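/- arXiv:2601.23213 — 2 statements merged into one kernel-verified Lean document; each statement's English description precedes it below -/
import Mathlib

section
/- Let 𝔥 be a map assigning a nonnegative real number 𝔥(P) to every probability vector P on every finite set, satisfying: (i) invariance under embedding and relabeling, i.e. 𝔥(P) = 𝔥(Q) whenever Q(f(x)) = P(x) for an injective map f and Q is zero elsewhere; (ii) monotonicity under mixing: 𝔥(P) ≤ 𝔥(S·P) for every doubly stochastic matrix S; (iii) additivity: 𝔥(P ⊗ Q) = 𝔥(P) + 𝔥(Q) for every Kronecker product of probability vectors; (iv) normalization: 𝔥((1/2,1/2)) = 1. Then there exists a Borel probability measure μ on [0,∞] such that 𝔥(P) = ∫_{[0,∞]} H_α(P) dμ(α) for every probability vector P. If axiom (iv) is dropped, the same conclusion holds with μ a finite positive Borel measure. -/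
open MeasureTheory
open scoped ENNReal

noncomputable section

/-- Base-2 logarithm. -/
def log2 (x : ℝ) : ℝ := Real.logb 2 x

/-- Base-2 exponential. -/
def exp2 (x : ℝ) : ℝ := (2 : ℝ) ^ x

/-- Rényi entropy of order `α ∈ [0,∞]` of a vector `p` on a finite set. -/
def renyi {X : Type*} [Fintype X] (α : ℝ≥0∞) (p : X → ℝ) : ℝ :=
  if α = 0 then log2 (Nat.card {x : X // 0 < p x})
  else if α = 1 then -∑ x, p x * log2 (p x)
  else if α = ⊤ then -log2 (⨆ x, p x)
  else (1 - α.toReal)⁻¹ * log2 (∑ x, p x ^ α.toReal)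

/-- A probability vector on a finite set. -/
def IsProbVec {X : Type*} [Fintype X] (p : X → ℝ) : Prop :=
  (∀ x, 0 ≤ p x) ∧ ∑ x, p x = 1

/-- A doubly stochastic matrix. -/
def DoublyStochastic {X : Type*} [Fintype X] (S : Matrix X X ℝ) : Prop :=
  (∀ i j, 0 ≤ S i j) ∧ (∀ i, ∑ j, S i j = 1) ∧ (∀ j, ∑ i, S i j = 1)

/-- `Q` is obtained from `P` by a conditionally mixing channel. -/
def CondMixed {X Y Y' : Type*} [Fintype X] [Fintype Y] [Fintype Y']
    (P : Matrix X Y ℝ) (Q : Matrix X Y' ℝ) : Prop :=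
  ∃ (k : ℕ) (S : Fin k → Matrix X X ℝ) (D : Fin k → Matrix Y Y' ℝ),
    (∀ i, DoublyStochastic (S i)) ∧
    (∀ i a b, 0 ≤ D i a b) ∧
    (∀ a, ∑ b, ∑ i, D i a b = 1) ∧
    Q = ∑ i, S i * P * D i

/-- A joint probability distribution on finite alphabets, viewed as a matrix. -/
def IsJointProb {X Y : Type*} [Fintype X] [Fintype Y] (P : Matrix X Y ℝ) : Prop :=
  (∀ x y, 0 ≤ P x y) ∧ ∑ x, ∑ y, P x y = 1

/-- Marginal on the conditioning system: the `y`-th column sum. -/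
def margY {X Y : Type*} [Fintype X] (P : Matrix X Y ℝ) (y : Y) : ℝ := ∑ x, P x y

/-- The conditioned distribution (normalized `y`-th column). -/
def condX {X Y : Type*} [Fintype X] (P : Matrix X Y ℝ) (y : Y) : X → ℝ :=
  fun x => P x y / margY P y

/-- The conditional entropy `H_{t,τ}`. -/
def Hbulk {X Y : Type*} [Fintype X] [Fintype Y] (t : ℝ) (τ : Measure ℝ≥0∞)
    (P : Matrix X Y ℝ) : ℝ :=
  t⁻¹ * log2 (∑ y ∈ Finset.univ.filter (fun y => 0 < margY P y),
    margY P y * exp2 (t * ∫ α, renyi α (condX P y) ∂τ))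

/-- The conditional entropy `H_{0,α}`. -/
def HzeroA {X Y : Type*} [Fintype X] [Fintype Y] (α : ℝ≥0∞) (P : Matrix X Y ℝ) : ℝ :=
  ∑ y ∈ Finset.univ.filter (fun y => 0 < margY P y), margY P y * renyi α (condX P y)

/-- The conditional entropy `H_{-∞,τ}`. -/
def HnegInf {X Y : Type*} [Fintype X] [Fintype Y] (τ : Measure ℝ≥0∞)
    (P : Matrix X Y ℝ) : ℝ :=
  sInf ((fun y => ∫ α, renyi α (condX P y) ∂τ) '' {y | 0 < margY P y})

/-- The conditional entropy `H_{+∞,0}`. -/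
def HposInf {X Y : Type*} [Fintype X] [Fintype Y] (P : Matrix X Y ℝ) : ℝ :=
  sSup ((fun y => renyi 0 (condX P y)) '' {y | 0 < margY P y})

/-- The parameter set `𝒟_bulk`. -/
def Dbulk : Set (ℝ × Measure ℝ≥0∞) :=
  {p | p.1 ≠ 0 ∧ IsProbabilityMeasure p.2 ∧
    ∀ (d n n' : ℕ) (P : Matrix (Fin d) (Fin n) ℝ) (Q : Matrix (Fin d) (Fin n') ℝ),
      IsJointProb P → CondMixed P Q → Hbulk p.1 p.2 P ≤ Hbulk p.1 p.2 Q}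

/-- The parameter set `𝒟_{-∞}`. -/
def DnegInf : Set (Measure ℝ≥0∞) :=
  {τ | IsProbabilityMeasure τ ∧
    ∀ (d n n' : ℕ) (P : Matrix (Fin d) (Fin n) ℝ) (Q : Matrix (Fin d) (Fin n') ℝ),
      IsJointProb P → CondMixed P Q → HnegInf τ P ≤ HnegInf τ Q}

/-- `P'` is obtained from `P` by relabeling (injections) and embedding, with zeros elsewhere. -/
def Embeds {X Y X' Y' : Type*} [Fintype X] [Fintype Y] [Fintype X'] [Fintype Y']
    (P : Matrix X Y ℝ) (P' : Matrix X' Y' ℝ) : Prop :=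
  ∃ (f : X ↪ X') (g : Y ↪ Y'),
    (∀ x y, P' (f x) (g y) = P x y) ∧
    (∀ x' y', P' x' y' ≠ 0 → (∃ x, f x = x') ∧ (∃ y, g y = y'))

/-- Conditional majorization: after a common embedding, a conditionally mixing channel maps
(the embedding of) `P` to (the embedding of) `Q`. -/
def CondMajorizes {X Y X' Y' : Type*} [Fintype X] [Fintype Y] [Fintype X'] [Fintype Y']
    (P : Matrix X Y ℝ) (Q : Matrix X' Y' ℝ) : Prop :=
  ∃ (m n n' : ℕ) (P' : Matrix (Fin m) (Fin n) ℝ) (Q' : Matrix (Fin m) (Fin n') ℝ),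
    Embeds P P' ∧ Embeds Q Q' ∧ CondMixed P' Q'

/-- Kronecker product of matrices. -/
def kron {X Y X' Y' : Type*} (P : Matrix X Y ℝ) (Q : Matrix X' Y' ℝ) :
    Matrix (X × X') (Y × Y') ℝ :=
  Matrix.of fun x y => P x.1 y.1 * Q x.2 y.2

/-- `n`-fold Kronecker power of a matrix. -/
def kronPow {X Y : Type*} (P : Matrix X Y ℝ) (n : ℕ) :
    Matrix (Fin n → X) (Fin n → Y) ℝ :=
  Matrix.of fun x y => ∏ i, P (x i) (y i)

/-- Sum of all entries of a matrix. -/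
def totalMass {X Y : Type*} [Fintype X] [Fintype Y] (P : Matrix X Y ℝ) : ℝ :=
  ∑ x, ∑ y, P x y

/-- `α/(1-α)`, with the convention that it equals `-1` at `α = ∞`. -/
def aRatio (α : ℝ≥0∞) : ℝ := if α = ⊤ then -1 else α.toReal / (1 - α.toReal)

/-- `α/(α-1)`, with the convention that it equals `1` at `α = ∞`. -/
def aRatio' (α : ℝ≥0∞) : ℝ := if α = ⊤ then 1 else α.toReal / (α.toReal - 1)

/-- Rényi relative entropy `D_α(p‖r)`. -/
def relRenyi {X : Type*} [Fintype X] (α : ℝ≥0∞) (p r : X → ℝ) : ℝ :=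
  if α = 1 then ∑ x, p x * log2 (p x / r x)
  else if α = ⊤ then log2 (⨆ x, p x / r x)
  else (α.toReal - 1)⁻¹ * log2 (∑ x, p x ^ α.toReal * r x ^ (1 - α.toReal))

/-- The quantity `I_{t,τ}(P‖R)`. -/
def Ibulk {X Y : Type*} [Fintype X] [Fintype Y] (t : ℝ) (τ : Measure ℝ≥0∞)
    (P : Matrix X Y ℝ) (R : X → ℝ) : ℝ :=
  -t⁻¹ * log2 (∑ y ∈ Finset.univ.filter (fun y => 0 < margY P y),
    margY P y * exp2 (-t * ∫ α, relRenyi α (condX P y) R ∂τ))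

/-- The quantity `I_{-∞,τ}(P‖R)`. -/
def InegInf {X Y : Type*} [Fintype X] [Fintype Y] (τ : Measure ℝ≥0∞)
    (P : Matrix X Y ℝ) (R : X → ℝ) : ℝ :=
  sSup ((fun y => ∫ α, relRenyi α (condX P y) R ∂τ) '' {y | 0 < margY P y})

/-- A conditioned `R`-preserving channel maps `P` to `Q`. -/
def CondPreserving {X Y Y' : Type*} [Fintype X] [Fintype Y] [Fintype Y'] (R : X → ℝ)
    (P : Matrix X Y ℝ) (Q : Matrix X Y' ℝ) : Prop :=
  ∃ (k : ℕ) (G : Fin k → Matrix X X ℝ) (D : Fin k → Matrix Y Y' ℝ),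
    (∀ i a b, 0 ≤ G i a b) ∧
    (∀ i b, ∑ a, G i a b = 1) ∧
    (∀ i, (G i).mulVec R = R) ∧
    (∀ i a b, 0 ≤ D i a b) ∧
    (∀ a, ∑ b, ∑ i, D i a b = 1) ∧
    Q = ∑ i, G i * P * D i

/-- Total variation distance between two matrices. -/
def tvDist {X Y : Type*} [Fintype X] [Fintype Y] (P Q : Matrix X Y ℝ) : ℝ :=
  (1 / 2) * ∑ x, ∑ y, |P x y - Q x y|


/-! ### Hardy–Littlewood–Pólya -/

theorem hc_abel : ∀ (N : ℕ) (a d : Fin N → ℝ) (c : ℝ), Monotone a → (∀ j, c ≤ a j) →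
    (∀ k, 0 ≤ ∑ j, if k ≤ j then d j else 0) → c * ∑ j, d j ≤ ∑ j, a j * d j := by
  intro N
  induction N with
  | zero => intro a d c _ _ _; simp
  | succ N ih =>
    intro a d c ha hc hk
    have h1 := ih (fun j => a j.succ) (fun j => d j.succ) (a 0)
      (fun i j hij => ha (Fin.succ_le_succ_iff.mpr hij)) (fun j => ha (Fin.zero_le _))
      (fun k => by
        have := hk k.succ
        rw [Fin.sum_univ_succ] at this
        simpa [Fin.succ_le_succ_iff] using this)
    have h0 : 0 ≤ ∑ j, d j := by simpa using hk 0
    rw [Fin.sum_univ_succ] at h0 ⊢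
    rw [Fin.sum_univ_succ]
    have := hc 0
    nlinarith

theorem hc_tail (N : ℕ) (b c : Fin N → ℝ) (hb : Monotone b) (hb0 : ∀ i, 0 ≤ b i)
    (hsum : ∑ i, b i = ∑ i, c i)
    (h : ∀ t, 0 ≤ t → ∑ i, min (b i) t ≤ ∑ i, min (c i) t) (k : Fin N) :
    0 ≤ ∑ j, if k ≤ j then b j - c j else 0 := by
  have h1 := h (b k) (hb0 k)
  have h2 : ∑ j, ((b j - c j) - (min (b j) (b k) - min (c j) (b k))) ≤
      ∑ j, if k ≤ j then b j - c j else 0 := by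
    apply Finset.sum_le_sum
    intro j _
    split_ifs with hj
    · have := hb hj
      rw [min_eq_right this]
      have := min_le_right (c j) (b k)
      linarith
    · have := hb (le_of_not_ge hj)
      rw [min_eq_left this]
      have := min_le_left (c j) (b k)
      linarith
  simp only [Finset.sum_sub_distrib] at h2
  linarith

theorem hc_hlp_fin (N : ℕ) (p q : Fin N → ℝ) (hp0 : ∀ i, 0 ≤ p i)
    (hsum : ∑ i, p i = ∑ i, q i)
    (h : ∀ t, 0 ≤ t → ∑ i, min (p i) t ≤ ∑ i, min (q i) t) :
    ∃ S : Matrix (Fin N) (Fin N) ℝ, DoublyStochastic S ∧ S.mulVec p = q := by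
  set R : Set (Fin N → ℝ) := Set.range (fun σ : Equiv.Perm (Fin N) => p ∘ σ) with hR
  have hK : q ∈ convexHull ℝ R := by
    by_contra hq
    have hcl : IsClosed (convexHull ℝ R) := (Set.finite_range _).isClosed_convexHull ℝ
    obtain ⟨f, u, hf, hu⟩ := geometric_hahn_banach_closed_point (convex_convexHull ℝ R) hcl hq
    set w : Fin N → ℝ := fun i => f (Pi.single i 1) with hw
    have hfw : ∀ v : Fin N → ℝ, f v = ∑ i, w i * v i := by
      intro v
      conv_lhs => rw [← Finset.univ_sum_single v]
      rw [map_sum]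
      refine Finset.sum_congr rfl fun i _ => ?_
      have : (Pi.single i (v i) : Fin N → ℝ) = v i • Pi.single i 1 := by
        rw [← Pi.single_smul]; simp
      rw [this, map_smul, smul_eq_mul, mul_comm]
    set τ := Tuple.sort w
    set π := Tuple.sort p
    have h1 : f (p ∘ (π * τ⁻¹ : Equiv.Perm (Fin N))) < u :=
      hf _ (subset_convexHull ℝ R ⟨_, rfl⟩)
    have e1 : f (p ∘ (π * τ⁻¹ : Equiv.Perm (Fin N))) = ∑ k, w (τ k) * p (π k) := by
      rw [hfw, ← Equiv.sum_comp τ]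
      simp
    have e2 : f q = ∑ k, w (τ k) * q (τ k) := by
      rw [hfw, ← Equiv.sum_comp τ]
    have hs1 : ∑ i, p (π i) = ∑ i, q (τ i) := by
      rw [Equiv.sum_comp π p, Equiv.sum_comp τ q, hsum]
    have ht := hc_tail N (fun k => p (π k)) (fun k => q (τ k)) (Tuple.monotone_sort p)
      (fun i => hp0 _) hs1
      (fun t ht => by
        rw [Equiv.sum_comp π (fun i => min (p i) t), Equiv.sum_comp τ (fun i => min (q i) t)]
        exact h t ht)
    rcases Nat.eq_zero_or_pos N with rfl | hN
    · rw [e1] at h1; rw [e2] at hu; simp at h1 hu; linarith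
    have := hc_abel N (fun k => w (τ k)) (fun k => p (π k) - q (τ k)) (w (τ ⟨0, hN⟩))
      (Tuple.monotone_sort w) (fun j => Tuple.monotone_sort w (by simp [Fin.le_def])) ht
    simp only [Finset.sum_sub_distrib, mul_sub] at this
    rw [hs1] at this
    simp at this
    linarith
  have hsub : convexHull ℝ R ⊆ {v | ∃ S : Matrix (Fin N) (Fin N) ℝ,
      DoublyStochastic S ∧ S.mulVec p = v} := by
    apply convexHull_min
    · rintro _ ⟨σ, rfl⟩
      refine ⟨fun i j => if σ i = j then 1 else 0, ⟨?_, ?_, ?_⟩, ?_⟩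
      · intro i j; dsimp only; split_ifs <;> norm_num
      · intro i; simp
      · intro j
        rw [← Equiv.sum_comp σ.symm]; simp
      · ext i; simp [Matrix.mulVec, dotProduct]
    · rintro _ ⟨S, ⟨hS1, hS2, hS3⟩, rfl⟩ _ ⟨T, ⟨hT1, hT2, hT3⟩, rfl⟩ a b ha hb hab
      refine ⟨a • S + b • T, ⟨?_, ?_, ?_⟩, ?_⟩
      · intro i j
        simp only [Matrix.add_apply, Matrix.smul_apply, smul_eq_mul]
        have := hS1 i j
        have := hT1 i j
        positivity
      · intro i
        simp only [Matrix.add_apply, Matrix.smul_apply, smul_eq_mul, Finset.sum_add_distrib,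
          ← Finset.mul_sum, hS2, hT2]
        linarith
      · intro i
        simp only [Matrix.add_apply, Matrix.smul_apply, smul_eq_mul, Finset.sum_add_distrib,
          ← Finset.mul_sum, hS3, hT3]
        linarith
      · rw [Matrix.add_mulVec, Matrix.smul_mulVec, Matrix.smul_mulVec]
  exact hsub hK

/-- Consequence for functionals. -/
theorem hc_major
    (H : ∀ (X : Type) [Fintype X], (X → ℝ) → ℝ)
    (h_embed : ∀ (X X' : Type) [Fintype X] [Fintype X'] (p : X → ℝ) (q : X' → ℝ)
      (f : X ↪ X'), IsProbVec p → (∀ x, q (f x) = p x) →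
      (∀ y, (∀ x, f x ≠ y) → q y = 0) → H X p = H X' q)
    (h_mono : ∀ (X : Type) [Fintype X] (p : X → ℝ) (S : Matrix X X ℝ),
      IsProbVec p → DoublyStochastic S → H X p ≤ H X (S.mulVec p))
    (X Y : Type) [Fintype X] [Fintype Y] (p : X → ℝ) (q : Y → ℝ)
    (hp : IsProbVec p) (hq : IsProbVec q) (hcard : Fintype.card X ≤ Fintype.card Y)
    (h : ∀ t, 0 < t → ∑ i, min (p i) t ≤ ∑ i, min (q i) t) : H X p ≤ H Y q := by
  classical
  set N := Fintype.card Y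
  let e : Y ≃ Fin N := Fintype.equivFin Y
  let f : X ↪ Fin N := (Fintype.equivFin X).toEmbedding.trans (Fin.castLEEmb hcard)
  let p' : Fin N → ℝ := fun i => ∑ x, if f x = i then p x else 0
  let q' : Fin N → ℝ := fun i => q (e.symm i)
  have hpf : ∀ x, p' (f x) = p x := by
    intro x; simp [p']
  have hpn : ∀ y, (∀ x, f x ≠ y) → p' y = 0 := by
    intro y hy; simp [p', hy]
  have hsum : ∀ g : ℝ → ℝ, g 0 = 0 → ∑ i, g (p' i) = ∑ x, g (p x) := by
    intro g hg
    have : ∑ x, g (p x) = ∑ i ∈ Finset.univ.map f, g (p' i) := by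
      rw [Finset.sum_map]; simp [hpf]
    rw [this]
    symm
    apply Finset.sum_subset (Finset.subset_univ _)
    intro i _ hi
    rw [hpn i (by intro x hx; apply hi; simp [← hx]), hg]
  have hsq : ∀ g : ℝ → ℝ, ∑ i, g (q' i) = ∑ x, g (q x) := fun g =>
    Equiv.sum_comp e.symm (fun y => g (q y))
  have hp'0 : ∀ i, 0 ≤ p' i := fun i => Finset.sum_nonneg fun x _ => by
    split_ifs
    · exact hp.1 x
    · exact le_rfl
  have hp' : IsProbVec p' := ⟨hp'0, by rw [← hp.2]; exact hsum id rfl⟩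
  have hq's : ∑ i, q' i = 1 := by rw [← hq.2]; exact hsq id
  obtain ⟨S, hS, hSp⟩ := hc_hlp_fin N p' q' hp'0 (by rw [hp'.2, hq's]) (by
    intro t ht
    rcases ht.eq_or_lt with rfl | ht
    · rw [Finset.sum_congr rfl (fun i _ => min_eq_right (hp'0 i)),
        Finset.sum_congr rfl (fun i _ => min_eq_right (hq.1 _))]
    · rw [hsum (fun z => min z t) (min_eq_left ht.le), hsq (fun z => min z t)]
      exact h t ht)
  rw [h_embed X (Fin N) p p' f hp hpf hpn,
    h_embed Y (Fin N) q q' e.toEmbedding hq (by simp [q']) (fun y hy => absurd (by simp) (hy (e.symm y))),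
    ← hSp]
  exact h_mono _ _ _ hp' hS


/-- partition function -/
def hcZ {ι : Type*} [Fintype ι] (p : ι → ℝ) (a : ℝ) : ℝ := ∑ i, p i ^ a

/-- log-partition function -/
def hcψ {ι : Type*} [Fintype ι] (p : ι → ℝ) (a : ℝ) : ℝ := Real.log (hcZ p a)

/-- its derivative -/
def hcD {ι : Type*} [Fintype ι] (p : ι → ℝ) (a : ℝ) : ℝ :=
  (∑ i, p i ^ a * Real.log (p i)) / hcZ p a

/-- power distribution -/
def hcP {ι : Type*} (p : ι → ℝ) (n : ℕ) (x : Fin n → ι) : ℝ := ∏ k, p (x k)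

section LD
variable {ι : Type*} [Fintype ι] {p : ι → ℝ}

theorem hcZ_pos (hp : ∀ i, 0 < p i) (h1 : ∑ i, p i = 1) (a : ℝ) : 0 < hcZ p a := by
  have : Nonempty ι := by
    by_contra hne
    rw [not_nonempty_iff] at hne
    simp at h1
  exact Finset.sum_pos (fun i _ => Real.rpow_pos_of_pos (hp i) a) Finset.univ_nonempty

theorem hcψ_deriv (hp : ∀ i, 0 < p i) (h1 : ∑ i, p i = 1) (a : ℝ) :
    HasDerivAt (hcψ p) (hcD p a) a := by
  have h : HasDerivAt (hcZ p) (∑ i, p i ^ a * Real.log (p i)) a := by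
    have := HasDerivAt.fun_sum (u := Finset.univ) (A := fun i (a : ℝ) => p i ^ a)
      (A' := fun i => p i ^ a * Real.log (p i)) (x := a)
      (fun i _ => (Real.hasStrictDerivAt_const_rpow (hp i) a).hasDerivAt)
    exact this
  exact h.log (hcZ_pos hp h1 a).ne'

theorem hcψ_one (h1 : ∑ i, p i = 1) : hcψ p 1 = 0 := by
  simp [hcψ, hcZ, h1]

theorem hcD_one (h1 : ∑ i, p i = 1) : hcD p 1 = ∑ i, p i * Real.log (p i) := by
  simp [hcD, hcZ, h1]

theorem hcψ_zero : hcψ p 0 = Real.log (Fintype.card ι) := by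
  simp [hcψ, hcZ]

theorem hcψ_lower (hp : ∀ i, 0 < p i) (a : ℝ) (i : ι) : a * Real.log (p i) ≤ hcψ p a := by
  rw [← Real.log_rpow (hp i)]
  apply Real.log_le_log (Real.rpow_pos_of_pos (hp i) a)
  exact Finset.single_le_sum (f := fun i => p i ^ a)
    (fun j _ => (Real.rpow_pos_of_pos (hp j) a).le) (Finset.mem_univ i)

theorem hcP_pos {ι : Type*} {p : ι → ℝ} (hp : ∀ i, 0 < p i) (n : ℕ) (x : Fin n → ι) : 0 < hcP p n x :=
  Finset.prod_pos fun _ _ => hp _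

theorem hcP_sum_rpow (hp : ∀ i, 0 < p i) (h1 : ∑ i, p i = 1) (n : ℕ) (a : ℝ) :
    ∑ x, hcP p n x ^ a = Real.exp (n * hcψ p a) := by
  rw [mul_comm, Real.exp_mul, hcψ, Real.exp_log (hcZ_pos hp h1 a), Real.rpow_natCast, hcZ,
    Fintype.sum_pow]
  refine Finset.sum_congr rfl fun x _ => ?_
  rw [hcP, ← Real.finsetProd_rpow _ _ (fun k _ => (hp _).le)]

theorem hcP_sum (h1 : ∑ i, p i = 1) (n : ℕ) : ∑ x, hcP p n x = 1 := by
  have := Fintype.sum_pow p n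
  rw [h1, one_pow] at this
  exact this.symm

theorem hc_tail1 (hp : ∀ i, 0 < p i) (h1 : ∑ i, p i = 1) (n : ℕ) (a s c : ℝ) :
    ∑ x with s * (n * c) ≤ s * Real.log (hcP p n x), hcP p n x ^ a ≤
      Real.exp (n * (hcψ p (a + s) - s * c)) := by
  calc _ ≤ ∑ x with s * (n * c) ≤ s * Real.log (hcP p n x),
        hcP p n x ^ (a + s) * Real.exp (- (s * (n * c))) := by
        apply Finset.sum_le_sum
        intro x hx
        rw [Finset.mem_filter] at hx
        have hP := hcP_pos hp n x
        rw [Real.rpow_add hP, mul_assoc]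
        apply le_mul_of_one_le_right (Real.rpow_pos_of_pos hP a).le
        rw [Real.rpow_def_of_pos hP, ← Real.exp_add]
        apply Real.one_le_exp
        linarith [hx.2]
    _ ≤ ∑ x, hcP p n x ^ (a + s) * Real.exp (- (s * (n * c))) := by
        apply Finset.sum_le_sum_of_subset_of_nonneg (Finset.subset_univ _)
        intro x _ _
        have hP := hcP_pos hp n x
        positivity
    _ = _ := by
        rw [← Finset.sum_mul, hcP_sum_rpow hp h1, ← Real.exp_add]
        congr 1; ring

theorem hc_exp_small {κ : ℝ} (hκ : 0 < κ) {c : ℝ} (hc : 0 < c) :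
    ∀ᶠ n : ℕ in Filter.atTop, Real.exp (-(n * κ)) ≤ c := by
  have : Filter.Tendsto (fun n : ℕ => Real.exp (-(n * κ))) Filter.atTop (nhds 0) := by
    apply Real.tendsto_exp_neg_atTop_nhds_zero.comp
    exact tendsto_natCast_atTop_atTop.atTop_mul_const hκ
  exact this.eventually_le_const hc

theorem hc_exists_right {f : ℝ → ℝ} {a d c : ℝ} (h : HasDerivAt f d a) (hc : d < c)
    {r : ℝ} (hr : 0 < r) : ∃ s > 0, f (a + s) < f a + s * c ∧ s < r := by
  have h2 : Filter.Tendsto (slope f a) (nhdsWithin a (Set.Ioi a)) (nhds d) :=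
    (hasDerivAt_iff_tendsto_slope.mp h).mono_left
      (nhdsWithin_mono a fun y (hy : a < y) => hy.ne')
  have h3 := ((h2.eventually_lt_const hc).and self_mem_nhdsWithin).and
    (nhdsWithin_le_nhds (gt_mem_nhds (show a < a + r by linarith)))
  obtain ⟨y, ⟨hy, hya⟩, hy1⟩ := h3.exists
  refine ⟨y - a, sub_pos.mpr hya, ?_, by linarith⟩
  rw [slope_def_field, div_lt_iff₀ (sub_pos.mpr hya)] at hy
  rw [add_sub_cancel]
  linarith

theorem hc_exists_left {f : ℝ → ℝ} {a d c : ℝ} (h : HasDerivAt f d a) (hc : c < d)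
    {r : ℝ} (hr : 0 < r) : ∃ s > 0, f (a - s) < f a - s * c ∧ s < r := by
  have h2 : Filter.Tendsto (slope f a) (nhdsWithin a (Set.Iio a)) (nhds d) :=
    (hasDerivAt_iff_tendsto_slope.mp h).mono_left
      (nhdsWithin_mono a fun y (hy : y < a) => hy.ne)
  have h3 := ((h2.eventually_const_lt hc).and (self_mem_nhdsWithin)).and
    (nhdsWithin_le_nhds (lt_mem_nhds (show a - r < a by linarith)))
  obtain ⟨y, ⟨hy, hya⟩, hy1⟩ := h3.exists
  have hya' : y < a := hya
  refine ⟨a - y, sub_pos.mpr hya, ?_, by linarith⟩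
  rw [slope_def_field, lt_div_iff_of_neg (by linarith)] at hy
  rw [sub_sub_cancel]
  linarith

theorem hc_window (hp : ∀ i, 0 < p i) (h1 : ∑ i, p i = 1) (a δ : ℝ) (hδ : 0 < δ) :
    ∀ᶠ n : ℕ in Filter.atTop, Real.exp (n * hcψ p a) / 2 ≤
      ∑ x with |Real.log (hcP p n x) - n * hcD p a| ≤ n * δ, hcP p n x ^ a := by
  have hd := hcψ_deriv hp h1 a
  obtain ⟨s, hs, hsr, -⟩ := hc_exists_right hd (show hcD p a < hcD p a + δ by linarith) one_pos
  obtain ⟨r, hr, hrl, -⟩ := hc_exists_left hd (show hcD p a - δ < hcD p a by linarith) one_pos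
  filter_upwards [hc_exp_small (κ := hcψ p a + s * (hcD p a + δ) - hcψ p (a + s)) (by linarith)
      (show (0 : ℝ) < 1 / 4 by norm_num),
    hc_exp_small (κ := hcψ p a - r * (hcD p a - δ) - hcψ p (a - r)) (by linarith)
      (show (0 : ℝ) < 1 / 4 by norm_num)] with n hn1 hn2
  have t1 := hc_tail1 hp h1 n a s (hcD p a + δ)
  have t2 := hc_tail1 hp h1 n a (-r) (hcD p a - δ)
  have b1 : Real.exp (n * (hcψ p (a + s) - s * (hcD p a + δ))) ≤
      Real.exp (n * hcψ p a) * (1 / 4) := by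
    calc _ = Real.exp (n * hcψ p a) *
          Real.exp (-(n * (hcψ p a + s * (hcD p a + δ) - hcψ p (a + s)))) := by
          rw [← Real.exp_add]; congr 1; ring
      _ ≤ _ := by gcongr
  have b2 : Real.exp (n * (hcψ p (a + -r) - -r * (hcD p a - δ))) ≤
      Real.exp (n * hcψ p a) * (1 / 4) := by
    calc _ = Real.exp (n * hcψ p a) *
          Real.exp (-(n * (hcψ p a - r * (hcD p a - δ) - hcψ p (a - r)))) := by
          rw [← Real.exp_add]; congr 1; rw [← sub_eq_add_neg]; ring
      _ ≤ _ := by gcongr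
  have hsum := hcP_sum_rpow hp h1 n a
  have hle : ∑ x, hcP p n x ^ a ≤
      ∑ x with |Real.log (hcP p n x) - n * hcD p a| ≤ n * δ, hcP p n x ^ a +
      ∑ x with s * (n * (hcD p a + δ)) ≤ s * Real.log (hcP p n x), hcP p n x ^ a +
      ∑ x with -r * (n * (hcD p a - δ)) ≤ -r * Real.log (hcP p n x), hcP p n x ^ a := by
    simp only [Finset.sum_filter]
    rw [← Finset.sum_add_distrib, ← Finset.sum_add_distrib]
    apply Finset.sum_le_sum
    intro x _
    have hP := (Real.rpow_pos_of_pos (hcP_pos hp n x) a).le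
    have n1 : (0 : ℝ) ≤ if |Real.log (hcP p n x) - n * hcD p a| ≤ n * δ then hcP p n x ^ a else 0 := by
      split_ifs <;> simp [hP]
    have n2 : (0 : ℝ) ≤ if s * (n * (hcD p a + δ)) ≤ s * Real.log (hcP p n x) then hcP p n x ^ a else 0 := by
      split_ifs <;> simp [hP]
    have n3 : (0 : ℝ) ≤ if -r * (n * (hcD p a - δ)) ≤ -r * Real.log (hcP p n x) then hcP p n x ^ a else 0 := by
      split_ifs <;> simp [hP]
    by_cases hc : |Real.log (hcP p n x) - n * hcD p a| ≤ n * δ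
    · rw [if_pos hc]; linarith
    · rw [not_le, lt_abs] at hc
      rcases hc with hc | hc
      · rw [if_pos (show s * (n * (hcD p a + δ)) ≤ s * Real.log (hcP p n x) by
          apply mul_le_mul_of_nonneg_left _ hs.le; linarith)]
        linarith
      · rw [if_pos (show -r * (n * (hcD p a - δ)) ≤ -r * Real.log (hcP p n x) by
          rw [neg_mul, neg_mul, neg_le_neg_iff]
          apply mul_le_mul_of_nonneg_left _ hr.le; linarith)]
        linarith
  linarith

theorem hc_F_upper (hp : ∀ i, 0 < p i) (h1 : ∑ i, p i = 1) (n : ℕ) (a τ : ℝ)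
    (ha0 : 0 ≤ a) (ha1 : a ≤ 1) :
    ∑ x, min (hcP p n x) (Real.exp (n * τ)) ≤ Real.exp (n * (hcψ p a + (1 - a) * τ)) := by
  have : Real.exp (n * (hcψ p a + (1 - a) * τ)) =
      ∑ x, hcP p n x ^ a * Real.exp (n * τ) ^ (1 - a) := by
    rw [← Finset.sum_mul, hcP_sum_rpow hp h1, ← Real.exp_mul, ← Real.exp_add]
    congr 1; ring
  rw [this]
  apply Finset.sum_le_sum
  intro x _
  have hP := hcP_pos hp n x
  set m := min (hcP p n x) (Real.exp (n * τ)) with hm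
  have hm0 : 0 < m := lt_min hP (Real.exp_pos _)
  calc m = m ^ a * m ^ (1 - a) := by rw [← Real.rpow_add hm0]; simp
    _ ≤ _ := by
      gcongr
      · exact min_le_left _ _
      · exact min_le_right _ _

theorem hc_G_upper (hp : ∀ i, 0 < p i) (h1 : ∑ i, p i = 1) (n : ℕ) (a τ : ℝ)
    (ha1 : 1 ≤ a) :
    ∑ x, max (hcP p n x - Real.exp (n * τ)) 0 ≤ Real.exp (n * (hcψ p a + (1 - a) * τ)) := by
  have : Real.exp (n * (hcψ p a + (1 - a) * τ)) =
      ∑ x, hcP p n x ^ a * Real.exp (n * τ) ^ (1 - a) := by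
    rw [← Finset.sum_mul, hcP_sum_rpow hp h1, ← Real.exp_mul, ← Real.exp_add]
    congr 1; ring
  rw [this]
  apply Finset.sum_le_sum
  intro x _
  have hP := hcP_pos hp n x
  have ht := Real.exp_pos (n * τ)
  apply max_le _ (by positivity)
  by_cases hle : hcP p n x ≤ Real.exp (n * τ)
  · have : 0 ≤ hcP p n x ^ a * Real.exp (n * τ) ^ (1 - a) := by positivity
    linarith
  · push Not at hle
    calc _ ≤ hcP p n x := by linarith
      _ = hcP p n x ^ a * hcP p n x ^ (1 - a) := by rw [← Real.rpow_add hP]; simp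
      _ ≤ _ := by
        apply mul_le_mul_of_nonneg_left _ (by positivity)
        exact Real.rpow_le_rpow_of_nonpos ht hle.le (by linarith)

theorem hc_F_lower (hp : ∀ i, 0 < p i) (h1 : ∑ i, p i = 1) (a τ : ℝ)
    (ha0 : 0 ≤ a) (ha1 : a ≤ 1) (c1 : 0 ≤ (1 - a) * (hcD p a - τ)) (c2 : 0 ≤ a * (τ - hcD p a))
    (η : ℝ) (hη : 0 < η) :
    ∀ᶠ n : ℕ in Filter.atTop, Real.exp (n * (hcψ p a + (1 - a) * τ - η)) ≤
      ∑ x, min (hcP p n x) (Real.exp (n * τ)) := by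
  filter_upwards [hc_window hp h1 a (η / 2) (by linarith),
    hc_exp_small (κ := η / 2) (by linarith) (show (0 : ℝ) < 1 / 2 by norm_num)] with n hn hs
  have hn0 : (0 : ℝ) ≤ n := Nat.cast_nonneg n
  calc Real.exp (n * (hcψ p a + (1 - a) * τ - η))
      = Real.exp (n * hcψ p a) * Real.exp (-(n * (η / 2))) *
          Real.exp (n * ((1 - a) * τ - η / 2)) := by
        rw [← Real.exp_add, ← Real.exp_add]; congr 1; ring
    _ ≤ Real.exp (n * hcψ p a) * (1 / 2) * Real.exp (n * ((1 - a) * τ - η / 2)) := by gcongr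
    _ ≤ (∑ x with |Real.log (hcP p n x) - n * hcD p a| ≤ n * (η / 2), hcP p n x ^ a) *
          Real.exp (n * ((1 - a) * τ - η / 2)) := by gcongr; linarith
    _ = ∑ x with |Real.log (hcP p n x) - n * hcD p a| ≤ n * (η / 2), hcP p n x ^ a *
          Real.exp (n * ((1 - a) * τ - η / 2)) := by rw [Finset.sum_mul]
    _ ≤ ∑ x with |Real.log (hcP p n x) - n * hcD p a| ≤ n * (η / 2),
          min (hcP p n x) (Real.exp (n * τ)) := by
        apply Finset.sum_le_sum
        intro x hx
        rw [Finset.mem_filter, abs_le] at hx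
        have hP := hcP_pos hp n x
        rw [Real.rpow_def_of_pos hP, ← Real.exp_add]
        have k1 := mul_nonneg hn0 c1
        have k2 := mul_nonneg hn0 c2
        have k3 := mul_nonneg hn0 hη.le
        have k4 : 0 ≤ (1 - a) * (Real.log (hcP p n x) - n * hcD p a + n * (η / 2)) :=
          mul_nonneg (by linarith) (by linarith [hx.2.1])
        have k5 : 0 ≤ a * (n * (η / 2) - (Real.log (hcP p n x) - n * hcD p a)) :=
          mul_nonneg (by linarith) (by linarith [hx.2.2])
        have k6 : 0 ≤ a * (n * (η / 2)) := by positivity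
        have k7 : 0 ≤ (1 - a) * (n * (η / 2)) := mul_nonneg (by linarith) (by linarith)
        apply le_min
        · conv_rhs => rw [← Real.exp_log hP]
          rw [Real.exp_le_exp]
          nlinarith
        · rw [Real.exp_le_exp]
          nlinarith
    _ ≤ _ := by
        apply Finset.sum_le_sum_of_subset_of_nonneg (Finset.subset_univ _)
        intro x _ _
        exact le_min (hcP_pos hp n x).le (Real.exp_pos _).le

theorem hc_G_lower (hp : ∀ i, 0 < p i) (h1 : ∑ i, p i = 1) (a τ τ' : ℝ)
    (ha1 : 1 ≤ a) (c1 : τ ≤ hcD p a) (c2 : (a - 1) * (hcD p a - τ) = 0) (hτ : τ' < τ)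
    (η : ℝ) (hη : 0 < η) :
    ∀ᶠ n : ℕ in Filter.atTop, Real.exp (n * (hcψ p a + (1 - a) * τ - η)) ≤
      ∑ x, max (hcP p n x - Real.exp (n * τ')) 0 := by
  set δ := min ((τ - τ') / 2) (η / (2 * a)) with hδ
  have ha : 0 < a := by linarith
  have hδ0 : 0 < δ := lt_min (by linarith) (by positivity)
  have hδ1 : 2 * δ ≤ τ - τ' := by linarith [min_le_left ((τ - τ') / 2) (η / (2 * a))]
  have hδ2 : a * δ ≤ η / 2 := by
    calc a * δ ≤ a * (η / (2 * a)) := by gcongr; exact min_le_right _ _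
      _ = η / 2 := by field_simp
  filter_upwards [hc_window hp h1 a δ hδ0,
    hc_exp_small (κ := η / 2) (by linarith) (show (0 : ℝ) < 1 / 4 by norm_num),
    hc_exp_small (κ := δ) hδ0 (show (0 : ℝ) < 1 / 2 by norm_num)] with n hn hs hs2
  have hn0 : (0 : ℝ) ≤ n := Nat.cast_nonneg n
  calc Real.exp (n * (hcψ p a + (1 - a) * τ - η))
      = Real.exp (n * hcψ p a) * Real.exp (-(n * (η / 2))) *
          Real.exp (n * ((1 - a) * τ - η / 2)) := by
        rw [← Real.exp_add, ← Real.exp_add]; congr 1; ring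
    _ ≤ Real.exp (n * hcψ p a) * (1 / 4) * Real.exp (n * ((1 - a) * τ - η / 2)) := by gcongr
    _ = (Real.exp (n * hcψ p a) / 2) * (Real.exp (n * ((1 - a) * τ - η / 2)) / 2) := by ring
    _ ≤ (∑ x with |Real.log (hcP p n x) - n * hcD p a| ≤ n * δ, hcP p n x ^ a) *
          (Real.exp (n * ((1 - a) * τ - η / 2)) / 2) := by gcongr
    _ = ∑ x with |Real.log (hcP p n x) - n * hcD p a| ≤ n * δ, hcP p n x ^ a *
          (Real.exp (n * ((1 - a) * τ - η / 2)) / 2) := by rw [Finset.sum_mul]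
    _ ≤ ∑ x with |Real.log (hcP p n x) - n * hcD p a| ≤ n * δ,
          max (hcP p n x - Real.exp (n * τ')) 0 := by
        apply Finset.sum_le_sum
        intro x hx
        rw [Finset.mem_filter, abs_le] at hx
        have hP := hcP_pos hp n x
        apply le_max_of_le_left
        have e1 : Real.exp (n * τ') ≤ hcP p n x / 2 := by
          calc Real.exp (n * τ') ≤ Real.exp (Real.log (hcP p n x) + -(n * δ)) := by
                rw [Real.exp_le_exp]
                have := mul_le_mul_of_nonneg_left hδ1 hn0
                have := mul_le_mul_of_nonneg_left c1 hn0
                linarith [hx.2.1]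
            _ = hcP p n x * Real.exp (-(n * δ)) := by rw [Real.exp_add, Real.exp_log hP]
            _ ≤ hcP p n x * (1 / 2) := by gcongr
            _ = _ := by ring
        have e2 : hcP p n x ^ a * Real.exp (n * ((1 - a) * τ - η / 2)) ≤ hcP p n x := by
          conv_rhs => rw [← Real.exp_log hP]
          rw [Real.rpow_def_of_pos hP, ← Real.exp_add, Real.exp_le_exp]
          have k1 : (n : ℝ) * ((a - 1) * (hcD p a - τ)) = 0 := by rw [c2, mul_zero]
          have k2 := mul_nonneg (show 0 ≤ a - 1 by linarith)
            (show 0 ≤ n * δ - (Real.log (hcP p n x) - n * hcD p a) by linarith [hx.2.2])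
          have k3 := mul_le_mul_of_nonneg_left hδ2 hn0
          have k4 : 0 ≤ n * δ := by positivity
          nlinarith
        linarith
    _ ≤ _ := by
        apply Finset.sum_le_sum_of_subset_of_nonneg (Finset.subset_univ _)
        intro x _ _
        exact le_max_right _ _

end LD

section Compare
variable {ι κ : Type*} [Fintype ι] [Fintype κ] {p : ι → ℝ} {q : κ → ℝ}

theorem hc_caseA (hp : ∀ i, 0 < p i) (hp1 : ∑ i, p i = 1) (hq : ∀ i, 0 < q i)
    (hq1 : ∑ i, q i = 1) (h01 : ∀ a, 0 ≤ a → a < 1 → hcψ p a < hcψ q a)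
    (τ : ℝ) (hτ : τ < hcD p 1) :
    ∃ ε > 0, ∀ᶠ n : ℕ in Filter.atTop, ∀ τ', |τ' - τ| < ε →
      ∑ x, min (hcP p n x) (Real.exp (n * τ')) ≤ ∑ x, min (hcP q n x) (Real.exp (n * τ')) := by
  have hcont : Continuous (hcψ q) :=
    continuous_iff_continuousAt.mpr fun a => (hcψ_deriv hq hq1 a).continuousAt
  obtain ⟨a, ⟨ha0, ha1⟩, hmin⟩ := (isCompact_Icc (a := (0 : ℝ)) (b := 1)).exists_isMinOn
    ⟨0, by simp⟩ (f := fun a => hcψ q a + (1 - a) * τ) (by fun_prop)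
  have hmin' : ∀ b, 0 ≤ b → b ≤ 1 → hcψ q a + (1 - a) * τ ≤ hcψ q b + (1 - b) * τ :=
    fun b hb0 hb1 => hmin (show b ∈ Set.Icc (0 : ℝ) 1 from ⟨hb0, hb1⟩)
  have c1 : 0 ≤ (1 - a) * (hcD q a - τ) := by
    rcases ha1.eq_or_lt with rfl | ha1'
    · simp
    apply mul_nonneg (by linarith)
    by_contra hcon
    obtain ⟨s, hs, h2, h3⟩ := hc_exists_right (hcψ_deriv hq hq1 a) (c := τ) (by linarith)
      (r := 1 - a) (by linarith)
    have := hmin' (a + s) (by linarith) (by linarith)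
    linarith
  have c2 : 0 ≤ a * (τ - hcD q a) := by
    rcases ha0.eq_or_lt with rfl | ha0'
    · simp
    apply mul_nonneg (by linarith)
    by_contra hcon
    obtain ⟨s, hs, h2, h3⟩ := hc_exists_left (hcψ_deriv hq hq1 a) (c := τ) (by linarith)
      (r := a) (by linarith)
    have := hmin' (a - s) (by linarith) (by linarith)
    linarith
  obtain ⟨b, hb0, hb1, hb⟩ : ∃ b, 0 ≤ b ∧ b ≤ 1 ∧
      hcψ p b + (1 - b) * τ < hcψ q a + (1 - a) * τ := by
    rcases ha1.eq_or_lt with rfl | ha1'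
    · obtain ⟨s, hs, h2, h3⟩ := hc_exists_left (hcψ_deriv hp hp1 1) hτ (r := 1) one_pos
      refine ⟨1 - s, by linarith, by linarith, ?_⟩
      rw [hcψ_one hp1] at h2
      rw [hcψ_one hq1]
      linarith
    · exact ⟨a, ha0, ha1, by linarith [h01 a ha0 ha1']⟩
  set u := hcψ p b + (1 - b) * τ with hu
  set v := hcψ q a + (1 - a) * τ with hv
  refine ⟨(v - u) / 4, by linarith, ?_⟩
  filter_upwards [hc_F_lower hq hq1 a τ ha0 ha1 c1 c2 ((v - u) / 4) (by linarith)] with n hn τ' hτ'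
  have hn0 : (0 : ℝ) ≤ n := Nat.cast_nonneg n
  rw [abs_lt] at hτ'
  set ε := (v - u) / 4 with hε
  have hε0 : 0 < ε := by rw [hε]; linarith
  calc _ ≤ Real.exp (n * (hcψ p b + (1 - b) * τ')) := hc_F_upper hp hp1 n b τ' hb0 hb1
    _ ≤ Real.exp (-(n * ε) + n * (v - ε)) := by
        rw [Real.exp_le_exp]
        have k1 : (1 - b) * (τ' - τ) ≤ ε := by nlinarith
        have k2 : hcψ p b + (1 - b) * τ' ≤ -ε + (v - ε) := by
          have : v - u = 4 * ε := by rw [hε]; ring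
          nlinarith
        nlinarith
    _ ≤ Real.exp (-(n * ε)) * ∑ x, min (hcP q n x) (Real.exp (n * τ)) := by
        rw [Real.exp_add]; gcongr
    _ = ∑ x, Real.exp (-(n * ε)) * min (hcP q n x) (Real.exp (n * τ)) := Finset.mul_sum _ _ _
    _ ≤ _ := by
        apply Finset.sum_le_sum
        intro x _
        apply le_min
        · calc _ ≤ 1 * hcP q n x := by
                apply mul_le_mul _ (min_le_left _ _) _ zero_le_one
                · rw [Real.exp_le_one_iff]; nlinarith
                · exact le_min (hcP_pos hq n x).le (Real.exp_pos _).le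
            _ = _ := one_mul _
        · calc _ ≤ Real.exp (-(n * ε)) * Real.exp (n * τ) := by
                gcongr; exact min_le_right _ _
            _ ≤ _ := by
                rw [← Real.exp_add, Real.exp_le_exp]; nlinarith

theorem hc_caseB (hp : ∀ i, 0 < p i) (hp1 : ∑ i, p i = 1) (hq : ∀ i, 0 < q i)
    (hq1 : ∑ i, q i = 1) (h1i : ∀ a, 1 < a → hcψ q a < hcψ p a)
    (hmax : ∀ i, ∃ j, q i < p j)
    (τ : ℝ) (hτ : hcD q 1 < τ) :
    ∃ ε > 0, ∀ᶠ n : ℕ in Filter.atTop, ∀ τ', |τ' - τ| < ε →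
      ∑ x, max (hcP q n x - Real.exp (n * τ')) 0 ≤
        ∑ x, max (hcP p n x - Real.exp (n * τ')) 0 := by
  by_cases hbig : ∀ i, Real.log (q i) < τ
  · have hne : (Finset.univ : Finset κ).Nonempty := by
      rw [Finset.univ_nonempty_iff]
      by_contra hne
      rw [not_nonempty_iff] at hne
      simp at hq1
    obtain ⟨i, -, hi⟩ := Finset.exists_max_image Finset.univ (fun i => Real.log (q i)) hne
    refine ⟨τ - Real.log (q i), by linarith [hbig i], Filter.Eventually.of_forall ?_⟩
    intro n τ' hτ'
    rw [abs_lt] at hτ'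
    have hz : ∀ x, max (hcP q n x - Real.exp (n * τ')) 0 = 0 := by
      intro x
      apply max_eq_right
      rw [sub_nonpos, ← Real.exp_log (hcP_pos hq n x), Real.exp_le_exp, hcP,
        Real.log_prod (fun k _ => (hq _).ne')]
      calc _ ≤ ∑ _k : Fin n, τ' := Finset.sum_le_sum fun k _ => by
            linarith [hi (x k) (Finset.mem_univ _)]
        _ = _ := by simp
    rw [Finset.sum_congr rfl fun x _ => hz x]
    simp only [Finset.sum_const_zero]
    exact Finset.sum_nonneg fun x _ => le_max_right _ _
  · push Not at hbig
    obtain ⟨i, hi⟩ := hbig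
    obtain ⟨j, hj⟩ := hmax i
    have hL : τ < Real.log (p j) := lt_of_le_of_lt hi (Real.log_lt_log (hq i) hj)
    set L := Real.log (p j) with hLdef
    have hcont : Continuous (hcψ p) :=
      continuous_iff_continuousAt.mpr fun a => (hcψ_deriv hp hp1 a).continuousAt
    obtain ⟨A, hA1, hA⟩ : ∃ A > 1, 0 < A * (L - (τ + L) / 2) + (τ + L) / 2 := by
      have hpos : 0 < L - (τ + L) / 2 := by linarith
      refine ⟨1 + (1 + |(τ + L) / 2|) / (L - (τ + L) / 2), ?_, ?_⟩
      · have : 0 < (1 + |(τ + L) / 2|) / (L - (τ + L) / 2) := by positivity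
        linarith
      · rw [add_mul, div_mul_cancel₀ _ hpos.ne']
        linarith [neg_abs_le ((τ + L) / 2)]
    have hmn : ∀ σ, ∃ a, (1 ≤ a ∧ a ≤ A) ∧
        ∀ b, 1 ≤ b → b ≤ A → hcψ p a + (1 - a) * σ ≤ hcψ p b + (1 - b) * σ := by
      intro σ
      obtain ⟨a, ha, hmin⟩ := (isCompact_Icc (a := (1 : ℝ)) (b := A)).exists_isMinOn
        ⟨1, by simp [hA1.le]⟩ (f := fun a => hcψ p a + (1 - a) * σ) (by fun_prop)
      exact ⟨a, ha, fun b hb0 hb1 => hmin (show b ∈ Set.Icc (1 : ℝ) A from ⟨hb0, hb1⟩)⟩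
    obtain ⟨a, ⟨ha1, haA⟩, hmin⟩ := hmn τ
    obtain ⟨b, hb1, hb⟩ : ∃ b, 1 ≤ b ∧
        hcψ q b + (1 - b) * τ < hcψ p a + (1 - a) * τ := by
      rcases ha1.eq_or_lt with rfl | ha1'
      · obtain ⟨s, hs, h2, h3⟩ := hc_exists_right (hcψ_deriv hq hq1 1) hτ (r := 1) one_pos
        refine ⟨1 + s, by linarith, ?_⟩
        rw [hcψ_one hq1] at h2
        rw [hcψ_one hp1]
        linarith
      · exact ⟨a, ha1, by linarith [h1i a ha1']⟩
    set u := hcψ q b + (1 - b) * τ with hu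
    set v := hcψ p a + (1 - a) * τ with hv
    obtain ⟨ε, hε0, hε1, hε2, hε3⟩ : ∃ ε > 0, (A - 1) * (2 * ε) ≤ (v - u) / 4 ∧
        (b - 1) * ε ≤ (v - u) / 4 ∧ 2 * ε ≤ (L - τ) / 2 := by
      have hvu : 0 < (v - u) / 4 := by linarith
      have hD : 0 < 2 * (A + b) := by linarith
      refine ⟨min ((v - u) / 4 / (2 * (A + b))) ((L - τ) / 4),
        lt_min (by positivity) (by linarith), ?_, ?_, ?_⟩
      · have := min_le_left ((v - u) / 4 / (2 * (A + b))) ((L - τ) / 4)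
        rw [le_div_iff₀ hD] at this
        have h0 : 0 < min ((v - u) / 4 / (2 * (A + b))) ((L - τ) / 4) :=
          lt_min (by positivity) (by linarith)
        nlinarith
      · have := min_le_left ((v - u) / 4 / (2 * (A + b))) ((L - τ) / 4)
        rw [le_div_iff₀ hD] at this
        have h0 : 0 < min ((v - u) / 4 / (2 * (A + b))) ((L - τ) / 4) :=
          lt_min (by positivity) (by linarith)
        nlinarith
      · have := min_le_right ((v - u) / 4 / (2 * (A + b))) ((L - τ) / 4)
        linarith
    obtain ⟨a2, ⟨ha21, ha2A⟩, hmin2⟩ := hmn (τ + 2 * ε)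
    have hne : a2 ≠ A := by
      rintro rfl
      have k1 := hmin2 1 le_rfl hA1.le
      rw [hcψ_one hp1] at k1
      have k2 := hcψ_lower hp a2 j
      rw [← hLdef] at k2
      have k3 : (a2 - 1) * (τ + 2 * ε) ≤ (a2 - 1) * ((τ + L) / 2) := by
        apply mul_le_mul_of_nonneg_left <;> linarith
      nlinarith
    have ha2lt : a2 < A := lt_of_le_of_ne ha2A hne
    have c1 : τ + 2 * ε ≤ hcD p a2 := by
      by_contra hcon
      obtain ⟨s, hs, h2, h3⟩ := hc_exists_right (hcψ_deriv hp hp1 a2) (c := τ + 2 * ε)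
        (by linarith) (r := A - a2) (by linarith)
      have := hmin2 (a2 + s) (by linarith) (by linarith)
      nlinarith
    have c2 : (a2 - 1) * (hcD p a2 - (τ + 2 * ε)) = 0 := by
      rcases ha21.eq_or_lt with rfl | ha21'
      · simp
      have : hcD p a2 ≤ τ + 2 * ε := by
        by_contra hcon
        obtain ⟨s, hs, h2, h3⟩ := hc_exists_left (hcψ_deriv hp hp1 a2) (c := τ + 2 * ε)
          (by linarith) (r := a2 - 1) (by linarith)
        have := hmin2 (a2 - s) (by linarith) (by linarith)
        nlinarith
      rw [le_antisymm this c1, sub_self, mul_zero]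
    have hv2 : v - (v - u) / 4 ≤ hcψ p a2 + (1 - a2) * (τ + 2 * ε) := by
      have k1 := hmin a2 ha21 ha2A
      have k2 : (a2 - 1) * (2 * ε) ≤ (A - 1) * (2 * ε) := by
        apply mul_le_mul_of_nonneg_right <;> linarith
      linarith
    refine ⟨ε, hε0, ?_⟩
    filter_upwards [hc_G_lower hp hp1 a2 (τ + 2 * ε) (τ + ε) ha21 c1 c2 (by linarith)
      ((v - u) / 4) (by linarith)] with n hn τ' hτ'
    rw [abs_lt] at hτ'
    have hn0 : (0 : ℝ) ≤ n := Nat.cast_nonneg n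
    calc _ ≤ Real.exp (n * (hcψ q b + (1 - b) * τ')) := hc_G_upper hq hq1 n b τ' hb1
      _ ≤ Real.exp (n * (hcψ p a2 + (1 - a2) * (τ + 2 * ε) - (v - u) / 4)) := by
          rw [Real.exp_le_exp]
          apply mul_le_mul_of_nonneg_left _ hn0
          have : (b - 1) * (τ - τ') ≤ (b - 1) * ε := by
            apply mul_le_mul_of_nonneg_left <;> linarith
          linarith
      _ ≤ _ := hn
      _ ≤ _ := by
          apply Finset.sum_le_sum
          intro x _
          apply max_le_max_right
          apply sub_le_sub_left
          rw [Real.exp_le_exp]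
          apply mul_le_mul_of_nonneg_left _ hn0
          linarith

theorem hc_FG (hp1 : ∑ i, p i = 1) (n : ℕ) (t : ℝ) :
    ∑ x, min (hcP p n x) t = 1 - ∑ x, max (hcP p n x - t) 0 := by
  rw [← hcP_sum hp1 n, ← Finset.sum_sub_distrib]
  refine Finset.sum_congr rfl fun x _ => ?_
  rcases le_total (hcP p n x) t with h | h
  · rw [min_eq_left h, max_eq_right (by linarith)]; ring
  · rw [min_eq_right h, max_eq_left (by linarith)]; ring

theorem hc_compare (hp : ∀ i, 0 < p i) (hp1 : ∑ i, p i = 1) (hq : ∀ i, 0 < q i)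
    (hq1 : ∑ i, q i = 1) (h01 : ∀ a, 0 ≤ a → a < 1 → hcψ p a < hcψ q a)
    (h1i : ∀ a, 1 < a → hcψ q a < hcψ p a) (hD : hcD q 1 < hcD p 1)
    (hmax : ∀ i, ∃ j, q i < p j) (hcard : Fintype.card ι ≤ Fintype.card κ) :
    ∃ n : ℕ, 0 < n ∧ ∀ t, 0 < t →
      ∑ x, min (hcP p n x) t ≤ ∑ x, min (hcP q n x) t := by
  have hloc : ∀ τ : ℝ, ∃ ε > 0, ∀ᶠ n : ℕ in Filter.atTop, ∀ τ', |τ' - τ| < ε →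
      ∑ x, min (hcP p n x) (Real.exp (n * τ')) ≤
        ∑ x, min (hcP q n x) (Real.exp (n * τ')) := by
    intro τ
    rcases lt_or_ge τ (hcD p 1) with h | h
    · exact hc_caseA hp hp1 hq hq1 h01 τ h
    · obtain ⟨ε, hε, hev⟩ := hc_caseB hp hp1 hq hq1 h1i hmax τ (by linarith)
      refine ⟨ε, hε, hev.mono fun n hn τ' hτ' => ?_⟩
      rw [hc_FG hp1, hc_FG hq1]
      linarith [hn τ' hτ']
  obtain ⟨T, hT0, hTp, hTq⟩ : ∃ T ≤ 0, (∀ i, T ≤ Real.log (p i)) ∧ ∀ i, T ≤ Real.log (q i) := by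
    refine ⟨-(∑ i, |Real.log (p i)| + ∑ i, |Real.log (q i)|), ?_, ?_, ?_⟩
    · have : 0 ≤ ∑ i, |Real.log (p i)| := Finset.sum_nonneg fun _ _ => abs_nonneg _
      have : 0 ≤ ∑ i, |Real.log (q i)| := Finset.sum_nonneg fun _ _ => abs_nonneg _
      linarith
    · intro i
      have : 0 ≤ ∑ i, |Real.log (q i)| := Finset.sum_nonneg fun _ _ => abs_nonneg _
      have := Finset.single_le_sum (f := fun i => |Real.log (p i)|) (fun _ _ => abs_nonneg _)
        (Finset.mem_univ i)
      have := neg_abs_le (Real.log (p i))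
      linarith
    · intro i
      have : 0 ≤ ∑ i, |Real.log (p i)| := Finset.sum_nonneg fun _ _ => abs_nonneg _
      have := Finset.single_le_sum (f := fun i => |Real.log (q i)|) (fun _ _ => abs_nonneg _)
        (Finset.mem_univ i)
      have := neg_abs_le (Real.log (q i))
      linarith
  choose ε hε hev using hloc
  obtain ⟨s, -, hs⟩ := (isCompact_Icc (a := T) (b := 0)).elim_nhds_subcover
    (fun τ => Metric.ball τ (ε τ)) (fun τ _ => Metric.ball_mem_nhds τ (hε τ))
  have hall : ∀ᶠ n : ℕ in Filter.atTop, ∀ τ ∈ s, ∀ τ', |τ' - τ| < ε τ →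
      ∑ x, min (hcP p n x) (Real.exp (n * τ')) ≤
        ∑ x, min (hcP q n x) (Real.exp (n * τ')) := by
    rw [Filter.eventually_all_finset]
    exact fun τ _ => hev τ
  obtain ⟨n, hn, hn0⟩ := (hall.and (Filter.eventually_gt_atTop 0)).exists
  refine ⟨n, hn0, ?_⟩
  intro t ht
  have hnR : (0 : ℝ) < n := Nat.cast_pos.mpr hn0
  set τ' := Real.log t / n with hτ'
  have htexp : t = Real.exp (n * τ') := by
    rw [hτ', mul_div_cancel₀ _ hnR.ne', Real.exp_log ht]
  rcases lt_or_ge τ' T with h | h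
  · have hle : t ≤ Real.exp (n * T) := by
      rw [htexp, Real.exp_le_exp]; gcongr
    have e1 : ∀ x, min (hcP p n x) t = t := fun x => min_eq_right (by
      refine hle.trans ?_
      rw [← Real.exp_log (hcP_pos hp n x), Real.exp_le_exp, hcP,
        Real.log_prod (fun k _ => (hp _).ne')]
      calc _ = ∑ _k : Fin n, T := by simp
        _ ≤ _ := Finset.sum_le_sum fun k _ => hTp _)
    have e2 : ∀ x, min (hcP q n x) t = t := fun x => min_eq_right (by
      refine hle.trans ?_
      rw [← Real.exp_log (hcP_pos hq n x), Real.exp_le_exp, hcP,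
        Real.log_prod (fun k _ => (hq _).ne')]
      calc _ = ∑ _k : Fin n, T := by simp
        _ ≤ _ := Finset.sum_le_sum fun k _ => hTq _)
    simp only [e1, e2, Finset.sum_const, Finset.card_univ, nsmul_eq_mul, Fintype.card_fun,
      Fintype.card_fin]
    gcongr
  rcases le_or_gt τ' 0 with h0 | h0
  · have hmem := hs (show τ' ∈ Set.Icc T 0 from ⟨h, h0⟩)
    simp only [Set.mem_iUnion, Metric.mem_ball, Real.dist_eq] at hmem
    obtain ⟨τ, hτs, hτ⟩ := hmem
    rw [htexp]
    exact hn τ hτs τ' hτ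
  · have ht1 : 1 ≤ t := by
      rw [htexp]; apply Real.one_le_exp; positivity
    have e : ∀ x, min (hcP q n x) t = hcP q n x := fun x => min_eq_left (by
      refine le_trans ?_ ht1
      rw [← hcP_sum hq1 n]
      exact Finset.single_le_sum (f := hcP q n) (fun y _ => (hcP_pos hq n y).le)
        (Finset.mem_univ x))
    simp only [e]
    rw [hcP_sum hq1, ← hcP_sum hp1 n]
    exact Finset.sum_le_sum fun x _ => min_le_left _ _

end Compare

/-! ### From monotone additive data to a measure -/

/-- Rational differences of elements of `M`. -/
def hcT (M : AddSubmonoid (C(ℝ≥0∞, ℝ) × ℝ)) : Set (C(ℝ≥0∞, ℝ) × ℝ) :=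
  {z | ∃ N : ℕ, 0 < N ∧ ∃ m₁ ∈ M, ∃ m₂ ∈ M, (N : ℝ) • z = m₁ - m₂}

theorem hcT_add (M : AddSubmonoid (C(ℝ≥0∞, ℝ) × ℝ)) {z w : C(ℝ≥0∞, ℝ) × ℝ}
    (hz : z ∈ hcT M) (hw : w ∈ hcT M) : z + w ∈ hcT M := by
  obtain ⟨N, hN, a, ha, b, hb, h⟩ := hz
  obtain ⟨N', hN', a', ha', b', hb', h'⟩ := hw
  refine ⟨N * N', Nat.mul_pos hN hN', N' • a + N • a', M.add_mem (M.nsmul_mem ha _) (M.nsmul_mem ha' _),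
    N' • b + N • b', M.add_mem (M.nsmul_mem hb _) (M.nsmul_mem hb' _), ?_⟩
  calc ((N * N' : ℕ) : ℝ) • (z + w) = (N' : ℝ) • ((N : ℝ) • z) + (N : ℝ) • ((N' : ℝ) • w) := by
        push_cast; module
    _ = _ := by
        rw [h, h']
        simp only [← Nat.cast_smul_eq_nsmul ℝ]
        module

theorem hcT_smul (M : AddSubmonoid (C(ℝ≥0∞, ℝ) × ℝ)) {z : C(ℝ≥0∞, ℝ) × ℝ}
    (hz : z ∈ hcT M) (r : ℚ) : (r : ℝ) • z ∈ hcT M := by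
  obtain ⟨N, hN, a, ha, b, hb, h⟩ := hz
  have key : ((N * r.den : ℕ) : ℝ) • ((r : ℝ) • z) = (r.num : ℝ) • (a - b) := by
    rw [← h, smul_smul, smul_smul]
    congr 1
    have h2 : (r : ℝ) * r.den = r.num := by exact_mod_cast Rat.mul_den_eq_num r
    push_cast
    linear_combination (N : ℝ) * h2
  obtain ⟨k, hk | hk⟩ := Int.eq_nat_or_neg r.num
  · refine ⟨N * r.den, Nat.mul_pos hN r.den_pos, k • a, M.nsmul_mem ha _, k • b, M.nsmul_mem hb _, ?_⟩
    rw [key, hk]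
    simp only [← Nat.cast_smul_eq_nsmul ℝ]
    push_cast
    module
  · refine ⟨N * r.den, Nat.mul_pos hN r.den_pos, k • b, M.nsmul_mem hb _, k • a, M.nsmul_mem ha _, ?_⟩
    rw [key, hk]
    simp only [← Nat.cast_smul_eq_nsmul ℝ]
    push_cast
    module

theorem hcT_pos (M : AddSubmonoid (C(ℝ≥0∞, ℝ) × ℝ))
    (hM : ∀ z ∈ M, ∀ w ∈ M, (∀ α, z.1 α < w.1 α) → z.2 ≤ w.2) (c : ℝ) (hc0 : 0 ≤ c)
    (hc : ((1 : C(ℝ≥0∞, ℝ)), c) ∈ M) {z : C(ℝ≥0∞, ℝ) × ℝ} (hz : z ∈ hcT M)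
    (s : ℝ) (hs : 0 ≤ s) (hzs : ∀ α, -s ≤ z.1 α) : -(s * c) ≤ z.2 := by
  obtain ⟨N, hN, a, ha, b, hb, h⟩ := hz
  have hNR : (0 : ℝ) < N := Nat.cast_pos.mpr hN
  have hz1 : ∀ α, N * z.1 α = a.1 α - b.1 α := fun α => by
    have := congrArg (fun y => y.1 α) h
    simpa using this
  have hz2 : N * z.2 = a.2 - b.2 := by
    have := congrArg (fun y => y.2) h
    simpa using this
  have key : ∀ j : ℕ, -((j * N * s + 1) * c) ≤ j * (N * z.2) := by
    intro j
    set k := ⌊(j * N * s : ℝ)⌋₊ + 1 with hk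
    have hjs : (0 : ℝ) ≤ j * N * s := by positivity
    have hk1 : (j * N * s : ℝ) < k := by rw [hk]; push_cast; exact Nat.lt_floor_add_one _
    have hk2 : (k : ℝ) ≤ j * N * s + 1 := by
      rw [hk]; push_cast; linarith [Nat.floor_le hjs]
    have := hM (j • b) (M.nsmul_mem hb _) (j • a + k • ((1 : C(ℝ≥0∞, ℝ)), c))
      (M.add_mem (M.nsmul_mem ha _) (M.nsmul_mem hc _)) (by
        intro α
        have h1 := hz1 α
        have h2 : (j : ℝ) * N * (-s) ≤ j * N * z.1 α :=
          mul_le_mul_of_nonneg_left (hzs α) (by positivity)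
        have h3 : (j : ℝ) * (N * z.1 α) = j * (a.1 α - b.1 α) := by rw [h1]
        simp
        linarith)
    simp at this
    rw [hz2]
    have := mul_le_mul_of_nonneg_right hk2 hc0
    linarith
  by_contra hcon
  push Not at hcon
  obtain ⟨j, hj⟩ := exists_nat_gt (c / (N * (-(s * c) - z.2)))
  rw [div_lt_iff₀ (by apply mul_pos hNR; linarith)] at hj
  have := key j
  nlinarith

theorem hc_measure (M : AddSubmonoid (C(ℝ≥0∞, ℝ) × ℝ))
    (hM : ∀ z ∈ M, ∀ w ∈ M, (∀ α, z.1 α < w.1 α) → z.2 ≤ w.2) (c : ℝ)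
    (hc : ((1 : C(ℝ≥0∞, ℝ)), c) ∈ M) :
    ∃ μ : Measure ℝ≥0∞, IsFiniteMeasure μ ∧ ∀ z ∈ M, ∫ α, z.1 α ∂μ = z.2 := by
  have hc0 : 0 ≤ c := by
    have := hM 0 M.zero_mem _ hc (by simp)
    simpa using this
  set W := Submodule.span ℝ (M : Set (C(ℝ≥0∞, ℝ) × ℝ)) with hW
  have hWT : ∀ z ∈ W, z ∈ closure (hcT M) := by
    intro z hz
    induction hz using Submodule.span_induction with
    | mem x hx => exact subset_closure ⟨1, one_pos, x, hx, 0, M.zero_mem, by simp⟩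
    | zero => exact subset_closure ⟨1, one_pos, 0, M.zero_mem, 0, M.zero_mem, by simp⟩
    | add x y _ _ hx hy => exact map_mem_closure₂ continuous_add hx hy fun a ha b hb => hcT_add M ha hb
    | smul r x _ hx =>
      have hr : r ∈ closure (Set.range ((↑) : ℚ → ℝ)) := Rat.denseRange_cast r
      refine map_mem_closure₂ (f := fun (r : ℝ) (x : C(ℝ≥0∞, ℝ) × ℝ) => r • x) continuous_smul hr hx ?_
      rintro _ ⟨q, rfl⟩ b hb
      exact hcT_smul M hb q
  have hWpos : ∀ z ∈ W, (∀ α, 0 ≤ z.1 α) → 0 ≤ z.2 := by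
    intro z hz hz0
    have hcl := hWT z hz
    rw [Metric.mem_closure_iff] at hcl
    by_contra hneg
    push Not at hneg
    set ε := -z.2 / (c + 2) with hε
    have hε0 : 0 < ε := div_pos (by linarith) (by linarith)
    obtain ⟨w, hw, hd⟩ := hcl ε hε0
    rw [Prod.dist_eq, max_lt_iff] at hd
    have h1 : ∀ α, -ε ≤ w.1 α := by
      intro α
      have := (ContinuousMap.dist_apply_le_dist (f := z.1) (g := w.1) α).trans_lt hd.1
      rw [Real.dist_eq, abs_lt] at this
      linarith [hz0 α]
    have h2 := hcT_pos M hM c hc0 hc hw ε hε0.le h1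
    have h3 := hd.2
    rw [Real.dist_eq, abs_lt] at h3
    have h4 : ε * (c + 2) = -z.2 := by rw [hε]; field_simp
    nlinarith
  have hgraph : ∀ x ∈ W, x.fst = 0 → x.snd = 0 := by
    intro x hx hx0
    apply le_antisymm
    · have := hWpos (-x) (W.neg_mem hx) (by simp [hx0])
      simpa using this
    · exact hWpos x hx (by simp [hx0])
  let s : PointedCone ℝ C(ℝ≥0∞, ℝ) :=
    { carrier := {f | ∀ α, 0 ≤ f α}
      add_mem' := fun {a b} ha hb α => add_nonneg (ha α) (hb α)
      zero_mem' := fun α => le_rfl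
      smul_mem' := fun r f hf α => mul_nonneg r.2 (hf α) }
  set f := W.toLinearPMap with hf
  have hfg : ∀ x : f.domain, ((x : C(ℝ≥0∞, ℝ)), f x) ∈ W := fun x =>
    W.mem_graph_toLinearPMap hgraph x
  have hmemdom : ∀ z ∈ W, z.1 ∈ f.domain := by
    intro z hz
    rw [hf, Submodule.toLinearPMap_domain]
    exact ⟨z, hz, rfl⟩
  have h1W : ((1 : C(ℝ≥0∞, ℝ)), c) ∈ W := Submodule.subset_span hc
  obtain ⟨g, hg1, hg2⟩ := riesz_extension s f (fun x hx => hWpos _ (hfg x) hx) (by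
    intro y
    refine ⟨‖y‖ • ⟨1, hmemdom _ h1W⟩, ?_⟩
    intro α
    have := y.norm_coe_le_norm α
    rw [Real.norm_eq_abs] at this
    simp
    linarith [neg_abs_le (y α)])
  have hgM : ∀ z ∈ M, g z.1 = z.2 := by
    intro z hz
    have hzW : z ∈ W := Submodule.subset_span hz
    have h1 := hg1 ⟨z.1, hmemdom z hzW⟩
    have h2 := hfg ⟨z.1, hmemdom z hzW⟩
    have h3 := hgraph _ (W.sub_mem h2 hzW) (by simp)
    simp only [Prod.snd_sub] at h3
    simp only at h1
    linarith
  let Λ : CompactlySupportedContinuousMap ℝ≥0∞ ℝ →ₚ[ℝ] ℝ :=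
    PositiveLinearMap.mk₀
      { toFun := fun h => g h.toContinuousMap
        map_add' := fun a b => by
          rw [← map_add]; rfl
        map_smul' := fun r a => by
          rw [← map_smul]; rfl }
      (fun h hh => hg2 _ fun α => hh α)
  refine ⟨RealRMK.rieszMeasure Λ, inferInstance, ?_⟩
  intro z hz
  have := RealRMK.integral_rieszMeasure Λ (CompactlySupportedContinuousMap.continuousMapEquiv z.1)
  rw [← hgM z hz]
  exact this

/-! ### Rényi entropies of positive vectors -/

section Renyi
variable {ι κ : Type*} [Fintype ι] [Fintype κ] {p : ι → ℝ} {q : κ → ℝ}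

theorem hc_nonempty (h1 : ∑ i, p i = 1) : Nonempty ι := by
  by_contra hne
  rw [not_nonempty_iff] at hne
  simp at h1

theorem hc_dslope (h1 : ∑ i, p i = 1) {a : ℝ} (ha : a ≠ 1) :
    dslope (hcψ p) 1 a = hcψ p a / (a - 1) := by
  rw [dslope_of_ne _ ha, slope_def_field, hcψ_one h1, sub_zero]

theorem hc_renyi (hp : ∀ i, 0 < p i) (h1 : ∑ i, p i = 1) {α : ℝ≥0∞} (hα : α ≠ ⊤) :
    renyi α p = -(dslope (hcψ p) 1 α.toReal) / Real.log 2 := by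
  unfold renyi
  split_ifs with h h'
  · subst h
    rw [ENNReal.toReal_zero, hc_dslope h1 zero_ne_one, hcψ_zero]
    simp [log2, Real.logb, hp]
    ring
  · subst h'
    rw [ENNReal.toReal_one, dslope_same, (hcψ_deriv hp h1 1).deriv, hcD_one h1, neg_div,
      Finset.sum_div]
    simp [log2, Real.logb, mul_div_assoc]
  · have hne : α.toReal ≠ 1 := by
      intro h2; apply h'
      rw [← ENNReal.ofReal_toReal hα, h2, ENNReal.ofReal_one]
    rw [hc_dslope h1 hne, log2, Real.logb, hcψ, hcZ, ← neg_sub 1 α.toReal, div_neg, neg_neg]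
    ring

theorem hc_renyi_top {i : ι} (hi : ∀ j, p j ≤ p i) :
    renyi ⊤ p = -Real.log (p i) / Real.log 2 := by
  have : ⨆ x, p x = p i := by
    have : Nonempty ι := ⟨i⟩
    exact le_antisymm (ciSup_le hi) (le_ciSup (Set.finite_range p).bddAbove i)
  simp [renyi, this, log2, Real.logb, neg_div]

theorem hc_exists_max (h1 : ∑ i, p i = 1) : ∃ i, ∀ j, p j ≤ p i := by
  have := hc_nonempty h1
  exact Finite.exists_max p

theorem hcψ_upper (hp : ∀ i, 0 < p i) (h1 : ∑ i, p i = 1) {i : ι} (hi : ∀ j, p j ≤ p i) {a : ℝ}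
    (ha : 0 ≤ a) : hcψ p a ≤ a * Real.log (p i) + Real.log (Fintype.card ι) := by
  have := hc_nonempty h1
  rw [← Real.log_rpow (hp i), ← Real.log_mul (Real.rpow_pos_of_pos (hp i) a).ne'
    (by simp)]
  apply Real.log_le_log (hcZ_pos hp h1 a)
  calc hcZ p a ≤ ∑ _j : ι, p i ^ a := Finset.sum_le_sum fun j _ =>
        Real.rpow_le_rpow (hp j).le (hi j) ha
    _ = _ := by simp [mul_comm]

theorem hc_lim (hp : ∀ i, 0 < p i) (h1 : ∑ i, p i = 1) {i : ι} (hi : ∀ j, p j ≤ p i) :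
    Filter.Tendsto (dslope (hcψ p) 1) Filter.atTop (nhds (Real.log (p i))) := by
  set L := Real.log (p i)
  have hsub : Filter.Tendsto (fun a : ℝ => a - 1) Filter.atTop Filter.atTop :=
    Filter.tendsto_atTop_add_const_right _ _ Filter.tendsto_id
  have l1 : Filter.Tendsto (fun a : ℝ => L + L / (a - 1)) Filter.atTop (nhds L) := by
    simpa using (hsub.const_div_atTop L).const_add L
  have l2 : Filter.Tendsto (fun a : ℝ => L + (L + Real.log (Fintype.card ι)) / (a - 1))
      Filter.atTop (nhds L) := by
    simpa using (hsub.const_div_atTop (L + Real.log (Fintype.card ι))).const_add L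
  apply tendsto_of_tendsto_of_tendsto_of_le_of_le' l1 l2
  · filter_upwards [Filter.eventually_gt_atTop 1] with a ha
    rw [hc_dslope h1 ha.ne', le_div_iff₀ (by linarith), add_mul,
      div_mul_cancel₀ _ (by linarith)]
    linarith [hcψ_lower hp a i]
  · filter_upwards [Filter.eventually_gt_atTop 1] with a ha
    rw [hc_dslope h1 ha.ne', div_le_iff₀ (by linarith), add_mul,
      div_mul_cancel₀ _ (by linarith)]
    linarith [hcψ_upper hp h1 hi (show 0 ≤ a by linarith)]

theorem hc_toReal_atTop :
    Filter.Tendsto ENNReal.toReal (nhdsWithin ⊤ {⊤}ᶜ) Filter.atTop := by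
  rw [Filter.tendsto_atTop]
  intro b
  filter_upwards [nhdsWithin_le_nhds (lt_mem_nhds (ENNReal.ofReal_lt_top (r := b))),
    self_mem_nhdsWithin] with α h1 h2
  exact (ENNReal.ofReal_le_iff_le_toReal h2).mp h1.le

theorem hc_dslope_cont (hp : ∀ i, 0 < p i) (h1 : ∑ i, p i = 1) :
    Continuous (dslope (hcψ p) 1) := by
  rw [continuous_iff_continuousAt]
  intro a
  by_cases ha : a = 1
  · subst ha
    exact continuousAt_dslope_same.mpr (hcψ_deriv hp h1 1).differentiableAt
  · exact (continuousAt_dslope_of_ne ha).mpr (hcψ_deriv hp h1 a).continuousAt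

theorem hc_renyi_cont (hp : ∀ i, 0 < p i) (h1 : ∑ i, p i = 1) :
    Continuous (fun α => renyi α p) := by
  rw [continuous_iff_continuousAt]
  intro α
  by_cases hα : α = ⊤
  · subst hα
    obtain ⟨i, hi⟩ := hc_exists_max h1
    rw [continuousAt_iff_punctured_nhds, hc_renyi_top hi]
    have := (((hc_lim hp h1 hi).comp hc_toReal_atTop).neg).div_const (Real.log 2)
    refine this.congr' ?_
    filter_upwards [self_mem_nhdsWithin] with β hβ
    rw [hc_renyi hp h1 hβ]
    rfl
  · have h2 : ContinuousAt (fun β : ℝ≥0∞ => -(dslope (hcψ p) 1 β.toReal) / Real.log 2) α :=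
      (((hc_dslope_cont hp h1).continuousAt.comp
        (ENNReal.continuousAt_toReal hα)).neg).div_const _
    refine h2.congr ?_
    filter_upwards [isOpen_compl_singleton.mem_nhds hα] with β hβ
    rw [hc_renyi hp h1 hβ]

theorem hc_prod_sum (h1 : ∑ i, p i = 1) (h2 : ∑ i, q i = 1) :
    ∑ z : ι × κ, p z.1 * q z.2 = 1 := by
  rw [Fintype.sum_prod_type]
  simp [← Finset.mul_sum, h1, h2]

theorem hc_renyi_prod (hp : ∀ i, 0 < p i) (h1 : ∑ i, p i = 1) (hq : ∀ i, 0 < q i)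
    (h2 : ∑ i, q i = 1) (α : ℝ≥0∞) :
    renyi α (fun z : ι × κ => p z.1 * q z.2) = renyi α p + renyi α q := by
  have hpq : ∀ z : ι × κ, 0 < p z.1 * q z.2 := fun z => mul_pos (hp _) (hq _)
  have hs := hc_prod_sum h1 h2
  by_cases hα : α = ⊤
  · subst hα
    obtain ⟨i, hi⟩ := hc_exists_max h1
    obtain ⟨j, hj⟩ := hc_exists_max h2
    rw [hc_renyi_top hi, hc_renyi_top hj, hc_renyi_top (p := fun z : ι × κ => p z.1 * q z.2) (i := (i, j)) (fun z =>
      mul_le_mul (hi _) (hj _) (hq _).le (hp _).le), Real.log_mul (hp i).ne' (hq j).ne']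
    ring
  · have hψ : ∀ a, hcψ (fun z : ι × κ => p z.1 * q z.2) a = hcψ p a + hcψ q a := by
      intro a
      rw [hcψ, hcψ, hcψ, ← Real.log_mul (hcZ_pos hp h1 a).ne' (hcZ_pos hq h2 a).ne']
      congr 1
      rw [hcZ, hcZ, hcZ, Fintype.sum_prod_type, Finset.sum_mul_sum]
      refine Finset.sum_congr rfl fun i _ => Finset.sum_congr rfl fun j _ => ?_
      exact Real.mul_rpow (hp i).le (hq j).le
    rw [hc_renyi hp h1 hα, hc_renyi hq h2 hα, hc_renyi hpq hs hα, ← add_div, ← neg_add]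
    congr 2
    by_cases h : α.toReal = 1
    · rw [h, dslope_same, dslope_same, dslope_same, (hcψ_deriv hp h1 1).deriv,
        (hcψ_deriv hq h2 1).deriv]
      have : hcψ (fun z : ι × κ => p z.1 * q z.2) = fun a => hcψ p a + hcψ q a := funext hψ
      rw [this]
      exact ((hcψ_deriv hp h1 1).add (hcψ_deriv hq h2 1)).deriv
    · rw [hc_dslope h1 h, hc_dslope h2 h, hc_dslope hs h, hψ, add_div]

theorem hc_strict_conditions (hp : ∀ i, 0 < p i) (h1 : ∑ i, p i = 1) (hq : ∀ i, 0 < q i)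
    (h2 : ∑ i, q i = 1) (h : ∀ α, renyi α p < renyi α q) :
    (∀ a, 0 ≤ a → a < 1 → hcψ p a < hcψ q a) ∧ (∀ a, 1 < a → hcψ q a < hcψ p a) ∧
    hcD q 1 < hcD p 1 ∧ (∀ i, ∃ j, q i < p j) := by
  have hl2 : 0 < Real.log 2 := Real.log_pos (by norm_num)
  have hr : ∀ a : ℝ, 0 ≤ a → dslope (hcψ q) 1 a < dslope (hcψ p) 1 a := by
    intro a ha
    have := h (ENNReal.ofReal a)
    rw [hc_renyi hp h1 ENNReal.ofReal_ne_top, hc_renyi hq h2 ENNReal.ofReal_ne_top,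
      ENNReal.toReal_ofReal ha, div_lt_div_iff_of_pos_right hl2] at this
    linarith
  refine ⟨?_, ?_, ?_, ?_⟩
  · intro a ha ha1
    have := hr a ha
    rwa [hc_dslope h1 ha1.ne, hc_dslope h2 ha1.ne, div_lt_div_right_of_neg (by linarith)] at this
  · intro a ha1
    have := hr a (by linarith)
    rwa [hc_dslope h1 ha1.ne', hc_dslope h2 ha1.ne', div_lt_div_iff_of_pos_right (by linarith)] at this
  · have := hr 1 zero_le_one
    rwa [dslope_same, dslope_same, (hcψ_deriv hp h1 1).deriv, (hcψ_deriv hq h2 1).deriv] at this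
  · intro k
    obtain ⟨i, hi⟩ := hc_exists_max h1
    obtain ⟨j, hj⟩ := hc_exists_max h2
    have := h ⊤
    rw [hc_renyi_top hi, hc_renyi_top hj, div_lt_div_iff_of_pos_right hl2, neg_lt_neg_iff] at this
    exact ⟨i, lt_of_le_of_lt (hj k) ((Real.log_lt_log_iff (hq j) (hp i)).mp this)⟩

theorem hc_renyi_embed {X : Type*} [Fintype X] (r : X → ℝ) (hr : ∀ x, 0 ≤ r x)
    (hs : ∑ x, r x = 1) (α : ℝ≥0∞) :
    renyi α r = renyi α (fun x : {x // 0 < r x} => r x) := by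
  have hsum : ∀ g : ℝ → ℝ, g 0 = 0 → ∑ x, g (r x) = ∑ x : {x // 0 < r x}, g (r x) := by
    intro g hg
    rw [← Finset.sum_subtype (Finset.univ.filter fun x => 0 < r x) (by simp) (fun x => g (r x)),
      Finset.sum_filter_of_ne]
    intro x _ hx
    refine lt_of_le_of_ne (hr x) fun h => hx ?_
    rw [← h, hg]
  by_cases hα : α = ⊤
  · subst hα
    obtain ⟨i, hi⟩ := hc_exists_max hs
    have hi0 : 0 < r i := by
      by_contra h
      have : ∑ x, r x ≤ 0 := Finset.sum_nonpos fun x _ => (hi x).trans (not_lt.mp h)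
      linarith
    rw [hc_renyi_top hi, hc_renyi_top (p := fun x : {x // 0 < r x} => r x) (i := ⟨i, hi0⟩)
      (fun j => hi j)]
  unfold renyi
  split_ifs with h0 h1
  · congr 2
    exact Nat.card_congr ⟨fun x => ⟨x, x.2⟩, fun x => x.1, fun _ => rfl, fun _ => rfl⟩
  · have := hsum (fun y => y * log2 y) (by simp)
    rw [this]
  · have := hsum (fun y => y ^ α.toReal) (by
      apply Real.zero_rpow
      rw [ENNReal.toReal_ne_zero]; exact ⟨h0, hα⟩)
    rw [this]

end Renyi

/-! ### Final assembly -/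

theorem hc_H_zero
    (H : ∀ (X : Type) [Fintype X], (X → ℝ) → ℝ)
    (h_embed : ∀ (X X' : Type) [Fintype X] [Fintype X'] (p : X → ℝ) (q : X' → ℝ)
      (f : X ↪ X'), IsProbVec p → (∀ x, q (f x) = p x) →
      (∀ y, (∀ x, f x ≠ y) → q y = 0) → H X p = H X' q)
    (h_add : ∀ (X X' : Type) [Fintype X] [Fintype X'] (p : X → ℝ) (q : X' → ℝ),
      IsProbVec p → IsProbVec q →
      H (X × X') (fun z => p z.1 * q z.2) = H X p + H X' q)
    (U : Type) [Fintype U] [Unique U] (u : U → ℝ) (hu : ∀ x, u x = 1) : H U u = 0 := by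
  have hpv : IsProbVec u := ⟨fun x => by rw [hu]; exact zero_le_one, by simp [hu]⟩
  have h1 := h_add U U u u hpv hpv
  have h2 := h_embed U (U × U) u (fun z => u z.1 * u z.2) ⟨fun x => (x, x), fun x y h => by
    simpa using congrArg Prod.fst h⟩ hpv (by simp [hu]) (fun y hy => by
      exact absurd (Subsingleton.elim _ _) (hy y.1))
  linarith

theorem hc_H_pow
    (H : ∀ (X : Type) [Fintype X], (X → ℝ) → ℝ)
    (h_embed : ∀ (X X' : Type) [Fintype X] [Fintype X'] (p : X → ℝ) (q : X' → ℝ)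
      (f : X ↪ X'), IsProbVec p → (∀ x, q (f x) = p x) →
      (∀ y, (∀ x, f x ≠ y) → q y = 0) → H X p = H X' q)
    (h_add : ∀ (X X' : Type) [Fintype X] [Fintype X'] (p : X → ℝ) (q : X' → ℝ),
      IsProbVec p → IsProbVec q →
      H (X × X') (fun z => p z.1 * q z.2) = H X p + H X' q)
    (X : Type) [Fintype X] (p : X → ℝ) (hp : ∀ i, 0 < p i) (h1 : ∑ i, p i = 1) (n : ℕ) :
    H (Fin n → X) (hcP p n) = n * H X p := by
  have hpv : ∀ n, IsProbVec (hcP p n) := fun n =>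
    ⟨fun x => Finset.prod_nonneg fun k _ => (hp _).le, hcP_sum h1 n⟩
  have hpp : IsProbVec p := ⟨fun i => (hp i).le, h1⟩
  induction n with
  | zero =>
    rw [hc_H_zero H h_embed h_add (Fin 0 → X) (hcP p 0) (fun x => by simp [hcP])]
    simp
  | succ n ih =>
    have h2 := h_add X (Fin n → X) p (hcP p n) hpp (hpv n)
    have hpr : IsProbVec (fun z : X × (Fin n → X) => p z.1 * hcP p n z.2) :=
      ⟨fun z => mul_nonneg (hpp.1 _) ((hpv n).1 _), hc_prod_sum h1 (hpv n).2⟩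
    have h3 := h_embed (X × (Fin n → X)) (Fin (n + 1) → X) _ (hcP p (n + 1))
      (Fin.consEquiv (fun _ : Fin (n + 1) => X)).toEmbedding hpr
      (fun x => by simp [hcP, Fin.prod_univ_succ, Fin.consEquiv])
      (fun y hy => absurd (Equiv.apply_symm_apply (Fin.consEquiv (fun _ : Fin (n + 1) => X)) y)
        (hy _))
    rw [← h3, h2, ih]
    push_cast
    ring

theorem hc_H_le
    (H : ∀ (X : Type) [Fintype X], (X → ℝ) → ℝ)
    (h_embed : ∀ (X X' : Type) [Fintype X] [Fintype X'] (p : X → ℝ) (q : X' → ℝ)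
      (f : X ↪ X'), IsProbVec p → (∀ x, q (f x) = p x) →
      (∀ y, (∀ x, f x ≠ y) → q y = 0) → H X p = H X' q)
    (h_mono : ∀ (X : Type) [Fintype X] (p : X → ℝ) (S : Matrix X X ℝ),
      IsProbVec p → DoublyStochastic S → H X p ≤ H X (S.mulVec p))
    (h_add : ∀ (X X' : Type) [Fintype X] [Fintype X'] (p : X → ℝ) (q : X' → ℝ),
      IsProbVec p → IsProbVec q →
      H (X × X') (fun z => p z.1 * q z.2) = H X p + H X' q)
    (X Y : Type) [Fintype X] [Fintype Y] (p : X → ℝ) (q : Y → ℝ)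
    (hp : ∀ i, 0 < p i) (h1 : ∑ i, p i = 1) (hq : ∀ i, 0 < q i) (h2 : ∑ i, q i = 1)
    (h : ∀ α, renyi α p < renyi α q) : H X p ≤ H Y q := by
  obtain ⟨h01, h1i, hD, hmax⟩ := hc_strict_conditions hp h1 hq h2 h
  have := hc_nonempty h1
  have := hc_nonempty h2
  have hcard : Fintype.card X ≤ Fintype.card Y := by
    have h0 := h01 0 le_rfl one_pos
    rw [hcψ_zero, hcψ_zero, Real.log_lt_log_iff (by simp [Fintype.card_pos])
      (by simp [Fintype.card_pos])] at h0
    exact_mod_cast h0.le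
  obtain ⟨n, hn, hc⟩ := hc_compare hp h1 hq h2 h01 h1i hD hmax hcard
  have h3 := hc_major H h_embed h_mono (Fin n → X) (Fin n → Y) (hcP p n) (hcP q n)
    ⟨fun x => Finset.prod_nonneg fun k _ => (hp _).le, hcP_sum h1 n⟩
    ⟨fun x => Finset.prod_nonneg fun k _ => (hq _).le, hcP_sum h2 n⟩
    (by simpa using Nat.pow_le_pow_left hcard n) hc
  rw [hc_H_pow H h_embed h_add X p hp h1, hc_H_pow H h_embed h_add Y q hq h2] at h3
  exact le_of_mul_le_mul_left h3 (by exact_mod_cast hn)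

theorem hc_renyi_unif (α : ℝ≥0∞) : renyi α (fun _ : Fin 2 => (1 : ℝ) / 2) = 1 := by
  have hl2 : Real.log 2 ≠ 0 := (Real.log_pos (by norm_num)).ne'
  have hp : ∀ i : Fin 2, 0 < (fun _ : Fin 2 => (1 : ℝ) / 2) i := fun _ => by norm_num
  have h1 : ∑ i : Fin 2, (fun _ : Fin 2 => (1 : ℝ) / 2) i = 1 := by norm_num
  by_cases hα : α = ⊤
  · subst hα
    rw [hc_renyi_top (i := 0) (fun _ => le_rfl)]
    simp [hl2]
  have hψ : ∀ a, hcψ (fun _ : Fin 2 => (1 : ℝ) / 2) a = (1 - a) * Real.log 2 := by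
    intro a
    have : hcZ (fun _ : Fin 2 => (1 : ℝ) / 2) a = 2 ^ (1 - a) := by
      rw [hcZ, Real.rpow_sub two_pos, Real.rpow_one, Finset.sum_const, one_div,
        Real.inv_rpow two_pos.le]
      simp [div_eq_mul_inv]
    rw [hcψ, this, Real.log_rpow two_pos]
  rw [hc_renyi hp h1 hα]
  by_cases h : α.toReal = 1
  · rw [h, dslope_same, funext hψ]
    have : HasDerivAt (fun a : ℝ => (1 - a) * Real.log 2) (-1 * Real.log 2) 1 :=
      ((hasDerivAt_id (1 : ℝ)).const_sub 1).mul_const _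
    rw [this.deriv]
    field_simp
  · rw [hc_dslope h1 h, hψ]
    have : α.toReal - 1 ≠ 0 := sub_ne_zero.mpr h
    field_simp
    ring

theorem hc_main
    (H : ∀ (X : Type) [Fintype X], (X → ℝ) → ℝ)
    (h_embed : ∀ (X X' : Type) [Fintype X] [Fintype X'] (p : X → ℝ) (q : X' → ℝ)
      (f : X ↪ X'), IsProbVec p → (∀ x, q (f x) = p x) →
      (∀ y, (∀ x, f x ≠ y) → q y = 0) → H X p = H X' q)
    (h_mono : ∀ (X : Type) [Fintype X] (p : X → ℝ) (S : Matrix X X ℝ),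
      IsProbVec p → DoublyStochastic S → H X p ≤ H X (S.mulVec p))
    (h_add : ∀ (X X' : Type) [Fintype X] [Fintype X'] (p : X → ℝ) (q : X' → ℝ),
      IsProbVec p → IsProbVec q →
      H (X × X') (fun z => p z.1 * q z.2) = H X p + H X' q) :
    ∃ μ : Measure ℝ≥0∞, IsFiniteMeasure μ ∧
      ∀ (X : Type) [Fintype X] (p : X → ℝ), IsProbVec p → H X p = ∫ α, renyi α p ∂μ := by
  let M : AddSubmonoid (C(ℝ≥0∞, ℝ) × ℝ) :=
    { carrier := {z | ∃ (X : Type) (_ : Fintype X) (p : X → ℝ), (∀ i, 0 < p i) ∧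
        ∑ i, p i = 1 ∧ (∀ α, z.1 α = renyi α p) ∧ z.2 = H X p}
      zero_mem' := by
        refine ⟨Unit, inferInstance, fun _ => 1, fun _ => one_pos, by simp, fun α => ?_, ?_⟩
        · simp [renyi, log2]
        · exact (hc_H_zero H h_embed h_add Unit _ (fun _ => rfl)).symm
      add_mem' := by
        rintro z w ⟨X, _, p, hp, h1, hz, hz2⟩ ⟨Y, _, q, hq, h2, hw, hw2⟩
        refine ⟨X × Y, inferInstance, fun z => p z.1 * q z.2, fun z => mul_pos (hp _) (hq _),
          hc_prod_sum h1 h2, fun α => ?_, ?_⟩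
        · rw [hc_renyi_prod hp h1 hq h2, ← hz, ← hw]
          rfl
        · rw [h_add X Y p q ⟨fun i => (hp i).le, h1⟩ ⟨fun i => (hq i).le, h2⟩, ← hz2, ← hw2]
          rfl }
  obtain ⟨μ, hμ, hM⟩ := hc_measure M (by
    rintro z ⟨X, _, p, hp, h1, hz, hz2⟩ w ⟨Y, _, q, hq, h2, hw, hw2⟩ h
    rw [hz2, hw2]
    exact hc_H_le H h_embed h_mono h_add X Y p q hp h1 hq h2
      (fun α => by rw [← hz, ← hw]; exact h α))
    (H (Fin 2) (fun _ => (1 : ℝ) / 2))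
    ⟨Fin 2, inferInstance, fun _ => 1 / 2, fun _ => by norm_num, by norm_num,
      fun α => by rw [hc_renyi_unif]; rfl, rfl⟩
  refine ⟨μ, hμ, fun X _ p hp => ?_⟩
  have hpos : ∀ x : {x // 0 < p x}, 0 < (fun x : {x // 0 < p x} => p x) x := fun x => x.2
  have hsum : ∑ x : {x // 0 < p x}, p x = 1 := by
    rw [← hp.2, ← Finset.sum_subtype (Finset.univ.filter fun x => 0 < p x) (by simp)
      (fun x => p x), Finset.sum_filter_of_ne]
    intro x _ hx
    exact lt_of_le_of_ne (hp.1 x) (Ne.symm hx)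
  have hE := h_embed {x // 0 < p x} X (fun x => p x) p (Function.Embedding.subtype _)
    ⟨fun x => (hpos x).le, hsum⟩ (fun _ => rfl) (fun y hy => by
      by_contra h
      exact hy ⟨y, lt_of_le_of_ne (hp.1 y) (Ne.symm h)⟩ rfl)
  have := hM (⟨fun α => renyi α (fun x : {x // 0 < p x} => p x), hc_renyi_cont hpos hsum⟩,
    H {x // 0 < p x} (fun x => p x)) ⟨_, inferInstance, _, hpos, hsum, fun _ => rfl, rfl⟩
  rw [← hE, ← show _ = H {x // 0 < p x} (fun x => p x) from this]
  refine integral_congr_ae (Filter.Eventually.of_forall fun α => ?_)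
  exact (hc_renyi_embed p hp.1 hp.2 α).symm

/-- Complete characterization of (unconditional) entropies: any functional on
probability vectors over finite sets that is invariant under embedding/relabeling, monotone
under doubly stochastic (mixing) channels, and additive under Kronecker products is a
barycentre of Rényi entropies with respect to a finite positive Borel measure on `[0,∞]`,
which is a probability measure if the normalization axiom `𝔥((1/2,1/2)) = 1` holds. -/
theorem entropy_characterization
    (H : ∀ (X : Type) [Fintype X], (X → ℝ) → ℝ)
    (h_nonneg : ∀ (X : Type) [Fintype X] (p : X → ℝ), IsProbVec p → 0 ≤ H X p)
    (h_embed : ∀ (X X' : Type) [Fintype X] [Fintype X'] (p : X → ℝ) (q : X' → ℝ)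
      (f : X ↪ X'), IsProbVec p → (∀ x, q (f x) = p x) →
      (∀ y, (∀ x, f x ≠ y) → q y = 0) → H X p = H X' q)
    (h_mono : ∀ (X : Type) [Fintype X] (p : X → ℝ) (S : Matrix X X ℝ),
      IsProbVec p → DoublyStochastic S → H X p ≤ H X (S.mulVec p))
    (h_add : ∀ (X X' : Type) [Fintype X] [Fintype X'] (p : X → ℝ) (q : X' → ℝ),
      IsProbVec p → IsProbVec q →
      H (X × X') (fun z => p z.1 * q z.2) = H X p + H X' q) :
    (∃ μ : Measure ℝ≥0∞, IsFiniteMeasure μ ∧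
      ∀ (X : Type) [Fintype X] (p : X → ℝ), IsProbVec p → H X p = ∫ α, renyi α p ∂μ) ∧
    (H (Fin 2) (fun _ => (1 : ℝ) / 2) = 1 →
      ∃ μ : Measure ℝ≥0∞, IsProbabilityMeasure μ ∧
        ∀ (X : Type) [Fintype X] (p : X → ℝ), IsProbVec p → H X p = ∫ α, renyi α p ∂μ) := by
  obtain ⟨μ, hμ, hH⟩ := hc_main H h_embed h_mono h_add
  refine ⟨⟨μ, hμ, hH⟩, fun h => ⟨μ, ?_, hH⟩⟩
  have h1 := hH (Fin 2) (fun _ => (1 : ℝ) / 2) ⟨fun _ => by norm_num, by norm_num⟩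
  simp only [hc_renyi_unif] at h1
  rw [h, integral_const, smul_eq_mul, mul_one] at h1
  constructor
  rw [Measure.real] at h1
  rw [← ENNReal.ofReal_toReal (measure_ne_top μ Set.univ), ← h1, ENNReal.ofReal_one]
end
end

section
/- Let Φ assign to every matrix with nonnegative real entries (of every finite size) a value in [0,∞) such that: (i) Φ is invariant under permuting rows and columns and under adding or removing zero rows and columns; (ii) Φ(P ⊕ Q) = Φ(P) + Φ(Q) for direct sums of matrices; (iii) Φ(P ⊗ Q) = Φ(P)·Φ(Q) for Kronecker products; (iv) Φ of the 1×1 zero matrix equals 0 and Φ of the 1×1 matrix (1) equals 1; (v) Φ(P) ≤ Φ(Q) whenever Q is obtained from P by a conditionally mixing channel. Then there exists a finite positive Borel measure μ on [0,∞] such that for every matrix P with nonnegative entries, Φ(P) = ∑_{y: P_Y(y)>0} P_Y(y)·exp₂(∫_{[0,∞]} H_α(P_{X|Y=y}) dμ(α)), where P_Y(y) denotes the y-th column sum of P and P_{X|Y=y} the normalized y-th column. -/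
open MeasureTheory
open scoped ENNReal

noncomputable section

/-- Abstract properties of the restriction of the functional to column vectors. -/
structure GoodF (f : ∀ (X : Type) [Fintype X], (X → ℝ) → ℝ) : Prop where
  nonneg : ∀ (X : Type) [Fintype X] (p : X → ℝ), (∀ x, 0 ≤ p x) → 0 ≤ f X p
  inv : ∀ (X X' : Type) [Fintype X] [Fintype X'] (e : X ↪ X') (p : X → ℝ) (p' : X' → ℝ),
    (∀ x, 0 ≤ p x) → (∀ x, p' (e x) = p x) → (∀ x', p' x' ≠ 0 → ∃ x, e x = x') →
    f X p = f X' p'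
  mul : ∀ (X X' : Type) [Fintype X] [Fintype X'] (p : X → ℝ) (q : X' → ℝ),
    (∀ x, 0 ≤ p x) → (∀ x, 0 ≤ q x) → f (X × X') (fun z => p z.1 * q z.2) = f X p * f X' q
  ds : ∀ (X : Type) [Fintype X] (S : Matrix X X ℝ) (p : X → ℝ), DoublyStochastic S →
    (∀ x, 0 ≤ p x) → f X p ≤ f X (S.mulVec p)
  superadd : ∀ (X : Type) [Fintype X] (p q : X → ℝ), (∀ x, 0 ≤ p x) → (∀ x, 0 ≤ q x) →
    f X p + f X q ≤ f X (fun x => p x + q x)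
  smul : ∀ (X : Type) [Fintype X] (c : ℝ) (p : X → ℝ), 0 ≤ c → (∀ x, 0 ≤ p x) →
    f X (fun x => c * p x) = c * f X p
  one : f Unit (fun _ => 1) = 1

theorem ds_one {X : Type*} [Fintype X] [DecidableEq X] :
    DoublyStochastic (1 : Matrix X X ℝ) := by
  refine ⟨fun i j => ?_, fun i => ?_, fun j => ?_⟩
  · rw [Matrix.one_apply]; split_ifs <;> norm_num
  · simp [Matrix.one_apply]
  · simp [Matrix.one_apply]

theorem ds_swap {X : Type*} [Fintype X] [DecidableEq X] :
    DoublyStochastic (Matrix.fromBlocks 0 1 1 0 : Matrix (X ⊕ X) (X ⊕ X) ℝ) := by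
  refine ⟨fun i j => ?_, fun i => ?_, fun j => ?_⟩
  · rcases i with i | i <;> rcases j with j | j <;> simp [Matrix.one_apply] <;>
      split_ifs <;> norm_num
  · rcases i with i | i <;> simp [Matrix.one_apply]
  · rcases j with i | i <;> simp [Matrix.one_apply]

/-- An additive nonnegative function on nonnegative reals with value one at one is the identity. -/
theorem additive_eq_id (g : ℝ → ℝ) (h0 : ∀ x, 0 ≤ x → 0 ≤ g x)
    (hadd : ∀ x y, 0 ≤ x → 0 ≤ y → g (x + y) = g x + g y) (h1 : g 1 = 1) :
    ∀ x, 0 ≤ x → g x = x := by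
  have hz : g 0 = 0 := by have := hadd 0 0 le_rfl le_rfl; simp at this; exact this
  have hmono : ∀ x y, 0 ≤ x → x ≤ y → g x ≤ g y := by
    intro x y hx hxy
    have := hadd x (y - x) hx (by linarith)
    have h2 := h0 (y - x) (by linarith)
    rw [show x + (y - x) = y by ring] at this
    linarith
  have hn : ∀ (n : ℕ) x, 0 ≤ x → g (n * x) = n * g x := by
    intro n x hx
    induction n with
    | zero => simp [hz]
    | succ k ih =>
      have := hadd (k * x) x (by positivity) hx
      push_cast
      rw [show ((k : ℝ) + 1) * x = k * x + x by ring, this, ih]; ring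
  have hnat : ∀ n : ℕ, g n = n := by
    intro n; have := hn n 1 zero_le_one; simpa [h1] using this
  intro x hx
  have key : ∀ n : ℕ, |n * (g x - x)| ≤ 1 := by
    intro n
    have hnx : (0 : ℝ) ≤ n * x := by positivity
    have a1 := Nat.floor_le hnx
    have a2 := (Nat.lt_floor_add_one ((n : ℝ) * x)).le
    have b1 := hmono _ _ (Nat.cast_nonneg _) a1
    have b2 := hmono _ (((⌊(n : ℝ) * x⌋₊ + 1 : ℕ) : ℝ)) hnx (by push_cast; exact a2)
    rw [hnat, hn n x hx] at b1
    rw [hnat, hn n x hx] at b2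
    push_cast at b2
    rw [abs_le]; constructor <;> nlinarith
  by_contra hne
  have hpos : 0 < |g x - x| := abs_pos.mpr (sub_ne_zero.mpr hne)
  obtain ⟨n, hn'⟩ := exists_nat_gt (1 / |g x - x|)
  have := key n
  rw [abs_mul, Nat.abs_cast] at this
  rw [div_lt_iff₀ hpos] at hn'
  linarith

section PhiPart

theorem phi_main
    (Φ : ∀ (X Y : Type) [Fintype X] [Fintype Y], Matrix X Y ℝ → ℝ)
    (h_nonneg : ∀ (X Y : Type) [Fintype X] [Fintype Y] (P : Matrix X Y ℝ),
      (∀ x y, 0 ≤ P x y) → 0 ≤ Φ X Y P)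
    (h_inv : ∀ (X Y X' Y' : Type) [Fintype X] [Fintype Y] [Fintype X'] [Fintype Y']
      (P : Matrix X Y ℝ) (P' : Matrix X' Y' ℝ),
      (∀ x y, 0 ≤ P x y) → Embeds P P' → Φ X Y P = Φ X' Y' P')
    (h_add : ∀ (X Y X' Y' : Type) [Fintype X] [Fintype Y] [Fintype X'] [Fintype Y']
      (P : Matrix X Y ℝ) (Q : Matrix X' Y' ℝ),
      (∀ x y, 0 ≤ P x y) → (∀ x y, 0 ≤ Q x y) →
      Φ (X ⊕ X') (Y ⊕ Y') (Matrix.fromBlocks P 0 0 Q) = Φ X Y P + Φ X' Y' Q)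
    (h_mul : ∀ (X Y X' Y' : Type) [Fintype X] [Fintype Y] [Fintype X'] [Fintype Y']
      (P : Matrix X Y ℝ) (Q : Matrix X' Y' ℝ),
      (∀ x y, 0 ≤ P x y) → (∀ x y, 0 ≤ Q x y) →
      Φ (X × X') (Y × Y') (kron P Q) = Φ X Y P * Φ X' Y' Q)
    (h_zero : Φ (Fin 1) (Fin 1) 0 = 0)
    (h_one : Φ (Fin 1) (Fin 1) (Matrix.of fun _ _ => (1 : ℝ)) = 1)
    (h_mono : ∀ (X Y Y' : Type) [Fintype X] [Fintype Y] [Fintype Y']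
      (P : Matrix X Y ℝ) (Q : Matrix X Y' ℝ),
      (∀ x y, 0 ≤ P x y) → CondMixed P Q → Φ X Y P ≤ Φ X Y' Q) :
    ∃ f : ∀ (X : Type) [Fintype X], (X → ℝ) → ℝ, GoodF f ∧
      ∀ (X Y : Type) [Fintype X] [Fintype Y] (P : Matrix X Y ℝ), (∀ x y, 0 ≤ P x y) →
        Φ X Y P = ∑ y, f X (fun x => P x y) := by
  classical
  -- two-block decomposition
  have hcols : ∀ (X Y Y' : Type) [Fintype X] [Fintype Y] [Fintype Y']
      (P : Matrix X Y ℝ) (Q : Matrix X Y' ℝ), (∀ x y, 0 ≤ P x y) → (∀ x y, 0 ≤ Q x y) →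
      Φ X (Y ⊕ Y') (Matrix.fromCols P Q) = Φ X Y P + Φ X Y' Q := by
    intro X Y Y' _ _ _ P Q hP hQ
    have e1 : Φ X (Y ⊕ Y') (Matrix.fromCols P Q) =
        Φ (X ⊕ X) (Y ⊕ Y') (Matrix.fromBlocks P Q 0 0) := by
      apply h_inv
      · intro x y; rcases y with y | y <;> simp [hP, hQ]
      · refine ⟨Function.Embedding.inl, Function.Embedding.refl _, ?_, ?_⟩
        · intro x y; rcases y with y | y <;> simp
        · intro x y h
          rcases x with x | x
          · exact ⟨⟨x, rfl⟩, ⟨y, rfl⟩⟩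
          · exfalso; apply h; rcases y with y | y <;> simp
    rw [e1, ← h_add X Y X Y' P Q hP hQ]
    have dd : ∀ i : Fin 2, ∀ a b, 0 ≤ (![Matrix.fromBlocks 1 0 0 0,
        Matrix.fromBlocks 0 0 0 1] : Fin 2 → Matrix (Y ⊕ Y') (Y ⊕ Y') ℝ) i a b := by
      intro i a b
      fin_cases i <;> rcases a with a | a <;> rcases b with b | b <;>
        simp [Matrix.one_apply] <;> split_ifs <;> norm_num
    have dsum : ∀ a, ∑ b, ∑ i : Fin 2, (![Matrix.fromBlocks 1 0 0 0,
        Matrix.fromBlocks 0 0 0 1] : Fin 2 → Matrix (Y ⊕ Y') (Y ⊕ Y') ℝ) i a b = 1 := by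
      intro a
      rcases a with a | a <;> simp [Fin.sum_univ_two, Matrix.one_apply]
    have sds : ∀ i : Fin 2, DoublyStochastic ((![1,
        Matrix.fromBlocks 0 1 1 0] : Fin 2 → Matrix (X ⊕ X) (X ⊕ X) ℝ) i) := by
      intro i
      fin_cases i
      · exact ds_one
      · exact ds_swap
    apply le_antisymm
    · apply h_mono
      · intro x y; rcases x with x | x <;> rcases y with y | y <;> simp [hP, hQ]
      · refine ⟨2, _, _, sds, dd, dsum, ?_⟩
        simp [Fin.sum_univ_two, Matrix.fromBlocks_multiply, Matrix.fromBlocks_add]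
    · apply h_mono
      · intro x y; rcases x with x | x <;> rcases y with y | y <;> simp [hP, hQ]
      · refine ⟨2, _, _, sds, dd, dsum, ?_⟩
        simp [Fin.sum_univ_two, Matrix.fromBlocks_multiply, Matrix.fromBlocks_add]
  have hempty : ∀ (X Y : Type) [Fintype X] [Fintype Y] [IsEmpty Y]
      (P : Matrix X Y ℝ), Φ X Y P = 0 := by
    intro X Y _ _ _ P
    have e1 : Φ X Y P = Φ (X ⊕ Fin 1) (Fin 1) 0 := by
      apply h_inv
      · intro x y; exact isEmptyElim y
      · exact ⟨Function.Embedding.inl, ⟨fun y => isEmptyElim y, fun y => isEmptyElim y⟩,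
          fun x y => isEmptyElim y, fun x y h => absurd rfl h⟩
    have e2 : Φ (Fin 1) (Fin 1) 0 = Φ (X ⊕ Fin 1) (Fin 1) 0 := by
      apply h_inv
      · intro x y; exact le_rfl
      · exact ⟨Function.Embedding.inr, Function.Embedding.refl _,
          fun x y => rfl, fun x y h => absurd rfl h⟩
    rw [e1, ← e2, h_zero]
  let f : ∀ (X : Type) [Fintype X], (X → ℝ) → ℝ :=
    fun X _ p => Φ X Unit (Matrix.of fun x _ => p x)
  have hsum : ∀ (X Y : Type) [Fintype X] [Fintype Y] (P : Matrix X Y ℝ), (∀ x y, 0 ≤ P x y) →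
        Φ X Y P = ∑ y, f X (fun x => P x y) := by
    intro X Y iX iY
    refine @Fintype.induction_empty_option (fun Y iY => ∀ P : Matrix X Y ℝ, (∀ x y, 0 ≤ P x y) →
        Φ X Y P = ∑ y, f X (fun x => P x y)) ?_ ?_ ?_ Y iY
    · intro α β iβ e ih P hP
      let _ : Fintype α := Fintype.ofEquiv β e.symm
      have e1 : Φ X α (Matrix.of fun x y => P x (e y)) = Φ X β P := by
        apply h_inv
        · intro x y; exact hP _ _
        · refine ⟨Function.Embedding.refl _, e.toEmbedding, fun x y => rfl, fun x y _ =>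
            ⟨⟨x, rfl⟩, ⟨e.symm y, by simp⟩⟩⟩
      rw [← e1, ih (Matrix.of fun x y => P x (e y)) (fun x y => hP _ _)]
      exact Fintype.sum_equiv e _ _ (fun y => rfl)
    · intro P hP; rw [hempty]; simp
    · intro α iα ih P hP
      have e1 : Φ X (Unit ⊕ α) (Matrix.fromCols (Matrix.of fun x _ => P x none)
          (Matrix.of fun x y => P x (some y))) = Φ X (Option α) P := by
        apply h_inv
        · intro x y; rcases y with y | y <;> simp [hP]
        · refine ⟨Function.Embedding.refl _,
            ((Equiv.sumComm _ _).trans (Equiv.optionEquivSumPUnit α).symm).toEmbedding, ?_, ?_⟩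
          · intro x y; rcases y with y | y <;> simp
          · intro x y _
            exact ⟨⟨x, rfl⟩, ((Equiv.sumComm _ _).trans
              (Equiv.optionEquivSumPUnit α).symm).surjective y⟩
      rw [← e1, hcols, ih (Matrix.of fun x y => P x (some y)) (fun x y => hP _ _), Fintype.sum_option]
      · rfl
      · intro x y; exact hP _ _
      · intro x y; exact hP _ _
  have hmul : ∀ (X X' : Type) [Fintype X] [Fintype X'] (p : X → ℝ) (q : X' → ℝ),
      (∀ x, 0 ≤ p x) → (∀ x, 0 ≤ q x) →
      f (X × X') (fun z => p z.1 * q z.2) = f X p * f X' q := by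
    intro X X' _ _ p q hp hq
    simp only [f]
    rw [← h_mul _ _ _ _ (Matrix.of fun x _ => p x) (Matrix.of fun x _ => q x) (fun x _ => hp x) (fun x _ => hq x)]
    symm
    apply h_inv
    · intro x y; exact mul_nonneg (hp _) (hq _)
    · exact ⟨Function.Embedding.refl _, ⟨fun _ => (), fun a b _ => Subsingleton.elim _ _⟩,
        fun x y => rfl, fun x y _ => ⟨⟨x, rfl⟩, ⟨((), ()), rfl⟩⟩⟩
  have hinv : ∀ (X X' : Type) [Fintype X] [Fintype X'] (e : X ↪ X') (p : X → ℝ) (p' : X' → ℝ),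
      (∀ x, 0 ≤ p x) → (∀ x, p' (e x) = p x) → (∀ x', p' x' ≠ 0 → ∃ x, e x = x') →
      f X p = f X' p' := by
    intro X X' _ _ e p p' hp h1 h2
    apply h_inv
    · intro x y; exact hp x
    · exact ⟨e, Function.Embedding.refl _, fun x y => h1 x, fun x y h => ⟨h2 x h, ⟨y, rfl⟩⟩⟩
  have hsuper : ∀ (X : Type) [Fintype X] (p q : X → ℝ), (∀ x, 0 ≤ p x) → (∀ x, 0 ≤ q x) →
      f X p + f X q ≤ f X (fun x => p x + q x) := by
    intro X _ p q hp hq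
    simp only [f]
    rw [← hcols _ _ _ (Matrix.of fun x _ => p x) (Matrix.of fun x _ => q x) (fun x _ => hp x) (fun x _ => hq x)]
    apply h_mono
    · intro x y; rcases y with y | y <;> simp [hp, hq]
    · refine ⟨1, fun _ => 1, fun _ => Matrix.of fun _ _ => 1, fun _ => ds_one, ?_, ?_, ?_⟩
      · intro i a b; simp
      · intro a; simp
      · ext x y; simp [Matrix.mul_apply]
  have hone : f Unit (fun _ => 1) = 1 := by
    refine Eq.trans ?_ h_one
    symm
    apply h_inv
    · intro x y; simp
    · exact ⟨⟨fun _ => (), fun a b _ => Subsingleton.elim _ _⟩,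
        ⟨fun _ => (), fun a b _ => Subsingleton.elim _ _⟩, fun x y => rfl,
        fun x y _ => ⟨⟨0, rfl⟩, ⟨0, rfl⟩⟩⟩
  have hscal : ∀ c, 0 ≤ c → f Unit (fun _ => c) = c := by
    apply additive_eq_id (fun c => f Unit (fun _ => c))
    · intro x hx; exact h_nonneg _ _ _ (fun _ _ => hx)
    · intro a b ha hb
      apply le_antisymm _ (hsuper Unit (fun _ => a) (fun _ => b) (fun _ => ha) (fun _ => hb))
      by_cases hab : a + b = 0
      · have ha0 : a = 0 := by linarith
        have hb0 : b = 0 := by linarith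
        subst ha0 hb0
        simp only [add_zero]
        have := h_nonneg Unit Unit (Matrix.of fun _ _ => 0) (fun _ _ => le_rfl)
        change _ ≤ f Unit _ + f Unit _
        have h3 : 0 ≤ f Unit (fun _ => 0) := this
        linarith
      have hab' : 0 < a + b := lt_of_le_of_ne (by linarith) (Ne.symm hab)
      simp only [f]
      rw [← hcols _ _ _ (Matrix.of fun _ _ => a) (Matrix.of fun _ _ => b) (fun x _ => ha) (fun x _ => hb)]
      apply h_mono
      · intro x y; simp; linarith
      · refine ⟨1, fun _ => 1, fun _ => Matrix.fromCols (Matrix.of fun _ _ => a / (a + b))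
          (Matrix.of fun _ _ => b / (a + b)), fun _ => ds_one, ?_, ?_, ?_⟩
        · intro i x y; rcases y with y | y <;> simp <;> positivity
        · intro x; simp; field_simp
        · ext x y; rcases y with y | y <;> simp [Matrix.mul_apply] <;> field_simp
    · exact hone
  refine ⟨f, ⟨fun X _ p hp => h_nonneg _ _ _ (fun x _ => hp x), hinv, hmul, ?_, hsuper, ?_, hone⟩,
    hsum⟩
  · intro X _ S p hS hp
    apply h_mono
    · intro x y; exact hp x
    · refine ⟨1, fun _ => S, fun _ => 1, fun _ => hS, ?_, ?_, ?_⟩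
      · intro i a b; simp
      · intro a; simp
      · ext x y; simp [Matrix.mul_apply, Matrix.mulVec, dotProduct]
  · intro X _ c p hc hp
    have := hmul Unit X (fun _ => c) p (fun _ => hc) hp
    rw [hscal c hc] at this
    rw [← this]
    exact hinv _ _ ⟨fun x => ((), x), fun a b h => by simpa using h⟩ _ _
      (fun x => mul_nonneg hc (hp x)) (fun x => rfl) (fun x _ => ⟨x.2, rfl⟩)

end PhiPart

theorem abel_nonneg : ∀ (n : ℕ) (w d : Fin n → ℝ) (c : ℝ), Monotone w → (∀ i, c ≤ w i) →
    (∀ k, 0 ≤ ∑ i, if k ≤ i then d i else 0) → 0 ≤ ∑ i, (w i - c) * d i := by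
  intro n
  induction n with
  | zero => intro w d c _ _ _; simp
  | succ n ih =>
    intro w d c hw hc hd
    have h1 := ih (fun i => w i.succ) (fun i => d i.succ) (w 0)
      (fun i j hij => hw (Fin.succ_le_succ_iff.mpr hij)) (fun i => hw (Fin.zero_le _)) (by
        intro k
        have := hd k.succ
        rw [Fin.sum_univ_succ] at this
        simpa using this)
    have h2 := hd 0
    simp only [Fin.zero_le, if_true] at h2
    have h3 := mul_nonneg (sub_nonneg.mpr (hc 0)) h2
    rw [Fin.sum_univ_succ] at h3 ⊢
    have h4 : ∑ i : Fin n, (w i.succ - c) * d i.succ =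
        ∑ i : Fin n, (w i.succ - w 0) * d i.succ + (w 0 - c) * ∑ i : Fin n, d i.succ := by
      rw [Finset.mul_sum, ← Finset.sum_add_distrib]
      apply Finset.sum_congr rfl; intro i _; ring
    rw [h4]; nlinarith

theorem GoodF.mono {f : ∀ (X : Type) [Fintype X], (X → ℝ) → ℝ} (hf : GoodF f)
    (X : Type) [Fintype X] (p q : X → ℝ) (hp : ∀ x, 0 ≤ p x) (hpq : ∀ x, p x ≤ q x) :
    f X p ≤ f X q := by
  have h1 := hf.superadd X p (fun x => q x - p x) hp (fun x => sub_nonneg.mpr (hpq x))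
  have h2 := hf.nonneg X (fun x => q x - p x) (fun x => sub_nonneg.mpr (hpq x))
  simp only [add_sub_cancel] at h1
  linarith

theorem weak_aux (n : ℕ) (w p q : Fin n → ℝ) (hw : ∀ i, 0 ≤ w i)
    (h : ∀ x, ∑ y, min (p y) (p x) ≤ ∑ y, min (q y) (p x)) :
    ∃ σ : Equiv.Perm (Fin n), ∑ i, w i * p (σ i) ≤ ∑ i, w i * q i := by
  set s := Tuple.sort w with hs
  have hwm : Monotone (w ∘ s) := Tuple.monotone_sort w
  set r := Tuple.sort (fun i => - p i) with hr
  have hpm : Monotone ((fun i => - p i) ∘ r) := Tuple.monotone_sort _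
  have hpa : ∀ i j, i ≤ j → p (r j) ≤ p (r i) := fun i j hij => by
    have := hpm hij; simpa using this
  refine ⟨s.symm.trans r, ?_⟩
  have key := abel_nonneg n (w ∘ s) (fun i => q (s i) - p (r i)) 0 hwm (fun i => hw _) (by
    intro k
    have h1 := h (r k)
    rw [← Equiv.sum_comp r, ← Equiv.sum_comp s (fun y => min (q y) (p (r k)))] at h1
    have h2 : ∑ i, (min (p (r i)) (p (r k)) - if k ≤ i then 0 else p (r k)) =
        ∑ i, if k ≤ i then p (r i) else 0 := by
      apply Finset.sum_congr rfl; intro i _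
      split_ifs with hk
      · rw [min_eq_left (hpa _ _ hk)]; ring
      · rw [min_eq_right (hpa _ _ (not_le.mp hk).le)]; ring
    have h3 : ∑ i, (min (q (s i)) (p (r k)) - if k ≤ i then 0 else p (r k)) ≤
        ∑ i, if k ≤ i then q (s i) else 0 := by
      apply Finset.sum_le_sum; intro i _
      split_ifs with hk
      · simp
      · simp
    rw [Finset.sum_sub_distrib] at h2 h3
    have h4 : ∑ i, (if k ≤ i then q (s i) - p (r i) else 0) =
      (∑ i, if k ≤ i then q (s i) else 0) - ∑ i, if k ≤ i then p (r i) else 0 := by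
      rw [← Finset.sum_sub_distrib]
      apply Finset.sum_congr rfl; intro i _; split_ifs <;> simp
    rw [h4]; linarith)
  rw [← Equiv.sum_comp s, ← Equiv.sum_comp s (fun i => w i * q i)]
  simp only [Function.comp, sub_zero, mul_sub, Finset.sum_sub_distrib] at key
  simpa using key

theorem GoodF.weak_fin {f : ∀ (X : Type) [Fintype X], (X → ℝ) → ℝ} (hf : GoodF f)
    (n : ℕ) (p q : Fin n → ℝ) (hp : ∀ x, 0 ≤ p x)
    (h : ∀ x, ∑ y, min (p y) (p x) ≤ ∑ y, min (q y) (p x)) :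
    f (Fin n) p ≤ f (Fin n) q := by
  set C : Set (Fin n → ℝ) := convexHull ℝ (Set.range fun σ : Equiv.Perm (Fin n) => p ∘ σ) with hC
  have hCc : IsCompact C := (Set.finite_range _).isCompact_convexHull ℝ
  have hsub : C ⊆ {v | (∀ x, 0 ≤ v x) ∧ f (Fin n) p ≤ f (Fin n) v} := by
    apply convexHull_min
    · rintro _ ⟨σ, rfl⟩
      refine ⟨fun x => hp _, le_of_eq ?_⟩
      exact hf.inv _ _ σ.symm.toEmbedding _ _ hp (fun x => by simp) (fun x _ => ⟨σ x, by simp⟩)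
    · rintro u ⟨hu0, hu⟩ v ⟨hv0, hv⟩ a b ha hb hab
      refine ⟨fun x => by
        simp only [Pi.add_apply, Pi.smul_apply, smul_eq_mul]
        exact add_nonneg (mul_nonneg ha (hu0 x)) (mul_nonneg hb (hv0 x)), ?_⟩
      have h1 := hf.superadd _ (fun x => a * u x) (fun x => b * v x)
        (fun x => mul_nonneg ha (hu0 x)) (fun x => mul_nonneg hb (hv0 x))
      rw [hf.smul _ _ _ ha hu0, hf.smul _ _ _ hb hv0] at h1
      have h2 : f (Fin n) p ≤ a * f (Fin n) u + b * f (Fin n) v := by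
        calc f (Fin n) p = a * f (Fin n) p + b * f (Fin n) p := by rw [← add_mul, hab, one_mul]
          _ ≤ _ := by gcongr
      exact h2.trans h1
  have hex : ∃ v ∈ C, ∀ x, v x ≤ q x := by
    by_contra hcon
    push Not at hcon
    have hdisj : Disjoint C (Set.Iic q) := by
      rw [Set.disjoint_left]
      intro v hv hv'
      obtain ⟨x, hx⟩ := hcon v hv
      exact absurd (hv' x) (not_le.mpr hx)
    obtain ⟨g, u, v, hgu, huv, hgv⟩ := geometric_hahn_banach_compact_closed
      (convex_convexHull ℝ _) hCc (convex_Iic q) isClosed_Iic hdisj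
    have hg : ∀ y : Fin n → ℝ, g y = ∑ i, y i * g (Pi.single i 1) := by
      intro y
      conv_lhs => rw [pi_eq_sum_univ' y]
      rw [map_sum]
      apply Finset.sum_congr rfl; intro i _
      rw [map_smul, smul_eq_mul]
    have hneg : ∀ i, g (Pi.single i 1) ≤ 0 := by
      intro i
      by_contra hi
      push Not at hi
      have hq := hgv q (Set.mem_Iic.mpr le_rfl)
      set t := (g q - v) / g (Pi.single i 1) with ht
      have ht0 : 0 ≤ t := div_nonneg (by linarith) hi.le
      have := hgv (q - t • Pi.single i 1) (by
        rw [Set.mem_Iic]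
        have : (0 : Fin n → ℝ) ≤ t • Pi.single i 1 := by
          apply smul_nonneg ht0
          rw [Pi.single_nonneg]; norm_num
        simpa using this)
      rw [map_sub, map_smul, smul_eq_mul, ht, div_mul_cancel₀ _ hi.ne'] at this
      linarith
    obtain ⟨σ, hσ⟩ := weak_aux n (fun i => - g (Pi.single i 1)) p q
      (fun i => by have := hneg i; linarith) h
    have h1 := hgu (p ∘ σ) (subset_convexHull ℝ _ ⟨σ, rfl⟩)
    have h2 := hgv q (Set.mem_Iic.mpr le_rfl)
    rw [hg] at h1 h2
    have h3 : ∑ i, -g (Pi.single i 1) * p (σ i) = - ∑ i, (p ∘ σ) i * g (Pi.single i 1) := by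
      rw [← Finset.sum_neg_distrib]; apply Finset.sum_congr rfl; intro i _
      simp only [Function.comp]; ring
    have h4 : ∑ i, -g (Pi.single i 1) * q i = - ∑ i, q i * g (Pi.single i 1) := by
      rw [← Finset.sum_neg_distrib]; apply Finset.sum_congr rfl; intro i _
      ring
    rw [h3, h4] at hσ
    linarith
  obtain ⟨v, hv, hvq⟩ := hex
  exact (hsub hv).2.trans (hf.mono _ _ _ (hsub hv).1 hvq)

theorem GoodF.weak {f : ∀ (X : Type) [Fintype X], (X → ℝ) → ℝ} (hf : GoodF f)
    (X : Type) [Fintype X] (p q : X → ℝ) (hp : ∀ x, 0 ≤ p x) (hq : ∀ x, 0 ≤ q x)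
    (h : ∀ x, ∑ y, min (p y) (p x) ≤ ∑ y, min (q y) (p x)) :
    f X p ≤ f X q := by
  classical
  let e := Fintype.equivFin X
  have tr : ∀ p : X → ℝ, (∀ x, 0 ≤ p x) → f X p = f (Fin (Fintype.card X)) (p ∘ e.symm) :=
    fun p hp => hf.inv _ _ e.toEmbedding _ _ hp (fun x => by simp) (fun x _ => ⟨e.symm x, by simp⟩)
  rw [tr p hp, tr q hq]
  apply hf.weak_fin _ _ _ (fun x => hp _)
  intro x
  have := h (e.symm x)
  rw [← Equiv.sum_comp e.symm, ← Equiv.sum_comp e.symm (fun y => min (q y) (p (e.symm x)))] at this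
  exact this

/-- One-variable Polya theorem. -/
theorem polya_coeff (n : ℕ) (c : ℕ → ℝ)
    (hpos : ∀ z : ℝ, 0 < z → 0 < ∑ i ∈ Finset.range (n + 1), c i * z ^ i)
    (h0 : 0 < c 0) (hn : 0 < c n) :
    ∃ N : ℕ, ∀ k : ℕ, 0 ≤ ∑ i ∈ Finset.range (n + 1),
      c i * (if i ≤ k then (N.choose (k - i) : ℝ) else 0) := by
  let G : ℝ → ℝ → ℝ := fun ε x => ∑ i ∈ Finset.range (n + 1),
    c i * ((∏ l ∈ Finset.range i, (x - l * ε)) * ∏ l ∈ Finset.range (n - i), (1 - x - l * ε))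
  have hGc : Continuous (fun z : ℝ × ℝ => G z.1 z.2) := by
    simp only [G]; fun_prop
  have hG0 : ∀ x ∈ Set.Icc (0 : ℝ) 1, 0 < G 0 x := by
    rintro x ⟨hx0, hx1⟩
    simp only [G, mul_zero, sub_zero, Finset.prod_const, Finset.card_range]
    rcases hx1.eq_or_lt with rfl | hx1
    · rw [Finset.sum_range_succ, Finset.sum_eq_zero]
      · simpa using hn
      · intro i hi
        rw [Finset.mem_range] at hi
        have : n - i ≠ 0 := by omega
        simp [this]
    rcases hx0.eq_or_lt with rfl | hx0
    · rw [Finset.sum_range_succ', Finset.sum_eq_zero]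
      · simpa using h0
      · intro i hi; simp
    · have h1x : 0 < 1 - x := by linarith
      have := mul_pos (pow_pos h1x n) (hpos (x / (1 - x)) (div_pos hx0 h1x))
      rw [Finset.mul_sum] at this
      refine lt_of_lt_of_eq this ?_
      apply Finset.sum_congr rfl
      intro i hi
      rw [Finset.mem_range] at hi
      have : (1 - x) ^ n = (1 - x) ^ i * (1 - x) ^ (n - i) := by rw [← pow_add]; congr 1; omega
      rw [this, div_pow]
      field_simp
  have hev : ∀ᶠ ε in nhds (0 : ℝ), ∀ x ∈ Set.Icc (0 : ℝ) 1, 0 < G ε x := by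
    apply isCompact_Icc.eventually_forall_of_forall_eventually
    intro x hx
    exact hGc.continuousAt.eventually_const_lt (hG0 x hx)
  have hten : Filter.Tendsto (fun N : ℕ => 1 / (((N + n : ℕ) : ℝ) + 1)) Filter.atTop (nhds 0) :=
    tendsto_one_div_add_atTop_nhds_zero_nat.comp (Filter.tendsto_add_atTop_nat n)
  obtain ⟨N', hN'⟩ := (hten.eventually hev).exists
  refine ⟨N' + 1, fun k => ?_⟩
  set N := N' + 1 with hN
  set m : ℕ := N + n with hm
  have hm0 : (0 : ℝ) < m := by rw [hm, hN]; positivity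
  by_cases hk : k ≤ m
  · have hx := hN' (k / m) ⟨by positivity, by rw [div_le_one hm0]; exact_mod_cast hk⟩
    have he : (1 : ℝ) / (((N' + n : ℕ) : ℝ) + 1) = 1 / m := by
      rw [hm, hN]; push_cast; ring_nf
    rw [he] at hx
    have hd : ∀ a i : ℕ, ∏ l ∈ Finset.range i, ((a : ℝ) - l) = (a.descFactorial i : ℝ) := by
      intro a i
      rw [← descPochhammer_eval_eq_descFactorial, descPochhammer_eval_eq_prod_range]
    have hfac : G (1 / m) (k / m) * m ^ n = ∑ i ∈ Finset.range (n + 1),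
        c i * ((k.descFactorial i : ℝ) * ((m - k).descFactorial (n - i) : ℝ)) := by
      simp only [G]
      rw [Finset.sum_mul]
      apply Finset.sum_congr rfl
      intro i hi
      rw [Finset.mem_range] at hi
      rw [← hd, ← hd]
      have e1 : ∏ l ∈ Finset.range i, ((k : ℝ) / m - l * (1 / m)) =
          (∏ l ∈ Finset.range i, ((k : ℝ) - l)) / m ^ i := by
        rw [← Finset.card_range i, ← Finset.prod_const, Finset.card_range, ← Finset.prod_div_distrib]
        apply Finset.prod_congr rfl; intro l _; field_simp
      have e2 : ∏ l ∈ Finset.range (n - i), (1 - (k : ℝ) / m - l * (1 / m)) =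
          (∏ l ∈ Finset.range (n - i), (((m - k : ℕ) : ℝ) - l)) / m ^ (n - i) := by
        rw [← Finset.card_range (n - i), ← Finset.prod_const, Finset.card_range,
          ← Finset.prod_div_distrib]
        apply Finset.prod_congr rfl; intro l _
        rw [Nat.cast_sub hk]; field_simp
      rw [e1, e2]
      have : (m : ℝ) ^ n = (m : ℝ) ^ i * (m : ℝ) ^ (n - i) := by rw [← pow_add]; congr 1; omega
      rw [this]
      field_simp
    have hS : 0 < ∑ i ∈ Finset.range (n + 1),
        c i * ((k.descFactorial i : ℝ) * ((m - k).descFactorial (n - i) : ℝ)) := by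
      rw [← hfac]; positivity
    have hid : ∀ i ∈ Finset.range (n + 1), (N.factorial : ℝ) *
        ((k.descFactorial i : ℝ) * ((m - k).descFactorial (n - i) : ℝ)) =
        (k.factorial * (m - k).factorial : ℝ) *
          (if i ≤ k then (N.choose (k - i) : ℝ) else 0) := by
      intro i hi
      rw [Finset.mem_range] at hi
      split_ifs with hik
      · by_cases h2 : k - i ≤ N
        · have a1 := Nat.factorial_mul_descFactorial hik
          have a2 := Nat.factorial_mul_descFactorial (show n - i ≤ m - k by omega)
          have a3 := Nat.choose_mul_factorial_mul_factorial h2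
          have a4 : m - k - (n - i) = N - (k - i) := by omega
          rw [a4] at a2
          rw [← a1, ← a2, ← a3]; push_cast; ring
        · rw [Nat.choose_eq_zero_of_lt (by omega),
            Nat.descFactorial_eq_zero_iff_lt.mpr (show m - k < n - i by omega)]
          simp
      · rw [Nat.descFactorial_eq_zero_iff_lt.mpr (by omega)]; simp
    have hfin : (N.factorial : ℝ) * ∑ i ∈ Finset.range (n + 1),
        c i * ((k.descFactorial i : ℝ) * ((m - k).descFactorial (n - i) : ℝ)) =
        (k.factorial * (m - k).factorial : ℝ) * ∑ i ∈ Finset.range (n + 1),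
          c i * (if i ≤ k then (N.choose (k - i) : ℝ) else 0) := by
      rw [Finset.mul_sum, Finset.mul_sum]
      apply Finset.sum_congr rfl
      intro i hi
      have := hid i hi
      linear_combination c i * this
    have hl : 0 < (N.factorial : ℝ) * ∑ i ∈ Finset.range (n + 1),
        c i * ((k.descFactorial i : ℝ) * ((m - k).descFactorial (n - i) : ℝ)) :=
      mul_pos (by positivity) hS
    rw [hfin] at hl
    exact (pos_of_mul_pos_right hl (by positivity)).le
  · apply le_of_eq
    symm
    apply Finset.sum_eq_zero
    intro i hi
    rw [Finset.mem_range] at hi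
    rw [Nat.choose_eq_zero_of_lt (show N < k - i by omega)]
    simp

theorem lattice_pos (m : ℤ → ℝ) (L : ℕ) (lam d0 d1 : ℝ) (hl : 1 < lam) (hd0 : 0 < d0)
    (hd1 : 0 < d1) (h0 : ∀ l : ℤ, l ≤ 0 → m l = lam ^ l * d0)
    (h1 : ∀ l : ℤ, (L : ℤ) ≤ l → m l = d1)
    (hmid : ∀ z : ℝ, 1 / lam < z → z < 1 → ∃ S, 0 < S ∧ HasSum (fun l : ℤ => m l * z ^ l) S) :
    ∃ J : ℕ, L ≤ J ∧ ∀ z : ℝ, 0 < z → 0 < ∑ l ∈ Finset.Icc (-(J : ℤ)) J, m l * z ^ l := by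
  have hl0 : 0 < lam := by linarith
  set T : ℕ → ℝ → ℝ := fun J z => ∑ l ∈ Finset.Icc (-(J : ℤ)) J, m l * z ^ l with hT
  have hm0 : ∀ l : ℤ, l ≤ 0 → 0 < m l := fun l h => by rw [h0 l h]; positivity
  have hm1 : ∀ l : ℤ, (L : ℤ) ≤ l → 0 < m l := fun l h => by rw [h1 l h]; exact hd1
  have hmono : ∀ J J' : ℕ, L ≤ J → J ≤ J' → ∀ z, 0 < z → T J z ≤ T J' z := by
    intro J J' hJ hJJ z hz
    apply Finset.sum_le_sum_of_subset_of_nonneg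
    · apply Finset.Icc_subset_Icc <;> omega
    · intro l hl hl'
      rw [Finset.mem_Icc] at hl hl'
      have : 0 < m l := by
        by_cases h : l ≤ 0
        · exact hm0 l h
        · exact hm1 l (by omega)
      positivity
  set B : ℝ := ∑ l ∈ Finset.Icc (0 : ℤ) L, |m l| with hB
  have hsplit : ∀ J : ℕ, L ≤ J → ∀ z, T J z = ∑ l ∈ Finset.Icc (0 : ℤ) L, m l * z ^ l +
      ∑ l ∈ Finset.Icc (-(J : ℤ)) J \ Finset.Icc (0 : ℤ) L, m l * z ^ l := by
    intro J hJ z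
    rw [add_comm]; symm
    apply Finset.sum_sdiff
    apply Finset.Icc_subset_Icc <;> omega
  have hrest : ∀ J : ℕ, ∀ l ∈ Finset.Icc (-(J : ℤ)) J \ Finset.Icc (0 : ℤ) L, 0 < m l := by
    intro J l h
    simp only [Finset.mem_sdiff, Finset.mem_Icc] at h
    by_cases h' : l ≤ 0
    · exact hm0 l h'
    · exact hm1 l (by omega)
  obtain ⟨K, hK⟩ := exists_nat_gt (B / d1 + B / d0)
  have hB0 : 0 ≤ B := Finset.sum_nonneg fun _ _ => abs_nonneg _
  have hK1 : B < K * d1 := by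
    rw [← div_lt_iff₀ hd1]; have : 0 ≤ B / d0 := by positivity
    linarith
  have hK0 : B < K * d0 := by
    rw [← div_lt_iff₀ hd0]; have : 0 ≤ B / d1 := by positivity
    linarith
  have hge1 : ∀ z, 1 ≤ z → 0 < T (L + K) z := by
    intro z hz
    have hz0 : 0 < z := by linarith
    rw [hsplit _ (by omega)]
    have e1 : -(z ^ (L : ℤ) * B) ≤ ∑ l ∈ Finset.Icc (0 : ℤ) L, m l * z ^ l := by
      rw [hB, Finset.mul_sum, ← Finset.sum_neg_distrib]
      apply Finset.sum_le_sum
      intro l hl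
      rw [Finset.mem_Icc] at hl
      have h2 : z ^ l ≤ z ^ (L : ℤ) := zpow_le_zpow_right₀ hz hl.2
      have h3 : 0 < z ^ l := by positivity
      have h4 := neg_abs_le (m l)
      have h5 := abs_nonneg (m l)
      nlinarith [mul_le_mul_of_nonneg_right h2 h5, mul_le_mul_of_nonneg_right h4 h3.le]
    have e2 : z ^ (L : ℤ) * (K * d1) ≤
        ∑ l ∈ Finset.Icc (-((L + K : ℕ) : ℤ)) (L + K : ℕ) \ Finset.Icc (0 : ℤ) L, m l * z ^ l := by
      calc z ^ (L : ℤ) * (K * d1) = ∑ l ∈ Finset.Ioc (L : ℤ) (L + K : ℕ), z ^ (L : ℤ) * d1 := by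
            rw [Finset.sum_const]; simp; ring
        _ ≤ ∑ l ∈ Finset.Ioc (L : ℤ) (L + K : ℕ), m l * z ^ l := by
            apply Finset.sum_le_sum
            intro l hl
            rw [Finset.mem_Ioc] at hl
            rw [h1 l hl.1.le, mul_comm]
            exact mul_le_mul_of_nonneg_left (zpow_le_zpow_right₀ hz hl.1.le) hd1.le
        _ ≤ _ := by
            apply Finset.sum_le_sum_of_subset_of_nonneg
            · intro l hl
              simp only [Finset.mem_sdiff, Finset.mem_Icc, Finset.mem_Ioc] at hl ⊢
              omega
            · intro l hl _
              have := hrest _ l hl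
              positivity
    have e3 : 0 < z ^ (L : ℤ) := by positivity
    nlinarith [mul_pos e3 (sub_pos.2 hK1)]
  have hle : ∀ z, 0 < z → z ≤ 1 / lam → 0 < T (L + K) z := by
    intro z hz0 hz
    have hz1 : z ≤ 1 := hz.trans (by rw [div_le_one hl0]; exact hl.le)
    have hlz : lam * z ≤ 1 := by rwa [le_div_iff₀ hl0, mul_comm] at hz
    rw [hsplit _ (by omega)]
    have e1 : -B ≤ ∑ l ∈ Finset.Icc (0 : ℤ) L, m l * z ^ l := by
      rw [hB, ← Finset.sum_neg_distrib]
      apply Finset.sum_le_sum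
      intro l hl
      rw [Finset.mem_Icc] at hl
      have h2 : z ^ l ≤ 1 := zpow_le_one₀ hz0 hz1 hl.1
      have h3 : 0 < z ^ l := by positivity
      have h4 := neg_abs_le (m l)
      have h5 := abs_nonneg (m l)
      nlinarith [mul_le_mul_of_nonneg_right h2 h5, mul_le_mul_of_nonneg_right h4 h3.le]
    have e2 : (K * d0) ≤
        ∑ l ∈ Finset.Icc (-((L + K : ℕ) : ℤ)) (L + K : ℕ) \ Finset.Icc (0 : ℤ) L, m l * z ^ l := by
      calc (K * d0) = ∑ l ∈ Finset.Ico (-(K : ℤ)) 0, d0 := by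
            rw [Finset.sum_const]; simp
        _ ≤ ∑ l ∈ Finset.Ico (-(K : ℤ)) 0, m l * z ^ l := by
            apply Finset.sum_le_sum
            intro l hl
            rw [Finset.mem_Ico] at hl
            rw [h0 l hl.2.le, mul_right_comm, ← mul_zpow]
            have : 1 ≤ (lam * z) ^ l := one_le_zpow_of_nonpos₀ (by positivity) hlz hl.2.le
            nlinarith
        _ ≤ _ := by
            apply Finset.sum_le_sum_of_subset_of_nonneg
            · intro l hl
              simp only [Finset.mem_sdiff, Finset.mem_Icc, Finset.mem_Ico] at hl ⊢
              omega
            · intro l hl _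
              have := hrest _ l hl
              positivity
    linarith
  have hcomp : ∃ J : ℕ, L + K ≤ J ∧ ∀ z ∈ Set.Icc (1 / lam) 1, 0 < T J z := by
    refine (isCompact_Icc (a := 1 / lam) (b := (1 : ℝ))).induction_on
      (p := fun s => ∃ J : ℕ, L + K ≤ J ∧ ∀ z ∈ s ∩ Set.Icc (1 / lam) 1, 0 < T J z) ?_ ?_ ?_ ?_
      |>.imp fun J hJ => ⟨hJ.1, fun z hz => hJ.2 z ⟨hz, hz⟩⟩
    · exact ⟨L + K, le_rfl, fun z hz => hz.1.elim⟩
    · rintro s t hst ⟨J, hJ, h⟩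
      exact ⟨J, hJ, fun z hz => h z ⟨hst hz.1, hz.2⟩⟩
    · rintro s t ⟨J, hJ, h⟩ ⟨J', hJ', h'⟩
      refine ⟨max J J', by omega, ?_⟩
      rintro z ⟨hz, hz'⟩
      have hzp : 0 < z := lt_of_lt_of_le (by positivity) hz'.1
      rcases hz with hz | hz
      · exact (h z ⟨hz, hz'⟩).trans_le (hmono _ _ (by omega) (by omega) _ hzp)
      · exact (h' z ⟨hz, hz'⟩).trans_le (hmono _ _ (by omega) (by omega) _ hzp)
    · intro z hz
      have hzp : 0 < z := lt_of_lt_of_le (by positivity) hz.1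
      have hpt : ∃ J : ℕ, L + K ≤ J ∧ 0 < T J z := by
        rcases hz.1.eq_or_lt with h | h
        · exact ⟨L + K, le_rfl, hle z hzp h.symm.le⟩
        rcases hz.2.eq_or_lt with h' | h'
        · exact ⟨L + K, le_rfl, hge1 z h'.symm.le⟩
        obtain ⟨S, hS, hsum⟩ := hmid z h h'
        have ht : Filter.Tendsto (fun J : ℕ => Finset.Icc (-(J : ℤ)) J) Filter.atTop Filter.atTop := by
          apply Filter.tendsto_atTop_finset_of_monotone
          · intro i j hij
            apply Finset.Icc_subset_Icc <;> omega
          · intro x; exact ⟨x.natAbs, by rw [Finset.mem_Icc]; omega⟩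
        have hev := (hsum.comp ht).eventually_const_lt hS
        obtain ⟨J, hJ, hJ'⟩ := (hev.and (Filter.eventually_ge_atTop (L + K))).exists
        exact ⟨J, hJ', hJ⟩
      obtain ⟨J, hJ, hpos⟩ := hpt
      have hc : ContinuousAt (T J) z := by
        simp only [hT]
        refine tendsto_finsetSum _ fun l _ => ?_
        exact continuousAt_const.mul (continuousAt_zpow₀ z l (Or.inl hzp.ne'))
      exact ⟨_, mem_nhdsWithin_of_mem_nhds (hc.eventually_const_lt hpos), J, hJ,
        fun w hw => hw.1⟩
  obtain ⟨J, hJ, hJJ⟩ := hcomp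
  refine ⟨J, by omega, fun z hz => ?_⟩
  by_cases hz1 : 1 ≤ z
  · exact (hge1 z hz1).trans_le (hmono _ _ (by omega) hJ _ hz)
  by_cases hz2 : z ≤ 1 / lam
  · exact (hle z hz hz2).trans_le (hmono _ _ (by omega) hJ _ hz)
  · exact hJJ z ⟨by linarith, by linarith⟩

theorem lattice_polya (m : ℤ → ℝ) (L : ℕ) (lam d0 d1 : ℝ) (hl : 1 < lam) (hd0 : 0 < d0)
    (hd1 : 0 < d1) (h0 : ∀ l : ℤ, l ≤ 0 → m l = lam ^ l * d0)
    (h1 : ∀ l : ℤ, (L : ℤ) ≤ l → m l = d1)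
    (hmid : ∀ z : ℝ, 1 / lam < z → z < 1 → ∃ S, 0 < S ∧ HasSum (fun l : ℤ => m l * z ^ l) S) :
    ∃ N : ℕ, ∀ j : ℕ, 0 ≤ ∑ i ∈ Finset.range (N + 1), (N.choose i : ℝ) * m ((j : ℤ) - i) := by
  obtain ⟨J, hJ, hpos⟩ := lattice_pos m L lam d0 d1 hl hd0 hd1 h0 h1 hmid
  have hm0 : ∀ l : ℤ, l ≤ 0 → 0 < m l := fun l h => by
    rw [h0 l h]; have : 0 < lam := by linarith
    positivity
  have hm1 : ∀ l : ℤ, (L : ℤ) ≤ l → 0 < m l := fun l h => by rw [h1 l h]; exact hd1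
  obtain ⟨N, hN⟩ := polya_coeff (2 * J) (fun i => m ((i : ℤ) - J)) (by
    intro z hz
    have h := mul_pos (pow_pos hz J) (hpos z hz)
    rw [Finset.mul_sum] at h
    refine lt_of_lt_of_eq h ?_
    symm
    refine Finset.sum_bij' (fun i _ => (i : ℤ) - J) (fun l _ => (l + J).toNat) ?_ ?_ ?_ ?_ ?_
    · intro i hi; simp only [Finset.mem_range, Finset.mem_Icc] at *; omega
    · intro i hi; simp only [Finset.mem_range, Finset.mem_Icc] at *; omega
    · intro i hi; simp
    · intro i hi; simp only [Finset.mem_range, Finset.mem_Icc] at *; omega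
    · intro i hi
      rw [zpow_sub₀ hz.ne', zpow_natCast, zpow_natCast]
      field_simp) (hm0 _ (by omega)) (hm1 _ (by push_cast; omega))
  refine ⟨N, fun j => ?_⟩
  refine (hN (j + J)).trans ?_
  have e : ∑ i ∈ Finset.range (2 * J + 1), m ((i : ℤ) - J) *
      (if i ≤ j + J then (N.choose (j + J - i) : ℝ) else 0) =
      ∑ i ∈ (Finset.range (N + 1)).filter (fun i : ℕ => i ≤ j + J ∧ j ≤ i + J),
        (N.choose i : ℝ) * m ((j : ℤ) - i) := by
    simp only [mul_ite, mul_zero]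
    rw [← Finset.sum_filter]
    have hs : ∑ a ∈ Finset.range (2 * J + 1) with a ≤ j + J,
        m ((a : ℤ) - J) * ((N.choose (j + J - a) : ℕ) : ℝ) =
        ∑ a ∈ Finset.range (2 * J + 1) with (a ≤ j + J ∧ j + J - a ≤ N),
        m ((a : ℤ) - J) * ((N.choose (j + J - a) : ℕ) : ℝ) := by
      symm
      apply Finset.sum_subset
      · intro a; simp only [Finset.mem_filter]; tauto
      · intro a ha hb
        simp only [Finset.mem_filter] at ha hb
        rw [Nat.choose_eq_zero_of_lt (by
          by_contra h; exact hb ⟨ha.1, ha.2, by omega⟩)]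
        simp
    rw [hs]
    refine Finset.sum_bij' (fun i _ => j + J - i) (fun i _ => j + J - i) ?_ ?_ ?_ ?_ ?_
    · intro i hi; simp only [Finset.mem_range, Finset.mem_filter] at *; omega
    · intro i hi; simp only [Finset.mem_range, Finset.mem_filter] at *; omega
    · intro i hi; simp only [Finset.mem_range, Finset.mem_filter] at *; omega
    · intro i hi; simp only [Finset.mem_range, Finset.mem_filter] at *; omega
    · intro i hi
      simp only [Finset.mem_range, Finset.mem_filter] at *
      rw [mul_comm]; congr 2; omega
  rw [e]
  apply Finset.sum_le_sum_of_subset_of_nonneg (Finset.filter_subset _ _)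
  intro i hi hi'
  simp only [Finset.mem_filter, not_and] at hi'
  have : 0 < m ((j : ℤ) - i) := by
    by_cases h : (j : ℤ) - i ≤ 0
    · exact hm0 _ h
    · apply hm1
      have := hi' hi
      omega
  positivity

theorem GoodF.weak2 {f : ∀ (X : Type) [Fintype X], (X → ℝ) → ℝ} (hf : GoodF f)
    (X Y : Type) [Fintype X] [Fintype Y] (p : X → ℝ) (q : Y → ℝ) (hp : ∀ x, 0 ≤ p x)
    (hq : ∀ x, 0 ≤ q x)
    (h : ∀ x, ∑ y, min (p y) (p x) ≤ ∑ y, min (q y) (p x)) :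
    f X p ≤ f Y q := by
  rw [hf.inv X (X ⊕ Y) Function.Embedding.inl p (Sum.elim p (fun _ => 0)) hp (fun x => rfl)
    (by rintro (x | y) h
        · exact ⟨x, rfl⟩
        · simp at h)]
  rw [hf.inv Y (X ⊕ Y) Function.Embedding.inr q (Sum.elim (fun _ => 0) q) hq (fun x => rfl)
    (by rintro (x | y) h
        · simp at h
        · exact ⟨y, rfl⟩)]
  apply hf.weak
  · rintro (x | y) <;> simp [hp]
  · rintro (x | y) <;> simp [hq]
  · rintro (x | y)
    · simp only [Fintype.sum_sum_type, Sum.elim_inl, Sum.elim_inr, min_eq_left (hp x)]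
      simpa using h x
    · simp [hp, hq]

theorem GoodF.pos {f : ∀ (X : Type) [Fintype X], (X → ℝ) → ℝ} (hf : GoodF f)
    (X : Type) [Fintype X] (p : X → ℝ) (hp : ∀ x, 0 ≤ p x) (x0 : X) (h0 : 0 < p x0) :
    0 < f X p := by
  classical
  have h1 : f Unit (fun _ => p x0) = p x0 := by
    have := hf.smul Unit (p x0) (fun _ => 1) h0.le (fun _ => zero_le_one)
    simpa [hf.one] using this
  have h2 := hf.inv Unit X ⟨fun _ => x0, fun _ _ _ => rfl⟩ (fun _ => p x0)
    (fun x => if x = x0 then p x0 else 0) (fun _ => h0.le) (fun _ => if_pos rfl)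
    (fun x' hx => ⟨(), by by_contra hne; simp at hx hne; exact hne hx.1.symm⟩)
  have h3 := hf.mono X (fun x => if x = x0 then p x0 else 0) p
    (fun x => by split_ifs; exacts [h0.le, le_rfl])
    (fun x => by split_ifs with h; exacts [h ▸ le_rfl, hp x])
  linarith

/-- Comparison on a geometric lattice. -/
theorem GoodF.lattice {f : ∀ (X : Type) [Fintype X], (X → ℝ) → ℝ} (hf : GoodF f)
    (X Y : Type) [Fintype X] [Fintype Y] (a : X → ℕ) (b : Y → ℕ) (lam : ℝ) (hl : 1 < lam)
    (h : ∀ z ∈ Set.Icc (1 / lam) 1, ∑ x, z ^ a x < ∑ y, z ^ b y) :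
    f X (fun x => lam ^ (-(a x : ℤ))) ≤ f Y (fun y => lam ^ (-(b y : ℤ))) := by
  classical
  have hl0 : 0 < lam := by linarith
  set κ : ℤ → ℝ := fun l => min (lam ^ l) 1 with hκ
  have hk0 : ∀ l, l ≤ 0 → κ l = lam ^ l := fun l hl' => by
    simp only [hκ]; exact min_eq_left (zpow_le_one_of_nonpos₀ hl.le hl')
  have hk1 : ∀ l, 0 ≤ l → κ l = 1 := fun l hl' => by
    simp only [hκ]; exact min_eq_right (one_le_zpow₀ hl.le hl')
  have hkpos : ∀ l, 0 < κ l := fun l => by simp only [hκ]; positivity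
  set m : ℤ → ℝ := fun l => ∑ y, κ (l - b y) - ∑ x, κ (l - a x) with hm
  set D : ℝ → ℝ := fun z => ∑ y, z ^ b y - ∑ x, z ^ a x with hD
  have hlinv : 1 / lam ≤ 1 := by rw [div_le_one hl0]; exact hl.le
  have hDpos : ∀ z ∈ Set.Icc (1 / lam) 1, 0 < D z := fun z hz => sub_pos.2 (h z hz)
  obtain ⟨N, hN⟩ := lattice_polya m (∑ x, a x + ∑ y, b y) lam (D (1 / lam)) (D 1) hl
    (hDpos _ ⟨le_rfl, hlinv⟩) (hDpos _ ⟨hlinv, le_rfl⟩) (by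
      intro l hl'
      simp only [hm, hD, mul_sub, Finset.mul_sum]
      congr 1
      · apply Finset.sum_congr rfl
        intro y _
        rw [hk0 _ (by omega), zpow_sub₀ hl0.ne', one_div, inv_pow, zpow_natCast]; rfl
      · apply Finset.sum_congr rfl
        intro y _
        rw [hk0 _ (by omega), zpow_sub₀ hl0.ne', one_div, inv_pow, zpow_natCast]; rfl) (by
      intro l hl'
      simp only [hm, hD, one_pow]
      congr 1
      · apply Finset.sum_congr rfl
        intro y _
        have := Finset.single_le_sum (f := b) (fun _ _ => Nat.zero_le _) (Finset.mem_univ y)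
        rw [hk1 _ (by omega)]
      · apply Finset.sum_congr rfl
        intro x _
        have := Finset.single_le_sum (f := a) (fun _ _ => Nat.zero_le _) (Finset.mem_univ x)
        rw [hk1 _ (by omega)]) (by
      intro z hz1 hz2
      have hz : 0 < z := lt_trans (by positivity) hz1
      have hlz : 1 < lam * z := by rwa [div_lt_iff₀ hl0, mul_comm] at hz1
      have hs : Summable (fun l : ℤ => κ l * z ^ l) := by
        apply Summable.of_nat_of_neg
        · have := summable_geometric_of_lt_one hz.le hz2
          refine this.congr fun n => ?_
          rw [hk1 _ (by omega), one_mul, zpow_natCast]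
        · have := summable_geometric_of_lt_one (r := (lam * z)⁻¹) (by positivity)
            (inv_lt_one_of_one_lt₀ hlz)
          refine this.congr fun n => ?_
          rw [hk0 _ (by omega), ← mul_zpow, zpow_neg, zpow_natCast, inv_pow]
      obtain ⟨K, hK⟩ := hs
      have hKpos : 0 < K := by
        have h1 := le_hasSum hK 0 (fun l _ => by have := hkpos l; positivity)
        have h2 : 0 < κ 0 * z ^ (0 : ℤ) := by have := hkpos 0; positivity
        linarith
      have hsh : ∀ c : ℕ, HasSum (fun l : ℤ => κ (l - c) * z ^ l) (z ^ c * K) := by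
        intro c
        have h1 := ((Equiv.subRight (c : ℤ)).hasSum_iff.2 hK).mul_left (z ^ c)
        refine h1.congr_fun ?_ |> fun h => h
        intro l
        simp only [Function.comp, Equiv.subRight_apply]
        rw [zpow_sub₀ hz.ne', zpow_natCast]
        field_simp
      refine ⟨D z * K, mul_pos (hDpos z ⟨hz1.le, hz2.le⟩) hKpos, ?_⟩
      have hy := hasSum_sum (s := Finset.univ) (fun y _ => hsh (b y))
      have hx := hasSum_sum (s := Finset.univ) (fun x _ => hsh (a x))
      have := hy.sub hx
      simp only [hm, hD, sub_mul, Finset.sum_mul]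
      exact this)
  set r : Finset (Fin N) → ℝ := fun s => lam ^ (-(s.card : ℤ)) with hr
  have hr0 : ∀ s, 0 ≤ r s := fun s => by simp only [hr]; positivity
  have hfr : 0 < f _ r := hf.pos _ r hr0 ∅ (by simp only [hr]; positivity)
  have hp0 : ∀ x, 0 ≤ lam ^ (-(a x : ℤ)) := fun x => by positivity
  have hq0 : ∀ x, 0 ≤ lam ^ (-(b x : ℤ)) := fun x => by positivity
  have key : ∀ (Z : Type) [Fintype Z] (c : Z → ℕ) (j : ℕ),
      ∑ y : Z × Finset (Fin N), min (lam ^ (-(c y.1 : ℤ)) * r y.2) (lam ^ (-(j : ℤ))) =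
      lam ^ (-(j : ℤ)) * ∑ i ∈ Finset.range (N + 1), (N.choose i : ℝ) * ∑ z, κ (j - i - c z) := by
    intro Z _ c j
    have e1 := Finset.sum_powerset_apply_card (fun i => ∑ z, κ ((j : ℤ) - i - c z))
      (x := (Finset.univ : Finset (Fin N)))
    simp only [Finset.powerset_univ, Finset.card_univ, Fintype.card_fin, nsmul_eq_mul] at e1
    rw [← e1, Fintype.sum_prod_type_right, Finset.mul_sum]
    apply Finset.sum_congr rfl
    intro s _
    rw [Finset.mul_sum]
    apply Finset.sum_congr rfl
    intro z _
    simp only [hκ, hr]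
    rw [mul_min_of_nonneg _ _ (by positivity), mul_one, ← zpow_add₀ hl0.ne', ← zpow_add₀ hl0.ne']
    congr 2; ring
  have hmain := hf.weak2 (X × Finset (Fin N)) (Y × Finset (Fin N))
    (fun z => lam ^ (-(a z.1 : ℤ)) * r z.2) (fun z => lam ^ (-(b z.1 : ℤ)) * r z.2)
    (fun z => mul_nonneg (hp0 _) (hr0 _)) (fun z => mul_nonneg (hq0 _) (hr0 _)) (by
      rintro ⟨x0, s0⟩
      have ej : lam ^ (-(a x0 : ℤ)) * r s0 = lam ^ (-((a x0 + s0.card : ℕ) : ℤ)) := by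
        simp only [hr]; rw [← zpow_add₀ hl0.ne']; congr 1; push_cast; ring
      simp only [ej]
      rw [key X a, key Y b]
      apply mul_le_mul_of_nonneg_left _ (by positivity)
      have := hN (a x0 + s0.card)
      simp only [hm, mul_sub, Finset.sum_sub_distrib] at this
      linarith)
  rw [hf.mul X (Finset (Fin N)) (fun x => lam ^ (-(a x : ℤ))) r hp0 hr0,
    hf.mul Y (Finset (Fin N)) (fun x => lam ^ (-(b x : ℤ))) r hq0 hr0] at hmain
  exact le_of_mul_le_mul_right hmain hfr

theorem GoodF.strict {f : ∀ (X : Type) [Fintype X], (X → ℝ) → ℝ} (hf : GoodF f)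
    (X Y : Type) [Fintype X] [Fintype Y] (p : X → ℝ) (q : Y → ℝ) (hp : ∀ x, 0 < p x)
    (hq : ∀ x, 0 < q x)
    (h : ∀ t ∈ Set.Icc (0 : ℝ) 1, ∑ x, p x ^ t < ∑ y, q y ^ t) :
    f X p ≤ f Y q := by
  have hev : ∀ᶠ lam in nhds (1 : ℝ), ∀ t ∈ Set.Icc (0 : ℝ) 1,
      0 < ∑ y, q y ^ t - lam ^ 2 * ∑ x, p x ^ t := by
    apply isCompact_Icc.eventually_forall_of_forall_eventually
    intro t ht
    have hc : Continuous (fun z : ℝ × ℝ => ∑ y, q y ^ z.2 - z.1 ^ 2 * ∑ x, p x ^ z.2) := by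
      refine Continuous.sub (continuous_finsetSum _ fun y _ => ?_)
        (Continuous.mul (by fun_prop) (continuous_finsetSum _ fun y _ => ?_))
      · exact (Real.continuous_const_rpow (hq y).ne').comp continuous_snd
      · exact (Real.continuous_const_rpow (hp y).ne').comp continuous_snd
    refine (hc.continuousAt (x := ((1 : ℝ), t))).eventually_const_lt ?_
    have := h t ht
    simp only [one_pow, one_mul]
    linarith
  obtain ⟨lam, hlam, hl⟩ := ((hev.filter_mono nhdsWithin_le_nhds).and
    (self_mem_nhdsWithin (s := Set.Ioi (1 : ℝ)))).exists
  replace hl : 1 < lam := hl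
  have hl0 : 0 < lam := by linarith
  obtain ⟨M, hM0, hMp, hMq⟩ : ∃ M : ℝ, 0 < M ∧ (∀ x, p x ≤ M) ∧ (∀ y, q y ≤ M) := by
    refine ⟨∑ x, p x + ∑ y, q y + 1, ?_, fun x => ?_, fun y => ?_⟩
    · have h1 := Finset.sum_nonneg (s := Finset.univ) (fun x _ => (hp x).le)
      have h2 := Finset.sum_nonneg (s := Finset.univ) (fun x _ => (hq x).le)
      linarith
    · have h1 := Finset.single_le_sum (fun x _ => (hp x).le) (Finset.mem_univ x)
      have h2 := Finset.sum_nonneg (s := Finset.univ) (fun x _ => (hq x).le)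
      linarith
    · have h1 := Finset.single_le_sum (fun x _ => (hq x).le) (Finset.mem_univ y)
      have h2 := Finset.sum_nonneg (s := Finset.univ) (fun x _ => (hp x).le)
      linarith
  have hround : ∀ w : ℝ, 0 < w → w ≤ M → ∃ a : ℕ, w ≤ M * lam ^ (-(a : ℤ)) ∧
      lam ^ (-(a : ℤ)) ≤ lam * w / M := by
    intro w hw hwM
    have h1 : 1 ≤ M / w := by rwa [one_le_div hw]
    obtain ⟨a, ha1, ha2⟩ := exists_nat_pow_near h1 hl
    refine ⟨a, ?_, ?_⟩
    · rw [zpow_neg, zpow_natCast, ← div_eq_mul_inv, le_div_iff₀ (by positivity)]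
      rw [le_div_iff₀ hw] at ha1; linarith
    · rw [zpow_neg, zpow_natCast, inv_le_iff_one_le_mul₀ (by positivity)]
      rw [div_lt_iff₀ hw, pow_succ] at ha2
      rw [div_mul_eq_mul_div, le_div_iff₀ hM0]
      nlinarith
  have hround' : ∀ w : ℝ, 0 < w → w ≤ M → ∃ b : ℕ, M * lam ^ (-(b : ℤ)) ≤ w ∧
      w / (lam * M) ≤ lam ^ (-(b : ℤ)) := by
    intro w hw hwM
    obtain ⟨a, h1, h2⟩ := hround w hw hwM
    refine ⟨a + 1, ?_, ?_⟩
    · push_cast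
      rw [neg_add, zpow_add₀ hl0.ne', zpow_neg_one]
      rw [le_div_iff₀ hM0] at h2
      rw [← mul_assoc, ← div_eq_mul_inv, div_le_iff₀ hl0]
      linarith
    · push_cast
      rw [neg_add, zpow_add₀ hl0.ne', zpow_neg_one, ← div_eq_mul_inv, div_le_div_iff₀ (by positivity) hl0]
      nlinarith
  choose a ha1 ha2 using fun x => hround (p x) (hp x) (hMp x)
  choose b hb1 hb2 using fun y => hround' (q y) (hq y) (hMq y)
  have hlat := hf.lattice X Y a b lam hl (by
    rintro z ⟨hz1, hz2⟩
    have hz0 : 0 < z := lt_of_lt_of_le (by positivity) hz1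
    obtain ⟨t, ht0, ht1, rfl⟩ : ∃ t : ℝ, 0 ≤ t ∧ t ≤ 1 ∧ z = lam ^ (-t) := by
      refine ⟨-Real.logb lam z, ?_, ?_, ?_⟩
      · have := Real.logb_nonpos hl hz0.le hz2
        linarith
      · have : Real.logb lam (1 / lam) ≤ Real.logb lam z :=
          Real.logb_le_logb_of_le hl (by positivity) hz1
        rw [one_div, Real.logb_inv, Real.logb_self_eq_one hl] at this
        linarith
      · rw [neg_neg, Real.rpow_logb hl0 hl.ne' hz0]
    have hconv : ∀ c : ℕ, (lam ^ (-t)) ^ c = (lam ^ (-(c : ℤ))) ^ t := by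
      intro c
      rw [← Real.rpow_natCast, ← Real.rpow_mul hl0.le, ← Real.rpow_intCast, ← Real.rpow_mul hl0.le]
      congr 1; push_cast; ring
    have hlt1 : lam ^ t ≤ lam := by
      calc lam ^ t ≤ lam ^ (1 : ℝ) := Real.rpow_le_rpow_of_exponent_le hl.le ht1
        _ = lam := Real.rpow_one _
    have hMt : 0 < M ^ t := Real.rpow_pos_of_pos hM0 _
    have hlt : 0 < lam ^ t := Real.rpow_pos_of_pos hl0 _
    have hX : ∑ x, (lam ^ (-t)) ^ a x ≤ lam / M ^ t * ∑ x, p x ^ t := by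
      rw [Finset.mul_sum]
      apply Finset.sum_le_sum
      intro x _
      rw [hconv]
      have hpt : 0 < p x ^ t := Real.rpow_pos_of_pos (hp x) _
      calc (lam ^ (-(a x : ℤ))) ^ t ≤ (lam * p x / M) ^ t :=
            Real.rpow_le_rpow (by positivity) (ha2 x) ht0
        _ = lam ^ t / M ^ t * p x ^ t := by
            rw [Real.div_rpow (mul_pos hl0 (hp x)).le hM0.le, Real.mul_rpow hl0.le (hp x).le]; ring
        _ ≤ _ := by gcongr
    have hY : 1 / (lam * M ^ t) * ∑ y, q y ^ t ≤ ∑ y, (lam ^ (-t)) ^ b y := by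
      rw [Finset.mul_sum]
      apply Finset.sum_le_sum
      intro y _
      rw [hconv]
      have hpt : 0 < q y ^ t := Real.rpow_pos_of_pos (hq y) _
      calc 1 / (lam * M ^ t) * q y ^ t ≤ 1 / (lam ^ t * M ^ t) * q y ^ t := by gcongr
        _ = (q y / (lam * M)) ^ t := by
            rw [Real.div_rpow (hq y).le (by positivity), Real.mul_rpow hl0.le hM0.le]; ring
        _ ≤ (lam ^ (-(b y : ℤ))) ^ t :=
            Real.rpow_le_rpow (div_nonneg (hq y).le (by positivity)) (hb2 y) ht0
    refine hX.trans_lt (lt_of_lt_of_le ?_ hY)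
    have h3 := hlam t ⟨ht0, ht1⟩
    rw [div_mul_eq_mul_div, div_mul_eq_mul_div, div_lt_div_iff₀ hMt (by positivity)]
    nlinarith)
  calc f X p ≤ f X (fun x => M * lam ^ (-(a x : ℤ))) := hf.mono _ _ _ (fun x => (hp x).le) ha1
    _ = M * f X (fun x => lam ^ (-(a x : ℤ))) := hf.smul _ _ _ hM0.le (fun x => by positivity)
    _ ≤ M * f Y (fun y => lam ^ (-(b y : ℤ))) := mul_le_mul_of_nonneg_left hlat hM0.le
    _ = f Y (fun y => M * lam ^ (-(b y : ℤ))) := (hf.smul _ _ _ hM0.le (fun x => by positivity)).symm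
    _ ≤ f Y q := hf.mono _ _ _ (fun y => by positivity) hb1

theorem GoodF.power {f : ∀ (X : Type) [Fintype X], (X → ℝ) → ℝ} (hf : GoodF f)
    (X : Type) [Fintype X] (p : X → ℝ) (hp : ∀ x, 0 < p x) (n : ℕ) :
    ∃ (Z : Type) (_ : Fintype Z) (r : Z → ℝ), (∀ z, 0 < r z) ∧
      (∀ t : ℝ, ∑ z, r z ^ t = (∑ x, p x ^ t) ^ n) ∧ f Z r = f X p ^ n := by
  induction n with
  | zero => exact ⟨Unit, inferInstance, fun _ => 1, by simp, by simp, by simp [hf.one]⟩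
  | succ n ih =>
    obtain ⟨Z, _, r, h1, h2, h3⟩ := ih
    refine ⟨Z × X, inferInstance, fun z => r z.1 * p z.2, fun z => mul_pos (h1 _) (hp _), ?_, ?_⟩
    · intro t
      rw [pow_succ, ← h2, Finset.sum_mul_sum, Fintype.sum_prod_type]
      refine Finset.sum_congr rfl fun z _ => Finset.sum_congr rfl fun x _ => ?_
      exact Real.mul_rpow (h1 _).le (hp _).le
    · rw [hf.mul Z X r p (fun z => (h1 z).le) (fun x => (hp x).le), h3, pow_succ]

theorem GoodF.compare {f : ∀ (X : Type) [Fintype X], (X → ℝ) → ℝ} (hf : GoodF f)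
    (X Y : Type) [Fintype X] [Fintype Y] [Nonempty Y] (p : X → ℝ) (q : Y → ℝ) (hp : ∀ x, 0 < p x)
    (hq : ∀ x, 0 < q x)
    (h : ∀ t ∈ Set.Icc (0 : ℝ) 1, ∑ x, p x ^ t ≤ ∑ y, q y ^ t) :
    f X p ≤ f Y q := by
  have hfq : 0 < f Y q := hf.pos Y q (fun y => (hq y).le) (Classical.arbitrary Y) (hq _)
  have hn : ∀ n : ℕ, f X p ^ n ≤ f Y q ^ n * f Bool (fun _ => 1) := by
    intro n
    obtain ⟨Z, _, r, hr, hrt, hrf⟩ := hf.power X p hp n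
    obtain ⟨W, _, s, hs, hst, hsf⟩ := hf.power Y q hq n
    rw [← hrf, ← hsf, ← hf.mul W Bool s (fun _ => 1) (fun z => (hs z).le) (fun _ => zero_le_one)]
    apply hf.strict _ _ _ _ hr (fun z => by simpa using hs z.1)
    intro t ht
    rw [hrt, Fintype.sum_prod_type]
    simp only [mul_one, Finset.sum_const, Finset.card_univ, Fintype.card_bool]
    rw [← Finset.smul_sum, hst, two_nsmul]
    have h1 : 0 < ∑ y, q y ^ t :=
      Finset.sum_pos (fun y _ => Real.rpow_pos_of_pos (hq y) _) Finset.univ_nonempty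
    have h2 : 0 ≤ ∑ x, p x ^ t := Finset.sum_nonneg fun x _ => (Real.rpow_pos_of_pos (hp x) _).le
    have h3 := pow_le_pow_left₀ h2 (h t ht) n
    have h4 := pow_pos h1 n
    linarith
  by_contra hlt
  push Not at hlt
  have hr1 : 1 < f X p / f Y q := by rwa [one_lt_div hfq]
  obtain ⟨n, hn'⟩ := pow_unbounded_of_one_lt (f Bool (fun _ => 1)) hr1
  have := hn n
  rw [div_pow, lt_div_iff₀ (pow_pos hfq n)] at hn'
  linarith

theorem abstract_ext (A : AddSubmonoid (C(unitInterval, ℝ) × ℝ)) (c1 : ℝ)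
    (h1 : ((1 : C(unitInterval, ℝ)), c1) ∈ A)
    (hmono : ∀ u ∈ A, ∀ v ∈ A, u.1 ≤ v.1 → u.2 ≤ v.2)
    (hnn : ∀ u ∈ A, (0 : C(unitInterval, ℝ)) ≤ u.1) :
    ∃ L : C(unitInterval, ℝ) →ₗ[ℝ] ℝ, (∀ h, 0 ≤ h → 0 ≤ L h) ∧ ∀ u ∈ A, L u.1 = u.2 := by
  have hc0 : ∀ u ∈ A, 0 ≤ u.2 := fun u hu => hmono 0 A.zero_mem u hu (hnn u hu)
  have claim : ∀ w ∈ Submodule.span ℝ (A : Set (C(unitInterval, ℝ) × ℝ)), 0 ≤ w.1 → 0 ≤ w.2 := by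
    intro w hw hw0
    obtain ⟨n, c, g, rfl⟩ := Submodule.mem_span_set'.1 hw
    set C : ℝ := ∑ i, (g i : C(unitInterval, ℝ) × ℝ).2 with hC
    have hIntg : ∀ k : Fin n → ℤ, 0 ≤ ∑ i, (k i : ℝ) • (g i : C(unitInterval, ℝ) × ℝ).1 →
        0 ≤ ∑ i, (k i : ℝ) * (g i : C(unitInterval, ℝ) × ℝ).2 := by
      intro k hk
      have e : ∀ i, (k i : ℝ) = ((k i).toNat : ℝ) - ((-k i).toNat : ℝ) := by
        intro i
        have := Int.toNat_sub_toNat_neg (k i)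
        exact_mod_cast this.symm
      have hp : ∑ i, (k i).toNat • (g i : C(unitInterval, ℝ) × ℝ) ∈ A :=
        sum_mem fun i _ => A.nsmul_mem (g i).2 _
      have hm : ∑ i, (-k i).toNat • (g i : C(unitInterval, ℝ) × ℝ) ∈ A :=
        sum_mem fun i _ => A.nsmul_mem (g i).2 _
      have := hmono _ hm _ hp (by
        rw [← sub_nonneg]
        refine le_of_le_of_eq hk ?_
        rw [Prod.fst_sum, Prod.fst_sum, ← Finset.sum_sub_distrib]
        refine Finset.sum_congr rfl fun i _ => ?_
        rw [e i, sub_smul, Prod.smul_fst, Prod.smul_fst, Nat.cast_smul_eq_nsmul,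
          Nat.cast_smul_eq_nsmul])
      rw [Prod.snd_sum, Prod.snd_sum] at this
      rw [← sub_nonneg] at this
      refine le_of_le_of_eq this ?_
      rw [← Finset.sum_sub_distrib]
      refine Finset.sum_congr rfl fun i _ => ?_
      rw [e i, sub_mul, Prod.smul_snd, Prod.smul_snd, nsmul_eq_mul, nsmul_eq_mul]
    set w : C(unitInterval, ℝ) × ℝ := ∑ i, c i • (g i : C(unitInterval, ℝ) × ℝ) with hwdef
    have hw1 : w.1 = ∑ i, c i • (g i : C(unitInterval, ℝ) × ℝ).1 := by
      rw [hwdef, Prod.fst_sum]; rfl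
    have hw2 : w.2 = ∑ i, c i * (g i : C(unitInterval, ℝ) × ℝ).2 := by
      rw [hwdef, Prod.snd_sum]; rfl
    have hN : ∀ N : ℕ, 0 ≤ N * w.2 + C := by
      intro N
      have h2 := hIntg (fun i => ⌈N * c i⌉) (by
        have h3 : (0 : C(unitInterval, ℝ)) ≤ (N : ℝ) • w.1 := smul_nonneg (Nat.cast_nonneg N) hw0
        refine h3.trans ?_
        rw [hw1, Finset.smul_sum]
        refine Finset.sum_le_sum fun i _ => ?_
        rw [smul_smul]
        exact smul_le_smul_of_nonneg_right (Int.le_ceil _) (hnn _ (g i).2))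
      refine h2.trans ?_
      rw [hw2, hC, Finset.mul_sum, ← Finset.sum_add_distrib]
      refine Finset.sum_le_sum fun i _ => ?_
      have h3 := (Int.ceil_lt_add_one ((N : ℝ) * c i)).le
      have h4 := mul_le_mul_of_nonneg_right h3 (hc0 _ (g i).2)
      linarith
    by_contra hneg
    push Not at hneg
    obtain ⟨N, hN'⟩ := exists_nat_gt (C / (-w.2))
    rw [div_lt_iff₀ (by linarith)] at hN'
    have := hN N
    linarith
  let s : PointedCone ℝ (C(unitInterval, ℝ) × ℝ) :=
    { carrier := {w | 0 ≤ w.1}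
      add_mem' := fun {a b} ha hb => add_nonneg (show 0 ≤ a.1 from ha) (show 0 ≤ b.1 from hb)
      zero_mem' := le_refl (0 : C(unitInterval, ℝ))
      smul_mem' := fun c x hx => by
        have : (0 : C(unitInterval, ℝ)) ≤ (c : ℝ) • x.1 := smul_nonneg c.2 hx
        exact this }
  have hs : ∀ w, w ∈ s ↔ 0 ≤ w.1 := fun w => Iff.rfl
  let φ : (C(unitInterval, ℝ) × ℝ) →ₗ.[ℝ] ℝ :=
    ⟨Submodule.span ℝ (A : Set (C(unitInterval, ℝ) × ℝ)),
      (LinearMap.snd ℝ C(unitInterval, ℝ) ℝ).comp (Submodule.subtype _)⟩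
  obtain ⟨g, hg1, hg2⟩ := riesz_extension s φ (fun x hx => claim _ x.2 hx) (by
    intro y
    refine ⟨⟨‖y.1‖ • (1, c1), Submodule.smul_mem _ _ (Submodule.subset_span h1)⟩, ?_⟩
    rw [hs]
    intro t
    have h3 := y.1.norm_coe_le_norm t
    rw [Real.norm_eq_abs] at h3
    have h4 := neg_abs_le (y.1 t)
    simp
    linarith)
  have hg0 : ∀ c : ℝ, g (0, c) = 0 := by
    intro c
    have e1 := hg2 (0, c) (le_refl (0 : C(unitInterval, ℝ)))
    have e2 := hg2 (-(0, c)) (by rw [hs]; simp)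
    rw [map_neg] at e2
    linarith
  refine ⟨g.comp (LinearMap.inl ℝ _ _), fun h hh => hg2 _ hh, fun u hu => ?_⟩
  have e1 : g u = u.2 := hg1 ⟨u, Submodule.subset_span hu⟩
  have e2 : u = (u.1, 0) + (0, u.2) := by simp
  rw [e2, map_add, hg0, add_zero] at e1
  simpa using e1

/-- The Rényi entropy as a function of the real order. -/
def hfun {X : Type} [Fintype X] (p : X → ℝ) (t : ℝ) : ℝ :=
  if t = 1 then -∑ x, p x * log2 (p x) else (1 - t)⁻¹ * log2 (∑ x, p x ^ t)

theorem hfun_continuous {X : Type} [Fintype X] [Nonempty X] (p : X → ℝ) (hp : ∀ x, 0 < p x)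
    (hs : ∑ x, p x = 1) : Continuous (hfun p) := by
  set G : ℝ → ℝ := fun t => log2 (∑ x, p x ^ t) with hG
  have hpos : ∀ t : ℝ, 0 < ∑ x, p x ^ t := fun t =>
    Finset.sum_pos (fun y _ => Real.rpow_pos_of_pos (hp y) _) Finset.univ_nonempty
  have hd : HasDerivAt G (∑ x, p x * log2 (p x)) 1 := by
    have h1 : HasDerivAt (fun t : ℝ => ∑ x, p x ^ t) (∑ x, Real.log (p x) * p x ^ (1 : ℝ)) 1 := by
      apply HasDerivAt.fun_sum
      intro x _
      have := (hasDerivAt_id (1 : ℝ)).const_rpow (hp x)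
      simpa [mul_comm] using this
    have h2 := (h1.log (hpos 1).ne').div_const (Real.log 2)
    have e : (∑ x, Real.log (p x) * p x ^ (1 : ℝ)) / (∑ x, p x ^ (1 : ℝ)) / Real.log 2 =
        ∑ x, p x * log2 (p x) := by
      simp only [Real.rpow_one, hs, div_one, Finset.sum_div]
      refine Finset.sum_congr rfl fun x _ => ?_
      simp only [log2, Real.logb]; ring
    rw [e] at h2
    exact h2
  have hc : Continuous G := by
    simp only [hG, log2, Real.logb]
    refine Continuous.div_const (Continuous.log ?_ fun t => (hpos t).ne') _
    exact continuous_finsetSum _ fun y _ => Real.continuous_const_rpow (hp y).ne'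
  have e : hfun p = fun t => -dslope G 1 t := by
    funext t
    unfold hfun
    split_ifs with ht
    · rw [ht, dslope_same, hd.deriv]
    · rw [dslope_of_ne _ ht, slope_def_field]
      have : G 1 = 0 := by simp [hG, hs, log2]
      rw [this, sub_zero, div_eq_inv_mul, ← neg_mul, ← inv_neg, neg_sub]
  rw [e]
  refine Continuous.neg (continuous_iff_continuousAt.2 fun t => ?_)
  by_cases ht : t = 1
  · rw [ht, continuousAt_dslope_same]; exact hd.differentiableAt
  · rw [continuousAt_dslope_of_ne ht]; exact hc.continuousAt

theorem hfun_renyi {X : Type} [Fintype X] (p : X → ℝ) (hp : ∀ x, 0 < p x) (t : ℝ) (ht : 0 ≤ t) :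
    renyi (ENNReal.ofReal t) p = hfun p t := by
  unfold renyi hfun
  by_cases h0 : t = 0
  · subst h0
    simp [hp]
  have h0' : ENNReal.ofReal t ≠ 0 := by
    rw [Ne, ENNReal.ofReal_eq_zero, not_le]; exact lt_of_le_of_ne ht (Ne.symm h0)
  have h1 : ENNReal.ofReal t = 1 ↔ t = 1 := by
    rw [ENNReal.ofReal_eq_one]
  simp only [h0', h1, if_false, ENNReal.ofReal_ne_top, ENNReal.toReal_ofReal ht]

theorem hfun_mul {X Y : Type} [Fintype X] [Fintype Y] [Nonempty X] [Nonempty Y] (p : X → ℝ)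
    (q : Y → ℝ) (hp : ∀ x, 0 < p x) (hq : ∀ x, 0 < q x) (hsp : ∑ x, p x = 1) (hsq : ∑ x, q x = 1)
    (t : ℝ) : hfun (fun z : X × Y => p z.1 * q z.2) t = hfun p t + hfun q t := by
  unfold hfun
  split_ifs with ht
  · rw [← neg_add, Fintype.sum_prod_type]
    congr 1
    have e : ∀ x y, p x * q y * log2 (p x * q y) =
        (p x * log2 (p x)) * q y + p x * (q y * log2 (q y)) := by
      intro x y
      unfold log2
      rw [Real.logb_mul (hp x).ne' (hq y).ne']; ring
    simp only [e, Finset.sum_add_distrib, ← Finset.mul_sum, ← Finset.sum_mul, hsp, hsq]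
    ring
  · rw [← mul_add]
    congr 1
    have e : ∑ z : X × Y, (p z.1 * q z.2) ^ t = (∑ x, p x ^ t) * ∑ y, q y ^ t := by
      rw [Finset.sum_mul_sum, Fintype.sum_prod_type]
      refine Finset.sum_congr rfl fun z _ => Finset.sum_congr rfl fun x _ => ?_
      exact Real.mul_rpow (hp _).le (hq _).le
    rw [e]
    unfold log2
    rw [Real.logb_mul]
    · exact (Finset.sum_pos (fun y _ => Real.rpow_pos_of_pos (hp y) _) Finset.univ_nonempty).ne'
    · exact (Finset.sum_pos (fun y _ => Real.rpow_pos_of_pos (hq y) _) Finset.univ_nonempty).ne'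

theorem hfun_nonneg {X : Type} [Fintype X] [Nonempty X] (p : X → ℝ) (hp : ∀ x, 0 < p x)
    (hs : ∑ x, p x = 1) (t : ℝ) (ht1 : t ≤ 1) : 0 ≤ hfun p t := by
  have hle : ∀ x, p x ≤ 1 := fun x => by
    rw [← hs]; exact Finset.single_le_sum (fun x _ => (hp x).le) (Finset.mem_univ x)
  unfold hfun
  split_ifs with ht
  · rw [neg_nonneg]
    refine Finset.sum_nonpos fun x _ => ?_
    exact mul_nonpos_of_nonneg_of_nonpos (hp x).le
      (Real.logb_nonpos one_lt_two (hp x).le (hle x))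
  · have h1 : 0 < 1 - t := by
      have := lt_of_le_of_ne ht1 ht
      linarith
    refine mul_nonneg (inv_nonneg.2 h1.le) (Real.logb_nonneg one_lt_two ?_)
    rw [← hs]
    refine Finset.sum_le_sum fun x _ => ?_
    calc p x = p x ^ (1 : ℝ) := (Real.rpow_one _).symm
      _ ≤ p x ^ t := Real.rpow_le_rpow_of_exponent_ge (hp x) (hle x) ht1

theorem hfun_compare {X Y : Type} [Fintype X] [Fintype Y] [Nonempty X] [Nonempty Y] (p : X → ℝ)
    (q : Y → ℝ) (hp : ∀ x, 0 < p x) (hq : ∀ x, 0 < q x) (hsp : ∑ x, p x = 1) (hsq : ∑ x, q x = 1)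
    (t : ℝ) (ht : t ≤ 1) (h : hfun p t ≤ hfun q t) : ∑ x, p x ^ t ≤ ∑ y, q y ^ t := by
  by_cases h1 : t = 1
  · subst h1; simp [hsp, hsq]
  · unfold hfun at h
    rw [if_neg h1, if_neg h1] at h
    have h2 : 0 < 1 - t := by
      have := lt_of_le_of_ne ht h1
      linarith
    have h3 := le_of_mul_le_mul_left h (inv_pos.2 h2)
    refine (Real.logb_le_logb one_lt_two ?_ ?_).1 h3
    · exact Finset.sum_pos (fun y _ => Real.rpow_pos_of_pos (hp y) _) Finset.univ_nonempty
    · exact Finset.sum_pos (fun y _ => Real.rpow_pos_of_pos (hq y) _) Finset.univ_nonempty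

/-- Positive functionals on `C([0,1])` are measures on `[0,∞]`. -/
theorem riesz_ennreal (L : C(unitInterval, ℝ) →ₗ[ℝ] ℝ) (hL : ∀ h, 0 ≤ h → 0 ≤ L h) :
    ∃ μ : Measure ℝ≥0∞, IsFiniteMeasure μ ∧ ∀ (h : C(unitInterval, ℝ)) (g : ℝ≥0∞ → ℝ),
      (∀ t : unitInterval, g (ENNReal.ofReal t) = h t) → ∫ α, g α ∂μ = L h := by
  let Λ : CompactlySupportedContinuousMap unitInterval ℝ →ₚ[ℝ] ℝ := PositiveLinearMap.mk₀
    { toFun := fun h => L h.toContinuousMap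
      map_add' := fun a b => L.map_add a.toContinuousMap b.toContinuousMap
      map_smul' := fun c a => L.map_smul c a.toContinuousMap }
    (fun h hh => hL _ hh)
  let ν := RealRMK.rieszMeasure Λ
  let ι : unitInterval → ℝ≥0∞ := fun t => ENNReal.ofReal t
  have hιc : Continuous ι := ENNReal.continuous_ofReal.comp continuous_subtype_val
  have hιi : Function.Injective ι := by
    intro a b hab
    have := (ENNReal.ofReal_eq_ofReal_iff a.2.1 b.2.1).1 hab
    exact Subtype.ext this
  have hιm : MeasurableEmbedding ι := (hιc.isClosedEmbedding hιi).measurableEmbedding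
  refine ⟨ν.map ι, inferInstance, fun h g hg => ?_⟩
  rw [hιm.integral_map]
  have e := RealRMK.integral_rieszMeasure Λ (CompactlySupportedContinuousMap.continuousMapEquiv h)
  have e2 : ∀ t, g (ι t) = h t := hg
  simp only [e2]
  exact e

theorem sum_support {X : Type} [Fintype X] (p F : X → ℝ) [Fintype {x // 0 < p x}]
    (hF : ∀ x, ¬ 0 < p x → F x = 0) :
    ∑ x, F x = ∑ z : {x // 0 < p x}, F z := by
  classical
  rw [← Finset.sum_subtype (Finset.univ.filter fun x => 0 < p x) (fun x => by simp) F]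
  symm
  apply Finset.sum_subset (Finset.subset_univ _)
  intro x _ hx
  exact hF x (by simpa using hx)

theorem renyi_support {X : Type} [Fintype X] (p : X → ℝ) (hp : ∀ x, 0 ≤ p x)
    [Fintype {x // 0 < p x}] (α : ℝ≥0∞) (hα : α ≠ ⊤) :
    renyi α p = renyi α (fun z : {x // 0 < p x} => p z) := by
  have hz : ∀ x, ¬ 0 < p x → p x = 0 := fun x h => le_antisymm (not_lt.1 h) (hp x)
  unfold renyi
  split_ifs with h0 h1
  · congr 2
    exact (Nat.card_congr (Equiv.subtypeUnivEquiv (fun z : {x // 0 < p x} => z.2))).symm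
  · rw [sum_support p (fun x => p x * log2 (p x)) (fun x h => by rw [hz x h, zero_mul])]
  · rw [sum_support p (fun x => p x ^ α.toReal) (fun x h => by
      rw [hz x h, Real.zero_rpow]
      exact (ENNReal.toReal_pos h0 hα).ne')]

theorem GoodF.repr {f : ∀ (X : Type) [Fintype X], (X → ℝ) → ℝ} (hf : GoodF f) :
    ∃ μ : Measure ℝ≥0∞, IsFiniteMeasure μ ∧ ∀ (X : Type) [Fintype X] (p : X → ℝ),
      (∀ x, 0 ≤ p x) → ∑ x, p x = 1 → f X p = exp2 (∫ α, renyi α p ∂μ) := by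
  classical
  let A : AddSubmonoid (C(unitInterval, ℝ) × ℝ) :=
    { carrier := {u | ∃ (X : Type) (_ : Fintype X) (_ : Nonempty X) (p : X → ℝ),
        (∀ x, 0 < p x) ∧ ∑ x, p x = 1 ∧ (∀ t : unitInterval, u.1 t = hfun p t) ∧
        u.2 = log2 (f X p)}
      zero_mem' := by
        refine ⟨Unit, inferInstance, inferInstance, fun _ => 1, fun _ => one_pos, by simp, ?_, ?_⟩
        · intro t; simp [hfun, log2]
        · rw [hf.one]; simp [log2]
      add_mem' := by
        rintro u v ⟨X, _, _, p, hp, hps, hpt, hpf⟩ ⟨Y, _, _, q, hq, hqs, hqt, hqf⟩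
        refine ⟨X × Y, inferInstance, inferInstance, fun z => p z.1 * q z.2,
          fun z => mul_pos (hp _) (hq _), ?_, ?_, ?_⟩
        · rw [Fintype.sum_prod_type]
          simp only [← Finset.mul_sum, hqs, mul_one, hps]
        · intro t
          rw [hfun_mul p q hp hq hps hqs, ← hpt, ← hqt]; rfl
        · rw [hf.mul X Y p q (fun x => (hp x).le) (fun x => (hq x).le)]
          unfold log2
          rw [Real.logb_mul]
          · rw [Prod.snd_add, hpf, hqf]; rfl
          · exact (hf.pos X p (fun x => (hp x).le) (Classical.arbitrary X) (hp _)).ne'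
          · exact (hf.pos Y q (fun x => (hq x).le) (Classical.arbitrary Y) (hq _)).ne' }
  have hA : ∀ u, u ∈ A ↔ ∃ (X : Type) (_ : Fintype X) (_ : Nonempty X) (p : X → ℝ),
        (∀ x, 0 < p x) ∧ ∑ x, p x = 1 ∧ (∀ t : unitInterval, u.1 t = hfun p t) ∧
        u.2 = log2 (f X p) := fun u => Iff.rfl
  obtain ⟨L, hL, hLA⟩ := abstract_ext A (log2 (f Bool (fun _ => 1 / 2))) (by
      rw [hA]
      refine ⟨Bool, inferInstance, inferInstance, fun _ => 1 / 2, fun _ => by norm_num,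
        by simp, ?_, rfl⟩
      intro t
      have hlog : log2 (1 / 2) = -1 := by
        unfold log2; rw [one_div, Real.logb_inv, Real.logb_self_eq_one one_lt_two]
      unfold hfun
      split_ifs with ht
      · simp only [hlog]; simp
      · have h1 : (1 : ℝ) - t ≠ 0 := sub_ne_zero.2 (Ne.symm ht)
        have e : ∑ _x : Bool, (1 / 2 : ℝ) ^ (t : ℝ) = 2 ^ (1 - (t : ℝ)) := by
          rw [Finset.sum_const, Finset.card_univ, Fintype.card_bool, two_nsmul, ← two_mul,
            one_div, Real.inv_rpow two_pos.le, Real.rpow_sub two_pos, Real.rpow_one]; rfl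
        have e3 : log2 (2 ^ (1 - (t : ℝ))) = 1 - t := Real.logb_rpow two_pos one_lt_two.ne'
        rw [e, e3, inv_mul_cancel₀ h1]; rfl)
    (by
      rintro u ⟨X, _, _, p, hp, hps, hpt, hpf⟩ v ⟨Y, _, _, q, hq, hqs, hqt, hqf⟩ huv
      rw [hpf, hqf]
      refine Real.logb_le_logb_of_le one_lt_two
        (hf.pos X p (fun x => (hp x).le) (Classical.arbitrary X) (hp _)) ?_
      refine hf.compare X Y p q hp hq fun t ht => ?_
      refine hfun_compare p q hp hq hps hqs t ht.2 ?_
      have := huv ⟨t, ht⟩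
      have h1 := hpt ⟨t, ht⟩
      have h2 := hqt ⟨t, ht⟩
      calc hfun p t = u.1 ⟨t, ht⟩ := h1.symm
        _ ≤ v.1 ⟨t, ht⟩ := this
        _ = hfun q t := h2)
    (by
      rintro u ⟨X, _, _, p, hp, hps, hpt, hpf⟩ t
      change (0 : ℝ) ≤ u.1 t
      rw [hpt]
      exact hfun_nonneg p hp hps _ t.2.2)
  obtain ⟨μ, hμ, hIntg⟩ := riesz_ennreal L hL
  refine ⟨μ, hμ, fun X _ p hp hps => ?_⟩
  have hs' : ∑ z : {x // 0 < p x}, p z = 1 := by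
    rw [← hps, ← sum_support p p (fun x h => le_antisymm (not_lt.1 h) (hp x))]
  have : Nonempty {x // 0 < p x} := by
    by_contra h
    rw [not_nonempty_iff] at h
    simp at hs'
  have e1 : f {x // 0 < p x} (fun z => p z) = f X p :=
    hf.inv _ _ (Function.Embedding.subtype _) _ _ (fun z => z.2.le) (fun z => rfl)
      (fun x hx => ⟨⟨x, lt_of_le_of_ne (hp x) (Ne.symm hx)⟩, rfl⟩)
  let h : C(unitInterval, ℝ) := ⟨fun t => hfun (fun z : {x // 0 < p x} => p z) t,
    (hfun_continuous _ (fun z => z.2) hs').comp continuous_subtype_val⟩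
  have hmem : (h, log2 (f {x // 0 < p x} (fun z => p z))) ∈ A :=
    ⟨_, inferInstance, inferInstance, _, fun z => z.2, hs', fun t => rfl, rfl⟩
  rw [hIntg h (fun α => renyi α p) (fun t => by
    rw [renyi_support p hp _ ENNReal.ofReal_ne_top, hfun_renyi _ (fun z => z.2) _ t.2.1]; rfl)]
  rw [hLA _ hmem, ← e1]
  have hpos : 0 < f {x // 0 < p x} (fun z => p z) :=
    hf.pos _ _ (fun z => z.2.le) (Classical.arbitrary _) (Classical.arbitrary {x // 0 < p x}).2
  unfold exp2 log2
  rw [Real.rpow_logb two_pos one_lt_two.ne' hpos]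

/-- Classification of monotone homomorphisms (temperate case `ℝ₊`): every
nonnegative functional on nonnegative matrices which is invariant under permutations and
zero-padding, additive under direct sums, multiplicative under Kronecker products, normalized,
and monotone under conditionally mixing channels has the stated exponential-barycentre form
for some finite positive Borel measure `μ` on `[0,∞]`. -/
theorem monotone_homomorphism_classification
    (Φ : ∀ (X Y : Type) [Fintype X] [Fintype Y], Matrix X Y ℝ → ℝ)
    (h_nonneg : ∀ (X Y : Type) [Fintype X] [Fintype Y] (P : Matrix X Y ℝ),
      (∀ x y, 0 ≤ P x y) → 0 ≤ Φ X Y P)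
    (h_inv : ∀ (X Y X' Y' : Type) [Fintype X] [Fintype Y] [Fintype X'] [Fintype Y']
      (P : Matrix X Y ℝ) (P' : Matrix X' Y' ℝ),
      (∀ x y, 0 ≤ P x y) → Embeds P P' → Φ X Y P = Φ X' Y' P')
    (h_add : ∀ (X Y X' Y' : Type) [Fintype X] [Fintype Y] [Fintype X'] [Fintype Y']
      (P : Matrix X Y ℝ) (Q : Matrix X' Y' ℝ),
      (∀ x y, 0 ≤ P x y) → (∀ x y, 0 ≤ Q x y) →
      Φ (X ⊕ X') (Y ⊕ Y') (Matrix.fromBlocks P 0 0 Q) = Φ X Y P + Φ X' Y' Q)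
    (h_mul : ∀ (X Y X' Y' : Type) [Fintype X] [Fintype Y] [Fintype X'] [Fintype Y']
      (P : Matrix X Y ℝ) (Q : Matrix X' Y' ℝ),
      (∀ x y, 0 ≤ P x y) → (∀ x y, 0 ≤ Q x y) →
      Φ (X × X') (Y × Y') (kron P Q) = Φ X Y P * Φ X' Y' Q)
    (h_zero : Φ (Fin 1) (Fin 1) 0 = 0)
    (h_one : Φ (Fin 1) (Fin 1) (Matrix.of fun _ _ => (1 : ℝ)) = 1)
    (h_mono : ∀ (X Y Y' : Type) [Fintype X] [Fintype Y] [Fintype Y']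
      (P : Matrix X Y ℝ) (Q : Matrix X Y' ℝ),
      (∀ x y, 0 ≤ P x y) → CondMixed P Q → Φ X Y P ≤ Φ X Y' Q) :
    ∃ μ : Measure ℝ≥0∞, IsFiniteMeasure μ ∧
      ∀ (X Y : Type) [Fintype X] [Fintype Y] (P : Matrix X Y ℝ), (∀ x y, 0 ≤ P x y) →
        Φ X Y P = ∑ y ∈ Finset.univ.filter (fun y => 0 < margY P y),
          margY P y * exp2 (∫ α, renyi α (condX P y) ∂μ) := by
  obtain ⟨f, hf, hΦ⟩ := phi_main Φ h_nonneg h_inv h_add h_mul h_zero h_one h_mono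
  obtain ⟨μ, hμ, hrep⟩ := hf.repr
  refine ⟨μ, hμ, fun X Y _ _ P hP => ?_⟩
  rw [hΦ X Y P hP]
  have hm0 : ∀ y, 0 ≤ margY P y := fun y => Finset.sum_nonneg fun x _ => hP x y
  symm
  rw [Finset.sum_filter]
  refine Finset.sum_congr rfl fun y _ => ?_
  split_ifs with hy
  · have hc : ∀ x, 0 ≤ condX P y x := fun x => div_nonneg (hP x y) hy.le
    rw [← hrep X (condX P y) hc (by
      unfold condX
      rw [← Finset.sum_div]
      exact div_self hy.ne'), ← hf.smul X _ _ hy.le hc]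
    congr 1
    funext x
    unfold condX
    field_simp
  · have h0 : margY P y = 0 := le_antisymm (not_lt.1 hy) (hm0 y)
    have hx : ∀ x, P x y = 0 := fun x =>
      (Finset.sum_eq_zero_iff_of_nonneg (fun x _ => hP x y)).1 h0 x (Finset.mem_univ x)
    have := hf.smul X 0 (fun x => P x y) le_rfl (fun x => hP x y)
    simp only [hx, mul_zero, zero_mul] at this
    simp only [hx, this]
end
end
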